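/- Assume that the sequence (MMSE_n)_{n≥1} converges uniformly in λ on compact subsets of ℝ₊. Then for all σ, λ > 0, lim_{n→∞} MMSE_n(σ,λ) = σ⁴ if λ ≤ 1/σ⁴, and lim_{n→∞} MMSE_n(σ,λ) = 2/λ − 1/(λ²σ⁴) if λ ≥ 1/σ⁴. -/

import Mathlib

open MeasureTheory ProbabilityTheory Filter Matrix

noncomputable section

instance {n : ℕ} : MeasurableSpace (Matrix (Fin n) (Fin n) ℝ) :=
  inferInstanceAs (MeasurableSpace (Fin n → Fin n → ℝ))

/-- Squared Frobenius norm of a matrix. -/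
def frobSq {n : ℕ} (M : Matrix (Fin n) (Fin n) ℝ) : ℝ := ∑ i, ∑ j, (M i j) ^ 2

/-- i.i.d. centered Gaussian prior with variance `v` on `ℝⁿ`. -/
def gaussPrior (n : ℕ) (v : ℝ) : Measure (Fin n → ℝ) :=
  Measure.pi fun _ => gaussianReal 0 (Real.toNNReal v)

/-- Law of the symmetric noise matrix `Z`: independent `N(0,1)` entries above the
diagonal and `N(0,2)` entries on the diagonal, extended symmetrically. -/
def noiseMeasure (n : ℕ) : Measure (Matrix (Fin n) (Fin n) ℝ) :=
  (Measure.pi fun p : Fin n × Fin n =>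
      gaussianReal 0 (if p.1 = p.2 then 2 else 1)).map
    (fun g => Matrix.of fun i j => if i ≤ j then g (i, j) else g (j, i))

/-- Observation matrix `Y = √(λ/n) s sᵀ + Z`. -/
def obs (n : ℕ) (lam : ℝ) (s : Fin n → ℝ) (Z : Matrix (Fin n) (Fin n) ℝ) :
    Matrix (Fin n) (Fin n) ℝ :=
  Real.sqrt (lam / n) • Matrix.vecMulVec s s + Z

/-- Posterior weight `exp(−¼‖Y−√(λ'/n) x xᵀ‖_F²)`. -/
def weight (n : ℕ) (lam' : ℝ) (Y : Matrix (Fin n) (Fin n) ℝ) (x : Fin n → ℝ) : ℝ :=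
  Real.exp (-(1 / 4) * frobSq (Y - Real.sqrt (lam' / n) • Matrix.vecMulVec x x))

/-- Gibbs (mismatched posterior) average `⟨f(x)⟩_{λ',σ'}` of an observable `f`. -/
def gibbs (n : ℕ) (sig' lam' : ℝ) (Y : Matrix (Fin n) (Fin n) ℝ)
    (f : (Fin n → ℝ) → ℝ) : ℝ :=
  (∫ x, f x * weight n lam' Y x ∂gaussPrior n (sig' ^ 2)) /
    (∫ x, weight n lam' Y x ∂gaussPrior n (sig' ^ 2))

/-- Posterior mean matrix `⟨x xᵀ⟩_{λ',σ'}`. -/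
def gibbsMatrix (n : ℕ) (sig' lam' : ℝ) (Y : Matrix (Fin n) (Fin n) ℝ) :
    Matrix (Fin n) (Fin n) ℝ :=
  Matrix.of fun i j => gibbs n sig' lam' Y (fun x => x i * x j)

/-- Mismatched matrix-MSE `MSE_n(σ,σ',λ,λ')`. -/
def MSE (n : ℕ) (sig sig' lam lam' : ℝ) : ℝ :=
  (1 / (n : ℝ) ^ 2) *
    ∫ p, frobSq (Matrix.vecMulVec p.1 p.1 -
        gibbsMatrix n sig' lam' (obs n lam p.1 p.2))
      ∂((gaussPrior n (sig ^ 2)).prod (noiseMeasure n))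

/-- Matrix-MMSE: the matched (Bayes-optimal) matrix-MSE. -/
def MMSE (n : ℕ) (sig lam : ℝ) : ℝ := MSE n sig sig lam lam

namespace Aux

/-- Measurable functions with all moments. -/
def AM {α : Type*} [MeasurableSpace α] (μ : Measure α) (f : α → ℝ) : Prop :=
  Measurable f ∧ ∀ k : ℕ, Integrable (fun x => |f x| ^ k) μ

section AMlemmas
variable {α : Type*} [MeasurableSpace α] {μ : Measure α} {f g : α → ℝ}

lemma AM.integrable (hf : AM μ f) : Integrable f μ := by
  have h := hf.2 1
  simp only [pow_one] at h
  exact (integrable_norm_iff hf.1.aestronglyMeasurable).1 h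

lemma AM.const [IsFiniteMeasure μ] (c : ℝ) : AM μ (fun _ => c) :=
  ⟨measurable_const, fun _ => integrable_const _⟩

lemma AM.mul (hf : AM μ f) (hg : AM μ g) : AM μ (fun x => f x * g x) := by
  refine ⟨hf.1.mul hg.1, fun k => ?_⟩
  refine ((hf.2 (2 * k)).add (hg.2 (2 * k))).mono'
    (((hf.1.mul hg.1).abs.pow_const k).aestronglyMeasurable) (Eventually.of_forall fun x => ?_)
  simp only [Pi.add_apply, Real.norm_eq_abs, abs_pow, abs_abs, abs_mul, mul_pow]
  have h1 : |f x| ^ (2 * k) = (|f x| ^ k) ^ 2 := by rw [← pow_mul, mul_comm]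
  have h2 : |g x| ^ (2 * k) = (|g x| ^ k) ^ 2 := by rw [← pow_mul, mul_comm]
  rw [h1, h2]
  nlinarith [sq_nonneg (|f x| ^ k - |g x| ^ k), sq_nonneg (|f x| ^ k), sq_nonneg (|g x| ^ k)]

lemma AM.add (hf : AM μ f) (hg : AM μ g) : AM μ (fun x => f x + g x) := by
  refine ⟨hf.1.add hg.1, fun k => ?_⟩
  refine (((hf.2 k).add (hg.2 k)).const_mul (2 ^ (k - 1))).mono'
    (((hf.1.add hg.1).abs.pow_const k).aestronglyMeasurable) (Eventually.of_forall fun x => ?_)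
  simp only [Pi.add_apply, Real.norm_eq_abs, abs_pow, abs_abs]
  exact (pow_le_pow_left₀ (abs_nonneg _) (abs_add_le _ _) k).trans
    (add_pow_le (abs_nonneg _) (abs_nonneg _) k)

lemma AM.neg (hf : AM μ f) : AM μ (fun x => - f x) :=
  ⟨hf.1.neg, fun k => by simpa only [abs_neg] using hf.2 k⟩

lemma AM.sub (hf : AM μ f) (hg : AM μ g) : AM μ (fun x => f x - g x) := by
  simpa only [sub_eq_add_neg] using hf.add hg.neg

lemma AM.const_mul (c : ℝ) (hf : AM μ f) : AM μ (fun x => c * f x) := by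
  refine ⟨hf.1.const_mul c, fun k => ?_⟩
  simpa only [abs_mul, mul_pow] using (hf.2 k).const_mul _

lemma AM.div_const (hf : AM μ f) (c : ℝ) : AM μ (fun x => f x / c) := by
  simpa only [div_eq_inv_mul] using hf.const_mul c⁻¹

lemma AM.pow [IsFiniteMeasure μ] (hf : AM μ f) (k : ℕ) : AM μ (fun x => f x ^ k) := by
  induction k with
  | zero => simpa using AM.const 1
  | succ k ih => simpa only [pow_succ] using ih.mul hf

lemma AM.sum [IsFiniteMeasure μ] {ι : Type*} (s : Finset ι) {F : ι → α → ℝ}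
    (h : ∀ i ∈ s, AM μ (F i)) :
    AM μ (fun x => ∑ i ∈ s, F i x) := by
  classical
  induction s using Finset.induction_on with
  | empty => simpa using AM.const 0
  | insert i s hi ih =>
    simp only [Finset.sum_insert hi]
    exact (h i (Finset.mem_insert_self _ _)).add
      (ih fun j hj => h j (Finset.mem_insert_of_mem hj))

lemma AM.comp {β : Type*} [MeasurableSpace β] {ν : Measure β} {T : β → α}
    (hf : AM μ f) (hT : MeasurePreserving T ν μ) : AM ν (fun x => f (T x)) :=
  ⟨hf.1.comp hT.measurable, fun k => hT.integrable_comp_of_integrable (hf.2 k)⟩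

end AMlemmas

/-- Standard Gaussian on `J → ℝ`. -/
def gam (J : Type*) [Fintype J] : Measure (J → ℝ) := Measure.pi fun _ => gaussianReal 0 1

instance (J : Type*) [Fintype J] : IsProbabilityMeasure (gam J) := by
  unfold gam; infer_instance

lemma shift1 (v : ℝ) : gaussianReal v 1 =
    (gaussianReal 0 1).withDensity (fun y => ENNReal.ofReal (Real.exp (v * y - v ^ 2 / 2))) := by
  rw [gaussianReal_of_var_ne_zero _ one_ne_zero, gaussianReal_of_var_ne_zero _ one_ne_zero,
    ← withDensity_mul _ (measurable_gaussianPDF _ _) (by fun_prop)]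
  congr 1
  ext y
  simp only [Pi.mul_apply, gaussianPDF, gaussianPDFReal]
  rw [← ENNReal.ofReal_mul (by positivity), mul_assoc (_)⁻¹ (Real.exp _) (Real.exp _),
    ← Real.exp_add]
  congr 3
  simp
  ring

lemma shiftJ {J : Type*} [Fintype J] (v : J → ℝ) :
    (gam J).map (fun g j => v j + g j) =
    (gam J).withDensity
      (fun y => ENNReal.ofReal (Real.exp (∑ j, (v j * y j - v j ^ 2 / 2)))) := by
  unfold gam
  have h1 : (Measure.pi fun _ : J => gaussianReal 0 1).map (fun g j => v j + g j)
      = Measure.pi (fun j => (gaussianReal 0 1).map (fun t => v j + t)) :=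
    Measure.pi_map_pi (f := fun j t => v j + t) (fun j => by fun_prop)
  rw [h1]
  have h2 : (fun j => (gaussianReal 0 1).map (fun t => v j + t)) = fun j => gaussianReal (v j) 1 := by
    ext1 j
    rw [gaussianReal_map_const_add]; simp
  rw [h2]
  refine Measure.pi_eq fun s hs => ?_
  have hIntg : ∀ j, Integrable (fun y => Real.exp (v j * y - v j ^ 2 / 2)) (gaussianReal 0 1) := by
    intro j
    simp only [sub_eq_add_neg, Real.exp_add]
    exact (integrable_exp_mul_gaussianReal (v j)).mul_const _
  rw [withDensity_apply _ (MeasurableSet.univ_pi hs), Measure.restrict_pi_pi]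
  simp only [Real.exp_sum]
  rw [← ofReal_integral_eq_lintegral_ofReal]
  · rw [integral_fintype_prod_eq_prod (𝕜 := ℝ) (f := fun j y => Real.exp (v j * y - v j ^ 2 / 2)),
      ENNReal.ofReal_prod_of_nonneg]
    · refine Finset.prod_congr rfl fun j _ => ?_
      rw [shift1 (v j), withDensity_apply _ (hs j), ofReal_integral_eq_lintegral_ofReal]
      · exact (hIntg j).integrableOn
      · exact Eventually.of_forall fun _ => (Real.exp_pos _).le
    · intro j _
      exact integral_nonneg fun _ => (Real.exp_pos _).le
  · exact Integrable.fintype_prod (𝕜 := ℝ) (f := fun j y => Real.exp (v j * y - v j ^ 2 / 2))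
      fun j => (hIntg j).integrableOn
  · exact Eventually.of_forall fun _ => Finset.prod_nonneg fun _ _ => (Real.exp_pos _).le

lemma update_mp {J : Type*} [Fintype J] [DecidableEq J] (ν : J → Measure ℝ)
    [∀ j, IsProbabilityMeasure (ν j)] (j : J) :
    MeasurePreserving (fun p : (J → ℝ) × ℝ => Function.update p.1 j p.2)
      ((Measure.pi ν).prod (ν j)) (Measure.pi ν) := by
  have hm : Measurable (fun p : (J → ℝ) × ℝ => Function.update p.1 j p.2) := by
    refine measurable_pi_lambda _ fun k => ?_
    by_cases h : k = j
    · subst h; simpa using measurable_snd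
    · simp only [Function.update_of_ne h]; fun_prop
  refine ⟨hm, ?_⟩
  refine (Measure.pi_eq fun s hs => ?_).symm
  rw [Measure.map_apply hm (MeasurableSet.univ_pi hs)]
  have : (fun p : (J → ℝ) × ℝ => Function.update p.1 j p.2) ⁻¹' (Set.univ.pi s)
      = (Set.univ.pi (Function.update s j Set.univ)) ×ˢ (s j) := by
    ext p
    simp only [Set.mem_preimage, Set.mem_univ_pi, Set.mem_prod]
    constructor
    · intro h
      refine ⟨fun k => ?_, by simpa using h j⟩
      by_cases hk : k = j
      · subst hk; simp
      · simpa [Function.update_of_ne hk] using h k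
    · rintro ⟨h1, h2⟩ k
      by_cases hk : k = j
      · subst hk; simpa using h2
      · simpa [Function.update_of_ne hk] using h1 k
  rw [this, Measure.prod_prod, Measure.pi_pi, ← Finset.mul_prod_erase _ _ (Finset.mem_univ j),
    ← Finset.mul_prod_erase _ (fun i => ν i (s i)) (Finset.mem_univ j)]
  simp only [Function.update_self, measure_univ, one_mul]
  rw [mul_comm]
  congr 1
  refine Finset.prod_congr rfl fun k hk => ?_
  rw [Function.update_of_ne (Finset.ne_of_mem_erase hk)]

lemma stein1 {v : NNReal} (hv : v ≠ 0) {h h' : ℝ → ℝ} (hd : ∀ t, HasDerivAt h (h' t) t)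
    (i1 : Integrable h (gaussianReal 0 v)) (i2 : Integrable (fun t => t * h t) (gaussianReal 0 v))
    (i3 : Integrable h' (gaussianReal 0 v)) :
    ∫ t, t * h t ∂(gaussianReal 0 v) = v * ∫ t, h' t ∂(gaussianReal 0 v) := by
  have conv : ∀ f : ℝ → ℝ, Integrable f (gaussianReal 0 v) →
      Integrable (fun t => gaussianPDFReal 0 v t * f t) := by
    intro f hf
    rw [gaussianReal_of_var_ne_zero _ hv] at hf
    have := (integrable_withDensity_iff_integrable_smul' (measurable_gaussianPDF 0 v)
      (ae_of_all _ fun _ => gaussianPDF_lt_top)).1 hf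
    simpa [toReal_gaussianPDF] using this
  have hv' : (v : ℝ) ≠ 0 := by exact_mod_cast hv
  have hp : ∀ t, HasDerivAt (gaussianPDFReal 0 v) (-(t / v) * gaussianPDFReal 0 v t) t := by
    intro t
    have h1 : HasDerivAt (fun t : ℝ => -(t - 0) ^ 2 / (2 * v)) (-(t / v)) t := by
      have h0 : HasDerivAt (fun t : ℝ => -(t ^ 2) / (2 * (v : ℝ)))
          (-((2 : ℕ) * t ^ (2 - 1)) / (2 * (v : ℝ))) t :=
        ((hasDerivAt_pow 2 t).neg).div_const _
      simp only [sub_zero]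
      refine h0.congr_deriv ?_
      simp; field_simp
    have := (h1.exp).const_mul ((√(2 * Real.pi * v))⁻¹)
    have e : gaussianPDFReal 0 v =
        fun t : ℝ => (√(2 * Real.pi * v))⁻¹ * Real.exp (-(t - 0) ^ 2 / (2 * v)) := by
      rw [gaussianPDFReal_def]
    rw [e]
    refine this.congr_deriv ?_
    ring
  rw [integral_gaussianReal_eq_integral_smul hv, integral_gaussianReal_eq_integral_smul hv]
  have key := integral_mul_deriv_eq_deriv_mul_of_integrable (u := h) (v := gaussianPDFReal 0 v)
    (u' := h') (v' := fun t => -(t / v) * gaussianPDFReal 0 v t)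
    (fun x _ => hd x) (fun x _ => hp x)
    (by
      have := (conv _ i2).const_mul (-(1 / (v : ℝ)))
      refine this.congr (Eventually.of_forall fun t => ?_)
      simp; ring)
    (by
      refine (conv _ i3).congr (Eventually.of_forall fun t => ?_)
      simp; ring)
    (by
      refine (conv _ i1).congr (Eventually.of_forall fun t => ?_)
      simp; ring)
  have e1 : ∫ x, h x * (-(x / v) * gaussianPDFReal 0 v x)
      = -(1 / (v : ℝ)) * ∫ x, gaussianPDFReal 0 v x • (x * h x) := by
    rw [← integral_const_mul]
    congr 1; ext t; simp; ring
  have e2 : ∫ x, h' x * gaussianPDFReal 0 v x = ∫ x, gaussianPDFReal 0 v x • h' x := by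
    congr 1; ext t; simp; ring
  rw [e1, e2] at key
  field_simp at key
  linarith

/-- Gaussian integration by parts in one coordinate of a product measure. -/
lemma steinPi {J : Type*} [Fintype J] [DecidableEq J] {v : NNReal} (hv : v ≠ 0) (j : J)
    {F F' : (J → ℝ) → ℝ}
    (hd : ∀ y t, HasDerivAt (fun t => F (Function.update y j t)) (F' (Function.update y j t)) t)
    (i1 : Integrable F (Measure.pi fun _ : J => gaussianReal 0 v))
    (i2 : Integrable (fun y => y j * F y) (Measure.pi fun _ : J => gaussianReal 0 v))
    (i3 : Integrable F' (Measure.pi fun _ : J => gaussianReal 0 v)) :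
    ∫ y, y j * F y ∂(Measure.pi fun _ : J => gaussianReal 0 v)
      = v * ∫ y, F' y ∂(Measure.pi fun _ : J => gaussianReal 0 v) := by
  have mp := update_mp (fun _ : J => gaussianReal 0 v) j
  have tr : ∀ G : (J → ℝ) → ℝ, Integrable G (Measure.pi fun _ : J => gaussianReal 0 v) →
      ∫ y, G y ∂(Measure.pi fun _ : J => gaussianReal 0 v) =
      ∫ p, G (Function.update p.1 j p.2)
        ∂((Measure.pi fun _ : J => gaussianReal 0 v).prod (gaussianReal 0 v)) := by
    intro G hG
    conv_lhs => rw [← mp.map_eq]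
    rw [integral_map mp.measurable.aemeasurable]
    rw [mp.map_eq]; exact hG.1
  have c1 := mp.integrable_comp_of_integrable i1
  have c2 := mp.integrable_comp_of_integrable i2
  have c3 := mp.integrable_comp_of_integrable i3
  simp only [Function.comp_def] at c1 c2 c3
  rw [tr _ i2, tr _ i3, integral_prod _ c2, integral_prod _ c3, ← integral_const_mul]
  refine integral_congr_ae ?_
  filter_upwards [c1.prod_right_ae, c2.prod_right_ae, c3.prod_right_ae] with y h1 h2 h3
  simp only [Function.comp_def, Function.update_self] at h1 h2 h3 ⊢
  exact stein1 hv (hd y) h1 h2 h3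

/-- Integration by parts in one noise coordinate, with an independent extra variable. -/
lemma steinProd {X : Type*} [MeasurableSpace X] {π : Measure X} [IsProbabilityMeasure π]
    {J : Type*} [Fintype J] [DecidableEq J] (j : J) {F F' : X × (J → ℝ) → ℝ}
    (hd : ∀ x y t, HasDerivAt (fun t => F (x, Function.update y j t))
      (F' (x, Function.update y j t)) t)
    (i1 : Integrable F (π.prod (gam J)))
    (i2 : Integrable (fun p => p.2 j * F p) (π.prod (gam J)))
    (i3 : Integrable F' (π.prod (gam J))) :
    ∫ p, p.2 j * F p ∂(π.prod (gam J)) = ∫ p, F' p ∂(π.prod (gam J)) := by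
  rw [integral_prod _ i2, integral_prod _ i3]
  refine integral_congr_ae ?_
  filter_upwards [i1.prod_right_ae, i2.prod_right_ae, i3.prod_right_ae] with y h1 h2 h3
  have := steinPi (J := J) one_ne_zero j (hd y) h1 h2 h3
  simpa [gam] using this

end Aux

namespace Aux
set_option linter.unusedSectionVars false
set_option linter.unusedSimpArgs false

section Channel
variable {X : Type*} [MeasurableSpace X] (π : Measure X) {J : Type*} [Fintype J]
  (ψ : J → X → ℝ) (a : J → ℝ)

/-- Log-likelihood ratio of the Gaussian channel `Y_j = a_j ψ_j(x) + g_j`. -/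
def Ham (Y : J → ℝ) (x : X) : ℝ := ∑ j, (a j * ψ j x * Y j - (a j * ψ j x) ^ 2 / 2)

/-- Observation. -/
def Yo (p : X × (J → ℝ)) : J → ℝ := fun j => a j * ψ j p.1 + p.2 j

/-- Posterior average. -/
def av (f : X → ℝ) (Y : J → ℝ) : ℝ := ∫ x, f x ∂(π.tilted (Ham ψ a Y))

/-- Partition function. -/
def Lk (Y : J → ℝ) : ℝ := ∫ x, Real.exp (Ham ψ a Y x) ∂π

variable {π ψ a}

lemma exp_Ham_le (Y : J → ℝ) (x : X) :
    Real.exp (Ham ψ a Y x) ≤ Real.exp (∑ j, Y j ^ 2 / 2) := by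
  refine Real.exp_le_exp.2 (Finset.sum_le_sum fun j _ => ?_)
  nlinarith [sq_nonneg (a j * ψ j x - Y j)]

lemma measurable_Ham (hψ : ∀ j, Measurable (ψ j)) :
    Measurable (fun p : X × (J → ℝ) => Ham ψ a p.2 p.1) := by
  unfold Ham
  refine Finset.measurable_sum _ fun j _ => ?_
  have h1 : Measurable (fun p : X × (J → ℝ) => ψ j p.1) := (hψ j).comp measurable_fst
  have h2 : Measurable (fun p : X × (J → ℝ) => p.2 j) := (measurable_pi_apply j).comp measurable_snd
  exact ((h1.const_mul _).mul h2).sub (((h1.const_mul _).pow_const 2).div_const _)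

lemma measurable_Ham' (hψ : ∀ j, Measurable (ψ j)) (Y : J → ℝ) : Measurable (Ham ψ a Y) :=
  (measurable_Ham hψ).comp (measurable_id.prodMk measurable_const)

lemma measurable_Yo (hψ : ∀ j, Measurable (ψ j)) : Measurable (Yo ψ a) := by
  refine measurable_pi_lambda _ fun j => ?_
  exact (((hψ j).comp measurable_fst).const_mul _).add ((measurable_pi_apply j).comp measurable_snd)

lemma integrable_mul_exp_Ham (hψ : ∀ j, Measurable (ψ j)) (Y : J → ℝ) {f : X → ℝ}
    (hf : Integrable f π) : Integrable (fun x => Real.exp (Ham ψ a Y x) * f x) π := by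
  refine hf.bdd_mul (c := Real.exp (∑ j, Y j ^ 2 / 2))
    ((measurable_Ham' hψ Y).exp.aestronglyMeasurable) (Eventually.of_forall fun x => ?_)
  rw [Real.norm_eq_abs, abs_of_pos (Real.exp_pos _)]
  exact exp_Ham_le Y x

variable [IsProbabilityMeasure π]

lemma integrable_exp_Ham (hψ : ∀ j, Measurable (ψ j)) (Y : J → ℝ) :
    Integrable (fun x => Real.exp (Ham ψ a Y x)) π := by
  simpa using integrable_mul_exp_Ham (a := a) hψ Y (integrable_const (μ := π) (1 : ℝ))

lemma Lk_pos (hψ : ∀ j, Measurable (ψ j)) (Y : J → ℝ) : 0 < Lk π ψ a Y :=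
  integral_exp_pos (integrable_exp_Ham hψ Y)

lemma tilted_prob (hψ : ∀ j, Measurable (ψ j)) (Y : J → ℝ) :
    IsProbabilityMeasure (π.tilted (Ham ψ a Y)) :=
  isProbabilityMeasure_tilted (integrable_exp_Ham hψ Y)

lemma integrable_tl (hψ : ∀ j, Measurable (ψ j)) (Y : J → ℝ) {f : X → ℝ}
    (hf : Integrable f π) : Integrable f (π.tilted (Ham ψ a Y)) := by
  rw [integrable_tilted_iff (integrable_exp_Ham hψ Y)]
  exact integrable_mul_exp_Ham hψ Y hf

lemma av_eq (f : X → ℝ) (Y : J → ℝ) :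
    av π ψ a f Y = (∫ x, Real.exp (Ham ψ a Y x) * f x ∂π) / Lk π ψ a Y := by
  unfold av Lk
  rw [integral_tilted]
  simp only [smul_eq_mul, div_mul_eq_mul_div]
  rw [integral_div]

lemma av_mul_Lk (hψ : ∀ j, Measurable (ψ j)) (f : X → ℝ) (Y : J → ℝ) :
    Lk π ψ a Y * av π ψ a f Y = ∫ x, Real.exp (Ham ψ a Y x) * f x ∂π := by
  rw [av_eq, mul_div_cancel₀ _ (Lk_pos hψ Y).ne']

/-- Law of `(s, Y)`. -/
lemma law_eq (hψ : ∀ j, Measurable (ψ j)) :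
    (π.prod (gam J)).map (fun p => (p.1, Yo ψ a p)) =
    (π.prod (gam J)).withDensity (fun p => ENNReal.ofReal (Real.exp (Ham ψ a p.2 p.1))) := by
  have hT : Measurable (fun p : X × (J → ℝ) => (p.1, Yo ψ a p)) :=
    measurable_fst.prodMk (measurable_Yo hψ)
  ext s hs
  rw [Measure.map_apply hT hs, withDensity_apply _ hs, Measure.prod_apply (hT hs),
    ← lintegral_indicator hs, lintegral_prod]
  · refine lintegral_congr fun x => ?_
    have hsx : MeasurableSet (Prod.mk x ⁻¹' s) := measurable_prodMk_left hs
    have e := shiftJ (fun j => a j * ψ j x)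
    have e2 := congrArg (fun m => m (Prod.mk x ⁻¹' s)) e
    beta_reduce at e2
    rw [Measure.map_apply (by fun_prop) hsx, withDensity_apply _ hsx,
      ← lintegral_indicator hsx] at e2
    exact e2
  · exact (((measurable_Ham hψ).exp.ennreal_ofReal).indicator hs).aemeasurable

lemma measurable_Lk (hψ : ∀ j, Measurable (ψ j)) : Measurable (Lk π ψ a) := by
  have := ((measurable_Ham (a := a) hψ).exp.stronglyMeasurable).integral_prod_left' (μ := π)
  exact this.measurable

lemma measurable_av2 (hψ : ∀ j, Measurable (ψ j)) {F : X × (J → ℝ) → ℝ} (hF : Measurable F) :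
    Measurable (fun Y => av π ψ a (fun x => F (x, Y)) Y) := by
  simp only [av_eq]
  refine Measurable.div ?_ (measurable_Lk hψ)
  have := (((measurable_Ham (a := a) hψ).exp.mul hF).stronglyMeasurable).integral_prod_left' (μ := π)
  exact this.measurable

lemma measurable_av (hψ : ∀ j, Measurable (ψ j)) {f : X → ℝ} (hf : Measurable f) :
    Measurable (av π ψ a f) :=
  measurable_av2 (F := fun p => f p.1) hψ (hf.comp measurable_fst)

lemma integrable_law (hψ : ∀ j, Measurable (ψ j)) {F : X × (J → ℝ) → ℝ} (hF : Measurable F) :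
    Integrable (fun p => F (p.1, Yo ψ a p)) (π.prod (gam J)) ↔
    Integrable (fun p => Real.exp (Ham ψ a p.2 p.1) * F p) (π.prod (gam J)) := by
  have hT : Measurable (fun p : X × (J → ℝ) => (p.1, Yo ψ a p)) :=
    measurable_fst.prodMk (measurable_Yo hψ)
  have h1 := integrable_map_measure (μ := π.prod (gam J)) (f := fun p => (p.1, Yo ψ a p)) (g := F)
    hF.aestronglyMeasurable hT.aemeasurable
  rw [law_eq hψ, integrable_withDensity_iff_integrable_smul'
    ((measurable_Ham hψ).exp.ennreal_ofReal) (ae_of_all _ fun _ => ENNReal.ofReal_lt_top)] at h1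
  simp only [ENNReal.toReal_ofReal (Real.exp_pos _).le, smul_eq_mul] at h1
  exact h1.symm

lemma integral_law (hψ : ∀ j, Measurable (ψ j)) {F : X × (J → ℝ) → ℝ} (hF : Measurable F) :
    ∫ p, F (p.1, Yo ψ a p) ∂(π.prod (gam J)) =
    ∫ p, Real.exp (Ham ψ a p.2 p.1) * F p ∂(π.prod (gam J)) := by
  have hT : Measurable (fun p : X × (J → ℝ) => (p.1, Yo ψ a p)) :=
    measurable_fst.prodMk (measurable_Yo hψ)
  have h1 := integral_map (μ := π.prod (gam J)) (φ := fun p => (p.1, Yo ψ a p)) (f := F)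
    hT.aemeasurable hF.aestronglyMeasurable
  rw [law_eq hψ, integral_withDensity_eq_integral_toReal_smul
    ((measurable_Ham hψ).exp.ennreal_ofReal) (ae_of_all _ fun _ => ENNReal.ofReal_lt_top)] at h1
  simp only [ENNReal.toReal_ofReal (Real.exp_pos _).le, smul_eq_mul] at h1
  exact h1.symm

/-- Nishimori identity, general form. -/
lemma nishi (hψ : ∀ j, Measurable (ψ j)) {F : X × (J → ℝ) → ℝ} (hF : Measurable F)
    (hi : Integrable (fun p => F (p.1, Yo ψ a p)) (π.prod (gam J))) :
    Integrable (fun p => av π ψ a (fun x => F (x, Yo ψ a p)) (Yo ψ a p)) (π.prod (gam J)) ∧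
    ∫ p, F (p.1, Yo ψ a p) ∂(π.prod (gam J)) =
    ∫ p, av π ψ a (fun x => F (x, Yo ψ a p)) (Yo ψ a p) ∂(π.prod (gam J)) := by
  have hi' := (integrable_law hψ hF).1 hi
  have hG : Measurable (fun Y => av π ψ a (fun x => F (x, Y)) Y) := measurable_av2 hψ hF
  have hG2 : Measurable (fun p : X × (J → ℝ) => av π ψ a (fun x => F (x, p.2)) p.2) :=
    hG.comp measurable_snd
  have hcol := hi'.integral_prod_right
  have hii : Integrable (fun p : X × (J → ℝ) => Real.exp (Ham ψ a p.2 p.1) *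
      av π ψ a (fun x => F (x, p.2)) p.2) (π.prod (gam J)) := by
    have hm : AEStronglyMeasurable (fun p : X × (J → ℝ) => Real.exp (Ham ψ a p.2 p.1) *
      av π ψ a (fun x => F (x, p.2)) p.2) (π.prod (gam J)) :=
      ((measurable_Ham hψ).exp.mul hG2).aestronglyMeasurable
    rw [integrable_prod_iff' hm]
    refine ⟨ae_of_all _ fun Y => 
      (integrable_exp_Ham (π := π) (a := a) hψ Y).mul_const (av π ψ a (fun x => F (x, Y)) Y), ?_⟩
    refine hcol.norm.congr (ae_of_all _ fun Y => ?_)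
    simp only [norm_mul, Real.norm_eq_abs, abs_of_pos (Real.exp_pos _)]
    rw [integral_mul_const]
    change _ = Lk π ψ a Y * _
    rw [← av_mul_Lk hψ, abs_mul, abs_of_pos (Lk_pos hψ Y)]
  refine ⟨(integrable_law hψ hG2).2 hii, ?_⟩
  rw [integral_law hψ hF, integral_law (F := fun p => av π ψ a (fun x => F (x, p.2)) p.2) hψ hG2,
    integral_prod_symm _ hi', integral_prod_symm _ hii]
  congr 1
  ext Y
  simp only
  rw [integral_mul_const]
  change _ = Lk π ψ a Y * _
  rw [av_mul_Lk hψ]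

end Channel
end Aux

namespace Aux
set_option linter.unusedSectionVars false
set_option linter.unusedSimpArgs false

section Channel2
variable {X : Type*} [MeasurableSpace X] {π : Measure X} {J : Type*} [Fintype J]
  {ψ : J → X → ℝ} {a : J → ℝ} [IsProbabilityMeasure π]

lemma av_const (hψ : ∀ j, Measurable (ψ j)) (c : ℝ) (Y : J → ℝ) :
    av π ψ a (fun _ => c) Y = c := by
  have := tilted_prob (π := π) (a := a) hψ Y
  simp [av]

lemma av_const_mul (c : ℝ) (f : X → ℝ) (Y : J → ℝ) :
    av π ψ a (fun x => c * f x) Y = c * av π ψ a f Y := by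
  simp only [av, integral_const_mul]

lemma av_mul_const (c : ℝ) (f : X → ℝ) (Y : J → ℝ) :
    av π ψ a (fun x => f x * c) Y = av π ψ a f Y * c := by
  simp only [av, integral_mul_const]

lemma av_add (hψ : ∀ j, Measurable (ψ j)) {f g : X → ℝ} (hf : Integrable f π)
    (hg : Integrable g π) (Y : J → ℝ) :
    av π ψ a (fun x => f x + g x) Y = av π ψ a f Y + av π ψ a g Y :=
  integral_add (integrable_tl hψ Y hf) (integrable_tl hψ Y hg)

lemma av_sub (hψ : ∀ j, Measurable (ψ j)) {f g : X → ℝ} (hf : Integrable f π)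
    (hg : Integrable g π) (Y : J → ℝ) :
    av π ψ a (fun x => f x - g x) Y = av π ψ a f Y - av π ψ a g Y :=
  integral_sub (integrable_tl hψ Y hf) (integrable_tl hψ Y hg)

lemma av_sum (hψ : ∀ j, Measurable (ψ j)) {ι : Type*} (s : Finset ι) {f : ι → X → ℝ}
    (hf : ∀ i ∈ s, Integrable (f i) π) (Y : J → ℝ) :
    av π ψ a (fun x => ∑ i ∈ s, f i x) Y = ∑ i ∈ s, av π ψ a (f i) Y :=
  integral_finsetSum s fun i hi => integrable_tl hψ Y (hf i hi)

lemma av_nonneg {f : X → ℝ} (hf : ∀ x, 0 ≤ f x) (Y : J → ℝ) : 0 ≤ av π ψ a f Y :=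
  integral_nonneg hf

lemma AM.intg {f g : X → ℝ} (hf : AM π f) (hg : AM π g) : Integrable (fun x => f x * g x) π :=
  (hf.mul hg).integrable

lemma AM.abs {f : X → ℝ} (hf : AM π f) : AM π (fun x => |f x|) :=
  ⟨hf.1.abs, fun k => by simpa only [abs_abs] using hf.2 k⟩

lemma av_sq_le (hψ : ∀ j, Measurable (ψ j)) {f : X → ℝ} (hf : AM π f) (Y : J → ℝ) :
    (av π ψ a f Y) ^ 2 ≤ av π ψ a (fun x => f x ^ 2) Y := by
  have h : 0 ≤ av π ψ a (fun x => (f x - av π ψ a f Y) ^ 2) Y := av_nonneg (fun _ => sq_nonneg _) Y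
  have e : (fun x => (f x - av π ψ a f Y) ^ 2) =
    fun x => (f x ^ 2 - (2 * av π ψ a f Y) * f x) + (av π ψ a f Y) ^ 2 := by ext x; ring
  rw [e, av_add hψ (((hf.pow 2).sub (hf.const_mul _)).integrable) (integrable_const _),
    av_sub hψ (hf.pow 2).integrable (hf.const_mul _).integrable, av_const hψ, av_const_mul] at h
  nlinarith

lemma abs_av_pow_le (hψ : ∀ j, Measurable (ψ j)) {f : X → ℝ} (hf : AM π f) (Y : J → ℝ) (k : ℕ) :
    |av π ψ a f Y| ^ k ≤ av π ψ a (fun x => |f x| ^ k) Y := by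
  have := tilted_prob (π := π) (a := a) hψ Y
  have h1 : |av π ψ a f Y| ≤ av π ψ a (fun x => |f x|) Y := abs_integral_le_integral_abs
  refine (pow_le_pow_left₀ (abs_nonneg _) h1 k).trans ?_
  have := (convexOn_pow k).map_integral_le (μ := π.tilted (Ham ψ a Y)) (f := fun x => |f x|)
    (continuous_pow k).continuousOn isClosed_Ici (ae_of_all _ fun x => Set.mem_Ici.2 (abs_nonneg (f x)))
    (integrable_tl hψ Y hf.abs.integrable) (integrable_tl hψ Y (hf.2 k))
  exact this

lemma AM.fst {f : X → ℝ} (hf : AM π f) : AM (π.prod (gam J)) (fun p => f p.1) :=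
  hf.comp measurePreserving_fst

lemma AM.gauss : AM (gaussianReal 0 1) (fun t => t) := by
  refine ⟨measurable_id, fun k => ?_⟩
  have := (memLp_id_gaussianReal (μ := 0) (v := 1) (k : NNReal)).integrable_norm_rpow'
  simpa using this

lemma AM.noise (j : J) : AM (π.prod (gam J)) (fun p => p.2 j) := by
  have h1 : MeasurePreserving (fun y : J → ℝ => y j) (gam J) (gaussianReal 0 1) :=
    measurePreserving_eval (fun _ => gaussianReal 0 1) j
  exact AM.gauss.comp (h1.comp measurePreserving_snd)

lemma AM_Yo (hψ : ∀ j, AM π (ψ j)) (j : J) : AM (π.prod (gam J)) (fun p => Yo ψ a p j) :=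
  (((hψ j).fst).const_mul _).add (AM.noise j)

lemma AM_av (hψ : ∀ j, Measurable (ψ j)) {f : X → ℝ} (hf : AM π f) :
    AM (π.prod (gam J)) (fun p => av π ψ a f (Yo ψ a p)) := by
  have hm : Measurable (fun p => av π ψ a f (Yo ψ a p)) :=
    (measurable_av hψ hf.1).comp (measurable_Yo hψ)
  refine ⟨hm, fun k => ?_⟩
  have h := nishi (a := a) (π := π) hψ (F := fun p => |f p.1| ^ k)
    ((hf.1.abs.pow_const k).comp measurable_fst) (hf.fst.2 k)
  refine h.1.mono' (hm.abs.pow_const k).aestronglyMeasurable (ae_of_all _ fun p => ?_)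
  rw [Real.norm_eq_abs, abs_of_nonneg (by positivity)]
  exact abs_av_pow_le hψ hf _ k

/-- Nishimori identity, product form. -/
lemma nishi' (hψ : ∀ j, Measurable (ψ j)) {f : X → ℝ} (hf : AM π f) {h : (J → ℝ) → ℝ}
    (hm : Measurable h) (hh : AM (π.prod (gam J)) (fun p => h (Yo ψ a p))) :
    ∫ p, f p.1 * h (Yo ψ a p) ∂(π.prod (gam J)) =
    ∫ p, av π ψ a f (Yo ψ a p) * h (Yo ψ a p) ∂(π.prod (gam J)) := by
  have := (nishi (a := a) (π := π) hψ (F := fun p => f p.1 * h p.2)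
    ((hf.1.comp measurable_fst).mul (hm.comp measurable_snd)) (hf.fst.mul hh).integrable).2
  simpa only [av_mul_const] using this

lemma nishi1 (hψ : ∀ j, Measurable (ψ j)) {f : X → ℝ} (hf : AM π f) :
    ∫ p, f p.1 ∂(π.prod (gam J)) = ∫ p, av π ψ a f (Yo ψ a p) ∂(π.prod (gam J)) :=
  (nishi (a := a) (π := π) hψ (F := fun p => f p.1) (hf.1.comp measurable_fst)
    hf.fst.integrable).2

/-- Optimality of the posterior mean. -/
lemma opt (hψ : ∀ j, Measurable (ψ j)) {f : X → ℝ} (hf : AM π f) {h : (J → ℝ) → ℝ}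
    (hm : Measurable h) (hh : AM (π.prod (gam J)) (fun p => h (Yo ψ a p))) :
    ∫ p, f p.1 ^ 2 ∂(π.prod (gam J)) - ∫ p, (av π ψ a f (Yo ψ a p)) ^ 2 ∂(π.prod (gam J)) ≤
    ∫ p, (f p.1 - h (Yo ψ a p)) ^ 2 ∂(π.prod (gam J)) := by
  have hv := AM_av (a := a) hψ hf
  have e1 : ∫ p, (f p.1 - h (Yo ψ a p)) ^ 2 ∂(π.prod (gam J)) =
      ∫ p, f p.1 ^ 2 ∂(π.prod (gam J)) - 2 * ∫ p, f p.1 * h (Yo ψ a p) ∂(π.prod (gam J))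
      + ∫ p, h (Yo ψ a p) ^ 2 ∂(π.prod (gam J)) := by
    rw [← integral_const_mul, ← integral_sub (hf.fst.pow 2).integrable
      ((hf.fst.mul hh).const_mul 2).integrable, ← integral_add
      ((hf.fst.pow 2).sub ((hf.fst.mul hh).const_mul 2)).integrable (hh.pow 2).integrable]
    congr 1; ext p; ring
  have e2 : ∫ p, (av π ψ a f (Yo ψ a p) - h (Yo ψ a p)) ^ 2 ∂(π.prod (gam J)) =
      ∫ p, av π ψ a f (Yo ψ a p) ^ 2 ∂(π.prod (gam J))
      - 2 * ∫ p, av π ψ a f (Yo ψ a p) * h (Yo ψ a p) ∂(π.prod (gam J))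
      + ∫ p, h (Yo ψ a p) ^ 2 ∂(π.prod (gam J)) := by
    rw [← integral_const_mul, ← integral_sub (hv.pow 2).integrable
      ((hv.mul hh).const_mul 2).integrable, ← integral_add
      ((hv.pow 2).sub ((hv.mul hh).const_mul 2)).integrable (hh.pow 2).integrable]
    congr 1; ext p; ring
  have e3 : 0 ≤ ∫ p, (av π ψ a f (Yo ψ a p) - h (Yo ψ a p)) ^ 2 ∂(π.prod (gam J)) :=
    integral_nonneg fun _ => sq_nonneg _
  rw [e1, nishi' hψ hf hm hh]
  rw [e2] at e3
  linarith

/-- `E (av f)² ≤ E f²`. -/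
lemma integral_av_sq_le (hψ : ∀ j, Measurable (ψ j)) {f : X → ℝ} (hf : AM π f) :
    ∫ p, (av π ψ a f (Yo ψ a p)) ^ 2 ∂(π.prod (gam J)) ≤ ∫ p, f p.1 ^ 2 ∂(π.prod (gam J)) := by
  rw [nishi1 (a := a) hψ (hf.pow 2)]
  exact integral_mono ((AM_av hψ hf).pow 2).integrable (AM_av hψ (hf.pow 2)).integrable
    fun p => av_sq_le hψ hf _

lemma Ham_congr {Y Y' : J → ℝ} (h : ∀ j, a j ≠ 0 → Y j = Y' j) : Ham ψ a Y = Ham ψ a Y' := by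
  ext x
  refine Finset.sum_congr rfl fun j _ => ?_
  by_cases h0 : a j = 0
  · simp [h0]
  · rw [h j h0]

lemma av_congr {Y Y' : J → ℝ} (h : ∀ j, a j ≠ 0 → Y j = Y' j) (f : X → ℝ) :
    av π ψ a f Y = av π ψ a f Y' := by
  unfold av; rw [Ham_congr h]

section Deriv
variable [DecidableEq J]

lemma hasDerivAt_Ham (Y : J → ℝ) (j : J) (x : X) (t : ℝ) :
    HasDerivAt (fun t => Ham ψ a (Function.update Y j t) x) (a j * ψ j x) t := by
  have hu : HasDerivAt (Function.update Y j) (Pi.single j (1 : ℝ)) t := hasDerivAt_update Y j t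
  rw [hasDerivAt_pi] at hu
  have : HasDerivAt (fun t => ∑ k, (a k * ψ k x * Function.update Y j t k - (a k * ψ k x) ^ 2 / 2))
      (∑ k, a k * ψ k x * (Pi.single j (1 : ℝ) : J → ℝ) k) t :=
    HasDerivAt.fun_sum fun k _ => ((hu k).const_mul (a k * ψ k x)).sub_const _
  refine this.congr_deriv ?_
  simp [Pi.single_apply]

lemma hasDerivAt_num (hψ : ∀ j, AM π (ψ j)) {f : X → ℝ} (hf : AM π f) (Y : J → ℝ) (j : J) (t : ℝ) :
    HasDerivAt (fun t => ∫ x, Real.exp (Ham ψ a (Function.update Y j t) x) * f x ∂π)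
      (∫ x, Real.exp (Ham ψ a (Function.update Y j t) x) * (a j * (f x * ψ j x)) ∂π) t := by
  have hψm := fun j => (hψ j).1
  refine (hasDerivAt_integral_of_dominated_loc_of_deriv_le
    (F := fun t x => Real.exp (Ham ψ a (Function.update Y j t) x) * f x)
    (F' := fun t x => Real.exp (Ham ψ a (Function.update Y j t) x) * (a j * (f x * ψ j x)))
    (bound := fun x => Real.exp (∑ k, Y k ^ 2 / 2 + (|t| + 1) ^ 2 / 2) * |a j * (f x * ψ j x)|)
    (Metric.ball_mem_nhds t one_pos) ?_ ?_ ?_ ?_ ?_ ?_).2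
  · exact Eventually.of_forall fun s =>
      (integrable_mul_exp_Ham hψm _ hf.integrable).aestronglyMeasurable
  · exact integrable_mul_exp_Ham hψm _ hf.integrable
  · exact (integrable_mul_exp_Ham hψm _ ((hf.mul (hψ j)).const_mul _).integrable).aestronglyMeasurable
  · refine ae_of_all _ fun x s hs => ?_
    rw [norm_mul, Real.norm_eq_abs, Real.norm_eq_abs, abs_of_pos (Real.exp_pos _)]
    refine mul_le_mul_of_nonneg_right ((exp_Ham_le _ x).trans (Real.exp_le_exp.2 ?_)) (abs_nonneg _)
    rw [Metric.mem_ball, Real.dist_eq] at hs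
    have hs' : s ^ 2 ≤ (|t| + 1) ^ 2 := by
      rw [← sq_abs s]
      refine pow_le_pow_left₀ (abs_nonneg _) ?_ 2
      have := abs_sub_abs_le_abs_sub s t
      linarith
    have : ∀ k, Function.update Y j s k ^ 2 / 2 ≤
        Y k ^ 2 / 2 + (Pi.single j ((|t| + 1) ^ 2 / 2) : J → ℝ) k := by
      intro k
      by_cases hk : k = j
      · subst hk
        simp
        nlinarith [sq_nonneg (Y k)]
      · simp [hk]
    refine (Finset.sum_le_sum fun k _ => this k).trans ?_
    rw [Finset.sum_add_distrib, Finset.sum_pi_single']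
    simp
  · exact (((hf.mul (hψ j)).const_mul _).integrable.abs.const_mul _)
  · refine ae_of_all _ fun x s _ => ?_
    refine (((hasDerivAt_Ham Y j x s).exp).mul_const (f x)).congr_deriv ?_
    ring

lemma hasDerivAt_av (hψ : ∀ j, AM π (ψ j)) {f : X → ℝ} (hf : AM π f) (Y : J → ℝ) (j : J) (t : ℝ) :
    HasDerivAt (fun t => av π ψ a f (Function.update Y j t))
      (a j * (av π ψ a (fun x => f x * ψ j x) (Function.update Y j t)
        - av π ψ a f (Function.update Y j t) * av π ψ a (ψ j) (Function.update Y j t))) t := by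
  have hψm := fun j => (hψ j).1
  have h1 := hasDerivAt_num (a := a) hψ hf Y j t
  have h2 := hasDerivAt_num (a := a) hψ (AM.const (μ := π) 1) Y j t
  simp only [mul_one, one_mul] at h2
  have hL := (Lk_pos (π := π) (a := a) hψm (Function.update Y j t)).ne'
  have h3 := h1.fun_div h2 hL
  simp only [av_eq]
  refine h3.congr_deriv ?_
  have e1 : ∫ x, Real.exp (Ham ψ a (Function.update Y j t) x) * (a j * (f x * ψ j x)) ∂π
     = a j * ∫ x, Real.exp (Ham ψ a (Function.update Y j t) x) * ((f x * ψ j x)) ∂π := by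
    rw [← integral_const_mul]; congr 1; ext x; ring
  have e2 : ∫ x, Real.exp (Ham ψ a (Function.update Y j t) x) * (a j * (ψ j x)) ∂π
     = a j * ∫ x, Real.exp (Ham ψ a (Function.update Y j t) x) * ((ψ j x)) ∂π := by
    rw [← integral_const_mul]; congr 1; ext x; ring
  rw [e1, e2]
  change (_ * Lk π ψ a _ - _) / (Lk π ψ a _) ^ 2 = _
  field_simp

lemma Yo_update (x : X) (g : J → ℝ) (j : J) (t : ℝ) :
    Yo ψ a (x, Function.update g j t) = Function.update (Yo ψ a (x, g)) j (a j * ψ j x + t) := by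
  ext k
  by_cases hk : k = j
  · subst hk; simp [Yo]
  · simp [Yo, hk]

lemma hasDerivAt_avYo (hψ : ∀ j, AM π (ψ j)) {f : X → ℝ} (hf : AM π f) (j : J) (x : X)
    (g : J → ℝ) (t : ℝ) :
    HasDerivAt (fun t => av π ψ a f (Yo ψ a (x, Function.update g j t)))
      (a j * (av π ψ a (fun x => f x * ψ j x) (Yo ψ a (x, Function.update g j t))
        - av π ψ a f (Yo ψ a (x, Function.update g j t))
          * av π ψ a (ψ j) (Yo ψ a (x, Function.update g j t)))) t := by
  simp only [Yo_update]
  have h := hasDerivAt_av (a := a) hψ hf (Yo ψ a (x, g)) j (a j * ψ j x + t)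
  have h2 := h.comp_const_add (a j * ψ j x) t
  exact h2

end Deriv
end Channel2
end Aux

namespace Aux
set_option linter.unusedSectionVars false
set_option linter.unusedSimpArgs false

section SD
variable {ι : Type*} [Fintype ι] [DecidableEq ι] {J : Type*} [Fintype J] [DecidableEq J]
  {ψ : J → (ι → ℝ) → ℝ} {a : J → ℝ} {v : NNReal}

lemma hasDerivAt_HamX {i : ι} {G : J → (ι → ℝ) → ℝ}
    (hG : ∀ j x t, HasDerivAt (fun t => ψ j (Function.update x i t)) (G j (Function.update x i t)) t)
    (Y : J → ℝ) (x : ι → ℝ) (t : ℝ) :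
    HasDerivAt (fun t => Ham ψ a Y (Function.update x i t))
      (∑ j, a j * (Y j * G j (Function.update x i t)
        - a j * (ψ j (Function.update x i t) * G j (Function.update x i t)))) t := by
  unfold Ham
  refine HasDerivAt.fun_sum fun j _ => ?_
  have h := ((hG j x t).const_mul (a j))
  refine ((h.mul_const (Y j)).sub ((h.fun_pow 2).div_const 2)).congr_deriv ?_
  simp
  ring

lemma AM_coord (i : ι) : AM (Measure.pi fun _ : ι => gaussianReal 0 v) (fun x => x i) := by
  have h1 : MeasurePreserving (fun y : ι → ℝ => y i) (Measure.pi fun _ : ι => gaussianReal 0 v)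
      (gaussianReal 0 v) := measurePreserving_eval (fun _ => gaussianReal 0 v) i
  refine AM.comp (f := fun t => t) ⟨measurable_id, fun k => ?_⟩ h1
  have := (memLp_id_gaussianReal (μ := 0) (v := v) (k : NNReal)).integrable_norm_rpow'
  simpa using this

/-- Pointwise Schwinger-Dyson equation. -/
lemma sd_point (hv : v ≠ 0) (hψ : ∀ j, AM (Measure.pi fun _ : ι => gaussianReal 0 v) (ψ j))
    {i : ι} {G : J → (ι → ℝ) → ℝ}
    (hGm : ∀ j, AM (Measure.pi fun _ : ι => gaussianReal 0 v) (G j))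
    (hG : ∀ j x t, HasDerivAt (fun t => ψ j (Function.update x i t)) (G j (Function.update x i t)) t)
    (Y : J → ℝ) :
    av (Measure.pi fun _ : ι => gaussianReal 0 v) ψ a (fun x => x i) Y = v * ∑ j, a j *
      (Y j * av (Measure.pi fun _ : ι => gaussianReal 0 v) ψ a (G j) Y
      - a j * av (Measure.pi fun _ : ι => gaussianReal 0 v) ψ a (fun x => ψ j x * G j x) Y) := by
  set π := Measure.pi fun _ : ι => gaussianReal 0 v with hπ
  have hψm := fun j => (hψ j).1
  have hD : AM π (fun x => ∑ j, a j * (Y j * G j x - a j * (ψ j x * G j x))) :=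
    AM.sum _ fun j _ => (((hGm j).const_mul _).sub (((hψ j).mul (hGm j)).const_mul _)).const_mul _
  have h := steinPi (J := ι) hv i (F := fun x => Real.exp (Ham ψ a Y x))
    (F' := fun x => Real.exp (Ham ψ a Y x) * ∑ j, a j * (Y j * G j x - a j * (ψ j x * G j x)))
    (fun x t => (hasDerivAt_HamX hG Y x t).exp)
    (integrable_exp_Ham hψm Y)
    ((integrable_mul_exp_Ham hψm Y (AM_coord i).integrable).congr
      (ae_of_all _ fun x => mul_comm _ _))
    (integrable_mul_exp_Ham hψm Y hD.integrable)
  have e1 : Lk π ψ a Y * av π ψ a (fun x => x i) Y = v * (Lk π ψ a Y * av π ψ a (fun x =>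
      ∑ j, a j * (Y j * G j x - a j * (ψ j x * G j x))) Y) := by
    rw [av_mul_Lk hψm, av_mul_Lk hψm, ← h]
    congr 1; ext x; ring
  have hL := (Lk_pos (π := π) (a := a) hψm Y).ne'
  have e2 : av π ψ a (fun x => x i) Y = v * av π ψ a (fun x =>
      ∑ j, a j * (Y j * G j x - a j * (ψ j x * G j x))) Y := by
    apply mul_left_cancel₀ hL
    rw [e1]; ring
  rw [e2, av_sum hψm]
  · congr 1
    refine Finset.sum_congr rfl fun j _ => ?_
    rw [av_const_mul, av_sub hψm, av_const_mul, av_const_mul]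
    · exact ((hGm j).const_mul _).integrable
    · exact (((hψ j).mul (hGm j)).const_mul _).integrable
  · intro j _
    exact ((((hGm j).const_mul _).sub (((hψ j).mul (hGm j)).const_mul _)).const_mul _).integrable

/-- Gaussian integration by parts over one noise variable, for products of averages. -/
lemma noise_ibp {X : Type*} [MeasurableSpace X] {π : Measure X} [IsProbabilityMeasure π]
    {ψ : J → X → ℝ} (hψ : ∀ j, AM π (ψ j)) {f h : X → ℝ} (hf : AM π f) (hh : AM π h) (j : J) :
    ∫ p, p.2 j * (av π ψ a f (Yo ψ a p) * av π ψ a h (Yo ψ a p)) ∂(π.prod (gam J)) =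
    ∫ p, a j * ((av π ψ a (fun x => f x * ψ j x) (Yo ψ a p)
        - av π ψ a f (Yo ψ a p) * av π ψ a (ψ j) (Yo ψ a p)) * av π ψ a h (Yo ψ a p)
      + av π ψ a f (Yo ψ a p) * (av π ψ a (fun x => h x * ψ j x) (Yo ψ a p)
        - av π ψ a h (Yo ψ a p) * av π ψ a (ψ j) (Yo ψ a p))) ∂(π.prod (gam J)) := by
  have hψm := fun j => (hψ j).1
  have af := AM_av (a := a) hψm hf
  have ah := AM_av (a := a) hψm hh
  have aψ := AM_av (a := a) hψm (hψ j)
  have afψ := AM_av (a := a) hψm (hf.mul (hψ j))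
  have ahψ := AM_av (a := a) hψm (hh.mul (hψ j))
  refine steinProd j (F := fun p => av π ψ a f (Yo ψ a p) * av π ψ a h (Yo ψ a p)) ?_ ?_ ?_ ?_
  · intro x y t
    refine ((hasDerivAt_avYo hψ hf j x y t).fun_mul (hasDerivAt_avYo hψ hh j x y t)).congr_deriv ?_
    ring
  · exact (af.mul ah).integrable
  · exact ((AM.noise j).mul (af.mul ah)).integrable
  · exact ((((afψ.sub (af.mul aψ)).mul ah).add (af.mul (ahψ.sub (ah.mul aψ)))).const_mul _).integrable

/-- Averaged Schwinger-Dyson equation. -/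
lemma sd (hv : v ≠ 0) (hψ : ∀ j, AM (Measure.pi fun _ : ι => gaussianReal 0 v) (ψ j))
    {i : ι} {G : J → (ι → ℝ) → ℝ}
    (hGm : ∀ j, AM (Measure.pi fun _ : ι => gaussianReal 0 v) (G j))
    (hG : ∀ j x t, HasDerivAt (fun t => ψ j (Function.update x i t)) (G j (Function.update x i t)) t)
    {π : Measure (ι → ℝ)} (hπ : π = Measure.pi fun _ : ι => gaussianReal 0 v) :
    ∫ p, av π ψ a (fun x => x i) (Yo ψ a p) ^ 2 ∂(π.prod (gam J)) = v * ∑ j, a j ^ 2 *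
      ∫ p, av π ψ a (G j) (Yo ψ a p) * (av π ψ a (fun x => x i * ψ j x) (Yo ψ a p)
        - av π ψ a (fun x => x i) (Yo ψ a p) * av π ψ a (ψ j) (Yo ψ a p)) ∂(π.prod (gam J)) := by
  have hx : AM π (fun x => x i) := by rw [hπ]; exact AM_coord i
  have hsd := sd_point (a := a) hv hψ hGm hG
  rw [← hπ] at hψ hGm hsd
  have hπp : IsProbabilityMeasure π := by rw [hπ]; infer_instance
  have hψm := fun j => (hψ j).1
  have am := AM_av (a := a) hψm hx
  have aG := fun j => AM_av (a := a) hψm (hGm j)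
  have aψ := fun j => AM_av (a := a) hψm (hψ j)
  have aψG := fun j => AM_av (a := a) hψm ((hψ j).mul (hGm j))
  have aGψ := fun j => AM_av (a := a) hψm ((hGm j).mul (hψ j))
  have axψ := fun j => AM_av (a := a) hψm (hx.mul (hψ j))
  have aY := fun j => AM_Yo (a := a) hψ j
  have e1 : ∀ p, av π ψ a (fun x => x i) (Yo ψ a p) ^ 2 = v * ∑ j, a j *
      (Yo ψ a p j * av π ψ a (G j) (Yo ψ a p) * av π ψ a (fun x => x i) (Yo ψ a p)
      - a j * (av π ψ a (fun x => ψ j x * G j x) (Yo ψ a p)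
        * av π ψ a (fun x => x i) (Yo ψ a p))) := by
    intro p
    rw [sq]
    nth_rewrite 1 [hsd (Yo ψ a p)]
    rw [mul_assoc, Finset.sum_mul]
    congr 1
    refine Finset.sum_congr rfl fun j _ => ?_
    ring
  simp only [e1]
  rw [integral_const_mul, integral_finsetSum]
  swap
  · intro j _
    exact (((((aY j).mul (aG j)).mul am).sub (((aψG j).mul am).const_mul _)).const_mul _).integrable
  congr 1
  refine Finset.sum_congr rfl fun j _ => ?_
  rw [integral_const_mul, sq, mul_assoc]
  congr 1
  rw [integral_sub (((aY j).mul (aG j)).mul am).integrable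
    (((aψG j).mul am).const_mul _).integrable, integral_const_mul]
  have e2 : ∫ p, Yo ψ a p j * av π ψ a (G j) (Yo ψ a p) * av π ψ a (fun x => x i) (Yo ψ a p)
      ∂(π.prod (gam J)) =
      a j * ∫ p, av π ψ a (ψ j) (Yo ψ a p) *
        (av π ψ a (G j) (Yo ψ a p) * av π ψ a (fun x => x i) (Yo ψ a p)) ∂(π.prod (gam J))
      + ∫ p, p.2 j * (av π ψ a (G j) (Yo ψ a p) * av π ψ a (fun x => x i) (Yo ψ a p))
        ∂(π.prod (gam J)) := by
    rw [← nishi' (a := a) (h := fun Y => av π ψ a (G j) Y * av π ψ a (fun x => x i) Y) hψm (hψ j)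
      ((measurable_av hψm (hGm j).1).mul (measurable_av hψm hx.1)) ((aG j).mul am),
      ← integral_const_mul, ← integral_add]
    · congr 1; ext p; simp only [Yo]; ring
    · exact (((hψ j).fst.mul ((aG j).mul am)).const_mul _).integrable
    · exact ((AM.noise j).mul ((aG j).mul am)).integrable
  rw [e2, noise_ibp hψ (hGm j) hx j, integral_const_mul, ← mul_add, ← mul_sub,
    ← integral_add, ← integral_sub]
  · congr 2
    ext p
    have : (fun x => ψ j x * G j x) = fun x => G j x * ψ j x := by ext x; ring
    rw [this]
    ring
  · exact (((aψ j).mul ((aG j).mul am)).add ((((aGψ j).sub ((aG j).mul (aψ j))).mul am).add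
      ((aG j).mul ((axψ j).sub (am.mul (aψ j)))))).integrable
  · exact ((aψG j).mul am).integrable
  · exact ((aψ j).mul ((aG j).mul am)).integrable
  · exact ((((aGψ j).sub ((aG j).mul (aψ j))).mul am).add
      ((aG j).mul ((axψ j).sub (am.mul (aψ j))))).integrable

end SD
end Aux

namespace Aux
set_option linter.unusedSectionVars false
set_option linter.unusedSimpArgs false

section Inc
variable {X : Type*} [MeasurableSpace X] {π : Measure X} {J : Type*} [Fintype J]
  {ψ : J → X → ℝ} {a a' : J → ℝ} [IsProbabilityMeasure π]

/-- Free energy. -/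
def Fe (π : Measure X) (ψ : J → X → ℝ) (a : J → ℝ) : ℝ :=
  ∫ p, Real.log (Lk π ψ a (Yo ψ a p)) ∂(π.prod (gam J))

lemma Fe_zero : Fe π ψ (fun _ => 0) = 0 := by
  have : ∀ Y, Lk π ψ (fun _ => 0) Y = 1 := by intro Y; simp [Lk, Ham]
  simp [Fe, this]

lemma integrable_log (hψ : ∀ j, AM π (ψ j)) :
    Integrable (fun p => Real.log (Lk π ψ a (Yo ψ a p))) (π.prod (gam J)) := by
  have hψm := fun j => (hψ j).1
  have hm : Measurable (fun p => Real.log (Lk π ψ a (Yo ψ a p))) :=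
    ((measurable_Lk hψm).comp (measurable_Yo hψm)).log
  have hup : ∀ Y, Real.log (Lk π ψ a Y) ≤ ∑ j, Y j ^ 2 / 2 := by
    intro Y
    rw [Real.log_le_iff_le_exp (Lk_pos hψm Y)]
    have := integral_mono (integrable_exp_Ham (π := π) (a := a) hψm Y)
      (integrable_const (Real.exp (∑ j, Y j ^ 2 / 2))) (fun x => exp_Ham_le Y x)
    simpa [Lk] using this
  have hHi : ∀ Y, Integrable (Ham ψ a Y) π := by
    intro Y
    exact (AM.sum (μ := π) Finset.univ (F := fun j x => a j * ψ j x * Y j - (a j * ψ j x) ^ 2 / 2)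
      fun j _ => by
        have := (((hψ j).const_mul (a j * Y j)).sub ((((hψ j).const_mul (a j)).pow 2).div_const 2))
        refine (?_ : AM π _)
        convert this using 2
        ring).integrable
  have hlow : ∀ Y, ∑ j, (a j * (∫ x, ψ j x ∂π) * Y j - (a j ^ 2 * ∫ x, ψ j x ^ 2 ∂π) / 2)
      ≤ Real.log (Lk π ψ a Y) := by
    intro Y
    have e : ∫ x, Ham ψ a Y x ∂π =
        ∑ j, (a j * (∫ x, ψ j x ∂π) * Y j - (a j ^ 2 * ∫ x, ψ j x ^ 2 ∂π) / 2) := by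
      unfold Ham
      rw [integral_finsetSum]
      · refine Finset.sum_congr rfl fun j _ => ?_
        rw [← integral_const_mul, ← integral_mul_const, ← integral_const_mul, ← integral_div,
          ← integral_sub (((hψ j).integrable.const_mul _).mul_const _)
          (((((hψ j).pow 2).const_mul _).div_const _).integrable)]
        congr 1; ext x; ring
      · intro j _
        refine Integrable.sub (((hψ j).integrable.const_mul _).mul_const _) ?_
        exact ((((hψ j).const_mul (a j)).pow 2).div_const 2).integrable
    rw [← e, Real.le_log_iff_exp_le (Lk_pos hψm Y)]
    have := convexOn_exp.map_integral_le (μ := π) (f := Ham ψ a Y) Real.continuous_exp.continuousOn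
      isClosed_univ (ae_of_all _ fun _ => Set.mem_univ _) (hHi Y) (integrable_exp_Ham hψm Y)
    exact this
  have hb : AM (π.prod (gam J)) (fun p => ∑ j, Yo ψ a p j ^ 2 / 2) :=
    AM.sum _ fun j _ => ((AM_Yo hψ j).pow 2).div_const _
  have hl : AM (π.prod (gam J)) (fun p => ∑ j, (a j * (∫ x, ψ j x ∂π) * Yo ψ a p j
      - (a j ^ 2 * ∫ x, ψ j x ^ 2 ∂π) / 2)) :=
    AM.sum _ fun j _ => ((AM_Yo hψ j).const_mul _).sub (AM.const _)
  refine (hb.integrable.abs.add hl.integrable.abs).mono' hm.aestronglyMeasurable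
    (ae_of_all _ fun p => ?_)
  rw [Real.norm_eq_abs, abs_le]
  simp only [Pi.add_apply]
  have h1 := hup (Yo ψ a p)
  have h2 := hlow (Yo ψ a p)
  have h3 := le_abs_self (∑ j, Yo ψ a p j ^ 2 / 2)
  have h4 := neg_abs_le (∑ j, (a j * (∫ x, ψ j x ∂π) * Yo ψ a p j
      - (a j ^ 2 * ∫ x, ψ j x ^ 2 ∂π) / 2))
  have h5 := abs_nonneg (∑ j, Yo ψ a p j ^ 2 / 2)
  have h6 := abs_nonneg (∑ j, (a j * (∫ x, ψ j x ∂π) * Yo ψ a p j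
      - (a j ^ 2 * ∫ x, ψ j x ^ 2 ∂π) / 2))
  constructor <;> linarith

lemma log_jensen (hψ : ∀ j, AM π (ψ j)) (Y Y' : J → ℝ) :
    Real.log (Lk π ψ a Y) + ∑ j, ((a' j * Y' j - a j * Y j) * av π ψ a (ψ j) Y
      - (a' j ^ 2 - a j ^ 2) / 2 * av π ψ a (fun x => ψ j x ^ 2) Y) ≤
      Real.log (Lk π ψ a' Y') := by
  have hψm := fun j => (hψ j).1
  have := tilted_prob (π := π) (a := a) hψm Y
  set D : X → ℝ := fun x => ∑ j, ((a' j * Y' j - a j * Y j) * ψ j x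
      - (a' j ^ 2 - a j ^ 2) / 2 * ψ j x ^ 2) with hD
  have hDH : ∀ x, Ham ψ a' Y' x = Ham ψ a Y x + D x := by
    intro x
    simp only [Ham, hD, ← Finset.sum_add_distrib]
    refine Finset.sum_congr rfl fun j _ => ?_
    ring
  have hDt : ∀ j, AM π (fun x => (a' j * Y' j - a j * Y j) * ψ j x
      - (a' j ^ 2 - a j ^ 2) / 2 * ψ j x ^ 2) :=
    fun j => ((hψ j).const_mul _).sub (((hψ j).pow 2).const_mul _)
  have hDA : AM π D := AM.sum _ fun j _ => hDt j
  have e : av π ψ a D Y = ∑ j, ((a' j * Y' j - a j * Y j) * av π ψ a (ψ j) Y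
      - (a' j ^ 2 - a j ^ 2) / 2 * av π ψ a (fun x => ψ j x ^ 2) Y) := by
    rw [hD, av_sum hψm _ (fun j _ => (hDt j).integrable)]
    refine Finset.sum_congr rfl fun j _ => ?_
    rw [av_sub hψm ((hψ j).const_mul _).integrable (((hψ j).pow 2).const_mul _).integrable,
      av_const_mul, av_const_mul]
  rw [← e]
  have hI : Integrable (fun x => Real.exp (D x)) (π.tilted (Ham ψ a Y)) := by
    rw [integrable_tilted_iff (integrable_exp_Ham hψm Y)]
    refine (integrable_exp_Ham (π := π) (a := a') hψm Y').congr (ae_of_all _ fun x => ?_)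
    simp only [hDH, Real.exp_add, smul_eq_mul]
  have hJ := convexOn_exp.map_integral_le (μ := π.tilted (Ham ψ a Y)) (f := D)
    Real.continuous_exp.continuousOn
    isClosed_univ (ae_of_all _ fun _ => Set.mem_univ _) (integrable_tl hψm Y hDA.integrable) hI
  have e3 : Lk π ψ a' Y' = Lk π ψ a Y * av π ψ a (fun x => Real.exp (D x)) Y := by
    rw [av_mul_Lk hψm]
    simp only [Lk, hDH, Real.exp_add]
  rw [Real.le_log_iff_exp_le (Lk_pos hψm Y'), Real.exp_add, Real.exp_log (Lk_pos hψm Y), e3]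
  exact mul_le_mul_of_nonneg_left hJ (Lk_pos hψm Y).le

lemma noise_ibp1 [DecidableEq J] (hψ : ∀ j, AM π (ψ j)) {f : X → ℝ} (hf : AM π f) (j : J) :
    ∫ p, p.2 j * av π ψ a f (Yo ψ a p) ∂(π.prod (gam J)) =
    a j * (∫ p, av π ψ a (fun x => f x * ψ j x) (Yo ψ a p) ∂(π.prod (gam J))
      - ∫ p, av π ψ a f (Yo ψ a p) * av π ψ a (ψ j) (Yo ψ a p) ∂(π.prod (gam J))) := by
  have hψm := fun j => (hψ j).1
  have h := noise_ibp (a := a) hψ hf (AM.const (μ := π) 1) j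
  simp only [av_const hψm, mul_one, one_mul, sub_self, mul_zero, add_zero] at h
  rw [h, integral_const_mul, integral_sub]
  · exact (AM_av hψm (hf.mul (hψ j))).integrable
  · exact ((AM_av hψm hf).mul (AM_av hψm (hψ j))).integrable

/-- Free energy increment. -/
lemma Fe_inc [DecidableEq J] (hψ : ∀ j, AM π (ψ j)) (a a' : J → ℝ) :
    Fe π ψ a + ∑ j, ((a' j ^ 2 - a j ^ 2) / 2 *
        ∫ p, av π ψ a (ψ j) (Yo ψ a p) ^ 2 ∂(π.prod (gam J))
      - (a' j - a j) ^ 2 / 2 * ∫ x, ψ j x ^ 2 ∂π) ≤ Fe π ψ a' := by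
  have hψm := fun j => (hψ j).1
  have aψ := fun j => AM_av (a := a) hψm (hψ j)
  have aψ2 := fun j => AM_av (a := a) hψm ((hψ j).pow 2)
  have hterm : ∀ j, AM (π.prod (gam J)) (fun p =>
      ((a' j * Yo ψ a' p j - a j * Yo ψ a p j) * av π ψ a (ψ j) (Yo ψ a p)
      - (a' j ^ 2 - a j ^ 2) / 2 * av π ψ a (fun x => ψ j x ^ 2) (Yo ψ a p))) := fun j =>
    ((((AM_Yo hψ j).const_mul _).sub ((AM_Yo hψ j).const_mul _)).mul (aψ j)).sub
      ((aψ2 j).const_mul _)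
  have h1 : Fe π ψ a + ∑ j, ∫ p, ((a' j * Yo ψ a' p j - a j * Yo ψ a p j) * av π ψ a (ψ j) (Yo ψ a p)
      - (a' j ^ 2 - a j ^ 2) / 2 * av π ψ a (fun x => ψ j x ^ 2) (Yo ψ a p)) ∂(π.prod (gam J))
      ≤ Fe π ψ a' := by
    unfold Fe
    rw [← integral_finsetSum _ (fun j _ => (hterm j).integrable), ← integral_add
      (integrable_log hψ) (AM.sum _ fun j _ => hterm j).integrable]
    refine integral_mono ((integrable_log hψ).add (AM.sum _ fun j _ => hterm j).integrable)
      (integrable_log hψ) fun p => ?_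
    exact log_jensen hψ (Yo ψ a p) (Yo ψ a' p)
  refine le_trans ?_ h1
  gcongr with j
  set q := ∫ p, av π ψ a (ψ j) (Yo ψ a p) ^ 2 ∂(π.prod (gam J)) with hq
  have f1 : ∫ p, ψ j p.1 * av π ψ a (ψ j) (Yo ψ a p) ∂(π.prod (gam J)) = q := by
    rw [nishi' (a := a) hψm (hψ j) (measurable_av hψm (hψ j).1) (aψ j), hq]
    congr 1; ext p; ring
  have f2 : ∫ p, av π ψ a (fun x => ψ j x ^ 2) (Yo ψ a p) ∂(π.prod (gam J)) = ∫ x, ψ j x ^ 2 ∂π := by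
    rw [← nishi1 (a := a) hψm ((hψ j).pow 2), integral_fun_fst (fun x => ψ j x ^ 2)]
    simp
  have f3 : ∫ p, p.2 j * av π ψ a (ψ j) (Yo ψ a p) ∂(π.prod (gam J)) =
      a j * (∫ x, ψ j x ^ 2 ∂π - q) := by
    rw [noise_ibp1 hψ (hψ j), ← f2, hq]
    simp only [sq]
  have f4 : ∫ p, ((a' j * Yo ψ a' p j - a j * Yo ψ a p j) * av π ψ a (ψ j) (Yo ψ a p)
      - (a' j ^ 2 - a j ^ 2) / 2 * av π ψ a (fun x => ψ j x ^ 2) (Yo ψ a p)) ∂(π.prod (gam J))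
      = (a' j ^ 2 - a j ^ 2) * q + (a' j - a j) * (a j * (∫ x, ψ j x ^ 2 ∂π - q))
        - (a' j ^ 2 - a j ^ 2) / 2 * ∫ x, ψ j x ^ 2 ∂π := by
    rw [← f3, ← f2, ← f1, ← integral_const_mul, ← integral_const_mul, ← integral_const_mul,
      ← integral_add, ← integral_sub]
    · congr 1; ext p; simp only [Yo]; ring
    · exact ((((hψ j).fst.mul (aψ j)).const_mul _).add
        (((AM.noise j).mul (aψ j)).const_mul _)).integrable
    · exact ((aψ2 j).const_mul _).integrable
    · exact (((hψ j).fst.mul (aψ j)).const_mul _).integrable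
    · exact (((AM.noise j).mul (aψ j)).const_mul _).integrable
  rw [f4]
  have hq0 : 0 ≤ q := integral_nonneg fun _ => sq_nonneg _
  nlinarith [mul_nonneg (sq_nonneg (a' j - a j)) hq0]

end Inc
end Aux

namespace Aux
set_option linter.unusedSectionVars false
set_option linter.unusedSimpArgs false

section Thermal
variable {X : Type*} [MeasurableSpace X] {π : Measure X} {J : Type*} [Fintype J] [DecidableEq J]
  {ψ : J → X → ℝ} {a a' : J → ℝ} [IsProbabilityMeasure π]

lemma noise_zero {A : X × (J → ℝ) → ℝ} (hA : AM (π.prod (gam J)) A) (j : J)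
    (hinv : ∀ x y t, A (x, Function.update y j t) = A (x, y)) :
    ∫ p, p.2 j * A p ∂(π.prod (gam J)) = 0 := by
  have h := steinProd (π := π) j (F := A) (F' := fun _ => 0) ?_ hA.integrable
    ((AM.noise j).mul hA).integrable (integrable_const _)
  · simpa using h
  · intro x y t
    simp only [hinv]
    exact hasDerivAt_const _ _

lemma noise_two {A : X × (J → ℝ) → ℝ} (hA : AM (π.prod (gam J)) A) (j l : J)
    (hinv : ∀ x y t, A (x, Function.update y j t) = A (x, y)) :
    ∫ p, p.2 j * (p.2 l * A p) ∂(π.prod (gam J)) = if j = l then ∫ p, A p ∂(π.prod (gam J)) else 0 := by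
  by_cases h : j = l
  · subst h
    rw [if_pos rfl]
    refine steinProd (π := π) j (F := fun p => p.2 j * A p) (F' := A) ?_
      ((AM.noise j).mul hA).integrable
      ((AM.noise j).mul ((AM.noise j).mul hA)).integrable hA.integrable
    intro x y t
    simp only [hinv, Function.update_self]
    exact ((hasDerivAt_id' t).mul_const _).congr_deriv (by ring)
  · rw [if_neg h]
    refine noise_zero ((AM.noise l).mul hA) j fun x y t => ?_
    simp only [hinv]
    rw [Function.update_of_ne (Ne.symm h)]

variable {ι : Type*} [Fintype ι] [DecidableEq ι]

/-- posterior covariance -/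
def Cv (π : Measure X) (ψ : J → X → ℝ) (a : J → ℝ) (φ : ι → X → ℝ) (i j : ι) (Y : J → ℝ) : ℝ :=
  av π ψ a (fun x => φ i x * φ j x) Y - av π ψ a (φ i) Y * av π ψ a (φ j) Y

lemma AM_Cv (hψ : ∀ j, AM π (ψ j)) {φ : ι → X → ℝ} (hφ : ∀ i, AM π (φ i)) (i j : ι) :
    AM (π.prod (gam J)) (fun p => Cv π ψ a φ i j (Yo ψ a p)) := by
  have hψm := fun j => (hψ j).1
  exact (AM_av hψm ((hφ i).mul (hφ j))).sub ((AM_av hψm (hφ i)).mul (AM_av hψm (hφ j)))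

lemma measurable_Cv (hψ : ∀ j, AM π (ψ j)) {φ : ι → X → ℝ} (hφ : ∀ i, AM π (φ i)) (i j : ι) :
    Measurable (Cv π ψ a φ i j) := by
  have hψm := fun j => (hψ j).1
  exact (measurable_av hψm ((hφ i).mul (hφ j)).1).sub
    ((measurable_av hψm (hφ i).1).mul (measurable_av hψm (hφ j).1))

lemma thermal_step (hψ : ∀ j, AM π (ψ j)) {φ : ι → X → ℝ} (hφ : ∀ i, AM π (φ i))
    {e : ι → J} (he : Function.Injective e) (hψe : ∀ i, ψ (e i) = φ i) {δ : ℝ}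
    (ha : ∀ i, a (e i) = 0) (ha' : ∀ i, a' (e i) = δ) (haa : ∀ j, j ∉ Set.range e → a' j = a j)
    (i : ι) :
    ∫ p, av π ψ a (φ i) (Yo ψ a p) ^ 2 ∂(π.prod (gam J))
      + δ ^ 2 * ∑ j, ∫ p, Cv π ψ a φ i j (Yo ψ a p) ^ 2 ∂(π.prod (gam J))
      - δ ^ 4 * ∫ p, (∑ j, Cv π ψ a φ i j (Yo ψ a p) *
          (φ j p.1 - av π ψ a (φ j) (Yo ψ a p))) ^ 2 ∂(π.prod (gam J))
      ≤ ∫ p, av π ψ a' (φ i) (Yo ψ a' p) ^ 2 ∂(π.prod (gam J)) := by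
  have hψm := fun j => (hψ j).1
  have hY : ∀ p j, a j ≠ 0 → Yo ψ a' p j = Yo ψ a p j := by
    intro p j hj
    have : j ∉ Set.range e := by
      rintro ⟨k, rfl⟩; exact hj (ha k)
    simp only [Yo, haa j this]
  have hav : ∀ f p, av π ψ a f (Yo ψ a' p) = av π ψ a f (Yo ψ a p) := fun f p => av_congr (hY p) f
  have hC' : ∀ j p, Cv π ψ a φ i j (Yo ψ a' p) = Cv π ψ a φ i j (Yo ψ a p) := by
    intro j p; simp only [Cv, hav]
  have hinv : ∀ f x y k t, av π ψ a f (Yo ψ a (x, Function.update y (e k) t))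
      = av π ψ a f (Yo ψ a (x, y)) := by
    intro f x y k t
    refine av_congr (fun j hj => ?_) f
    have : j ≠ e k := by rintro rfl; exact hj (ha k)
    simp [Yo, this]
  have hinvC : ∀ j x y k t, Cv π ψ a φ i j (Yo ψ a (x, Function.update y (e k) t))
      = Cv π ψ a φ i j (Yo ψ a (x, y)) := by
    intro j x y k t; simp only [Cv, hinv]
  have am := fun i => AM_av (a := a) hψm (hφ i)
  have aC := fun j => AM_Cv (a := a) hψ hφ i j
  have aD : ∀ j, AM (π.prod (gam J)) (fun p => φ j p.1 - av π ψ a (φ j) (Yo ψ a p)) :=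
    fun j => (hφ j).fst.sub (am j)
  -- abbreviations
  set C : ι → X × (J → ℝ) → ℝ := fun j p => Cv π ψ a φ i j (Yo ψ a p) with hCdef
  set D : ι → X × (J → ℝ) → ℝ := fun j p => φ j p.1 - av π ψ a (φ j) (Yo ψ a p) with hDdef
  set V : X × (J → ℝ) → ℝ := fun p => ∑ j, C j p * D j p with hVdef
  set N : X × (J → ℝ) → ℝ := fun p => ∑ j, p.2 (e j) * C j p with hNdef
  have aV : AM (π.prod (gam J)) V := AM.sum _ fun j _ => (aC j).mul (aD j)
  have aN : AM (π.prod (gam J)) N := AM.sum _ fun j _ => (AM.noise _).mul (aC j)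
  -- the estimator
  set h : (J → ℝ) → ℝ := fun Y => av π ψ a (φ i) Y +
    ∑ j, Cv π ψ a φ i j Y * (δ * (Y (e j) - δ * av π ψ a (φ j) Y)) with hh
  have hm : Measurable h := by
    refine (measurable_av hψm (hφ i).1).add (Finset.measurable_sum _ fun j _ => ?_)
    exact (measurable_Cv hψ hφ i j).mul ((((measurable_pi_apply _).sub
      ((measurable_av hψm (hφ j).1).const_mul _))).const_mul _)
  have hform : ∀ p, φ i p.1 - h (Yo ψ a' p) = D i p - δ ^ 2 * V p - δ * N p := by
    intro p
    simp only [hh, hav, hC', hVdef, hNdef, hDdef, hCdef, Finset.mul_sum]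
    have : ∀ j, Yo ψ a' p (e j) = δ * φ j p.1 + p.2 (e j) := by
      intro j; simp only [Yo, ha', hψe]
    simp only [this]
    rw [sub_sub, sub_sub, ← Finset.sum_add_distrib, sub_eq_sub_iff_add_eq_add]
    congr 2
    refine Finset.sum_congr rfl fun j _ => ?_
    ring
  have hhA : AM (π.prod (gam J)) (fun p => h (Yo ψ a' p)) := by
    have : (fun p => h (Yo ψ a' p)) = fun p => φ i p.1 - (D i p - δ ^ 2 * V p - δ * N p) := by
      ext p; rw [← hform]; ring
    rw [this]
    exact (hφ i).fst.sub (((aD i).sub (aV.const_mul _)).sub (aN.const_mul _))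
  have hopt := opt (a := a') hψm (hφ i) hm hhA
  simp only [hform] at hopt
  -- evaluate
  have i1 : ∫ p, D i p ^ 2 ∂(π.prod (gam J)) = ∫ p, φ i p.1 ^ 2 ∂(π.prod (gam J))
      - ∫ p, av π ψ a (φ i) (Yo ψ a p) ^ 2 ∂(π.prod (gam J)) := by
    have n1 := nishi' (a := a) hψm (hφ i) (measurable_av hψm (hφ i).1) (am i)
    have : ∫ p, D i p ^ 2 ∂(π.prod (gam J)) = ∫ p, φ i p.1 ^ 2 ∂(π.prod (gam J))
      - 2 * ∫ p, φ i p.1 * av π ψ a (φ i) (Yo ψ a p) ∂(π.prod (gam J))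
      + ∫ p, av π ψ a (φ i) (Yo ψ a p) ^ 2 ∂(π.prod (gam J)) := by
      rw [← integral_const_mul, ← integral_sub, ← integral_add]
      · congr 1; ext p; simp only [hDdef]; ring
      · exact (((hφ i).fst.pow 2).sub (((hφ i).fst.mul (am i)).const_mul _)).integrable
      · exact ((am i).pow 2).integrable
      · exact ((hφ i).fst.pow 2).integrable
      · exact (((hφ i).fst.mul (am i)).const_mul _).integrable
    rw [this, n1]
    simp only [sq]
    ring
  have i2 : ∫ p, D i p * V p ∂(π.prod (gam J)) = ∑ j, ∫ p, C j p ^ 2 ∂(π.prod (gam J)) := by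
    have : ∀ j, ∫ p, D i p * (C j p * D j p) ∂(π.prod (gam J)) = ∫ p, C j p ^ 2 ∂(π.prod (gam J)) := by
      intro j
      have n1 := nishi' (a := a) hψm ((hφ i).mul (hφ j)) (measurable_Cv hψ hφ i j) (aC j)
      have n2 := nishi' (a := a) (h := fun Y => av π ψ a (φ j) Y * Cv π ψ a φ i j Y) hψm (hφ i)
        ((measurable_av hψm (hφ j).1).mul (measurable_Cv hψ hφ i j)) ((am j).mul (aC j))
      have n3 := nishi' (a := a) (h := fun Y => av π ψ a (φ i) Y * Cv π ψ a φ i j Y) hψm (hφ j)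
        ((measurable_av hψm (hφ i).1).mul (measurable_Cv hψ hφ i j)) ((am i).mul (aC j))
      have e1 : ∫ p, D i p * (C j p * D j p) ∂(π.prod (gam J)) =
          ∫ p, (φ i p.1 * φ j p.1) * Cv π ψ a φ i j (Yo ψ a p) ∂(π.prod (gam J))
          - ∫ p, φ i p.1 * (av π ψ a (φ j) (Yo ψ a p) * Cv π ψ a φ i j (Yo ψ a p)) ∂(π.prod (gam J))
          - ∫ p, φ j p.1 * (av π ψ a (φ i) (Yo ψ a p) * Cv π ψ a φ i j (Yo ψ a p)) ∂(π.prod (gam J))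
          + ∫ p, av π ψ a (φ i) (Yo ψ a p) * (av π ψ a (φ j) (Yo ψ a p) * Cv π ψ a φ i j (Yo ψ a p))
            ∂(π.prod (gam J)) := by
        have b1 := ((hφ i).fst.mul (hφ j).fst).mul (aC j)
        have b2 := (hφ i).fst.mul ((am j).mul (aC j))
        have b3 := (hφ j).fst.mul ((am i).mul (aC j))
        have b4 := (am i).mul ((am j).mul (aC j))
        rw [← integral_sub b1.integrable b2.integrable, ← integral_sub (b1.sub b2).integrable
          b3.integrable, ← integral_add ((b1.sub b2).sub b3).integrable b4.integrable]
        congr 1; ext p; simp only [hDdef, hCdef]; ring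
      rw [e1, n1, n2, n3]
      have b1 := (AM_av (a := a) hψm ((hφ i).mul (hφ j))).mul (aC j)
      have b4 := (am i).mul ((am j).mul (aC j))
      have b3 := (am j).mul ((am i).mul (aC j))
      rw [← integral_sub b1.integrable b4.integrable, ← integral_sub (b1.sub b4).integrable
          b3.integrable, ← integral_add ((b1.sub b4).sub b3).integrable b4.integrable]
      congr 1; ext p; simp only [hCdef, Cv]; ring
    simp only [hVdef, Finset.mul_sum]
    rw [integral_finsetSum]
    · exact Finset.sum_congr rfl fun j _ => this j
    · intro j _; exact ((aD i).mul ((aC j).mul (aD j))).integrable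
  have i3 : ∫ p, N p ^ 2 ∂(π.prod (gam J)) = ∑ j, ∫ p, C j p ^ 2 ∂(π.prod (gam J)) := by
    have : ∀ p, N p ^ 2 = ∑ j, ∑ l, p.2 (e j) * (p.2 (e l) * (C j p * C l p)) := by
      intro p
      simp only [hNdef, sq, Finset.sum_mul_sum]
      refine Finset.sum_congr rfl fun j _ => Finset.sum_congr rfl fun l _ => ?_
      ring
    simp only [this]
    rw [integral_finsetSum]
    swap
    · intro j _
      exact (AM.sum _ fun l _ => (AM.noise _).mul ((AM.noise _).mul ((aC j).mul (aC l)))).integrable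
    refine Finset.sum_congr rfl fun j _ => ?_
    rw [integral_finsetSum]
    swap
    · intro l _
      exact ((AM.noise _).mul ((AM.noise _).mul ((aC j).mul (aC l)))).integrable
    have : ∀ l, ∫ p, p.2 (e j) * (p.2 (e l) * (C j p * C l p)) ∂(π.prod (gam J)) =
        if j = l then ∫ p, C j p * C l p ∂(π.prod (gam J)) else 0 := by
      intro l
      rw [noise_two ((aC j).mul (aC l)) (e j) (e l) (fun x y t => by simp only [hCdef, hinvC])]
      simp only [he.eq_iff]
      rfl
    simp only [this, Finset.sum_ite_eq, Finset.mem_univ, if_true, sq]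
  have i4 : ∀ A : X × (J → ℝ) → ℝ, AM (π.prod (gam J)) A →
      (∀ k x y t, A (x, Function.update y (e k) t) = A (x, y)) →
      ∫ p, N p * A p ∂(π.prod (gam J)) = 0 := by
    intro A hA hAi
    have : ∀ p, N p * A p = ∑ j, p.2 (e j) * (C j p * A p) := by
      intro p
      simp only [hNdef, Finset.sum_mul]
      exact Finset.sum_congr rfl fun j _ => by ring
    simp only [this]
    rw [integral_finsetSum _ (fun j _ => ((AM.noise _).mul ((aC j).mul hA)).integrable)]
    refine Finset.sum_eq_zero fun j _ => ?_
    exact noise_zero ((aC j).mul hA) (e j) fun x y t => by simp only [hCdef, hinvC, hAi]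
  have i5 : ∫ p, N p * D i p ∂(π.prod (gam J)) = 0 :=
    i4 (D i) (aD i) fun k x y t => by simp only [hDdef, hinv]
  have i6 : ∫ p, N p * V p ∂(π.prod (gam J)) = 0 :=
    i4 V aV fun k x y t => by simp only [hVdef, hDdef, hCdef, hinv, hinvC]
  have tot : ∫ p, (D i p - δ ^ 2 * V p - δ * N p) ^ 2 ∂(π.prod (gam J)) =
      ∫ p, D i p ^ 2 ∂(π.prod (gam J)) - (2 * δ ^ 2) * ∫ p, D i p * V p ∂(π.prod (gam J))
      + δ ^ 4 * ∫ p, V p ^ 2 ∂(π.prod (gam J)) + δ ^ 2 * ∫ p, N p ^ 2 ∂(π.prod (gam J))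
      - (2 * δ) * ∫ p, N p * D i p ∂(π.prod (gam J))
      + (2 * δ ^ 3) * ∫ p, N p * V p ∂(π.prod (gam J)) := by
    have b1 := (aD i).pow 2
    have b2 := ((aD i).mul aV).const_mul (2 * δ ^ 2)
    have b3 := (aV.pow 2).const_mul (δ ^ 4)
    have b4 := (aN.pow 2).const_mul (δ ^ 2)
    have b5 := (aN.mul (aD i)).const_mul (2 * δ)
    have b6 := (aN.mul aV).const_mul (2 * δ ^ 3)
    rw [← integral_const_mul, ← integral_const_mul, ← integral_const_mul, ← integral_const_mul,
      ← integral_const_mul, ← integral_sub b1.integrable b2.integrable,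
      ← integral_add (b1.sub b2).integrable b3.integrable,
      ← integral_add ((b1.sub b2).add b3).integrable b4.integrable,
      ← integral_sub (((b1.sub b2).add b3).add b4).integrable b5.integrable,
      ← integral_add ((((b1.sub b2).add b3).add b4).sub b5).integrable b6.integrable]
    congr 1; ext p; ring
  rw [tot, i1, i2, i3, i5, i6] at hopt
  linarith

end Thermal
end Aux

namespace Aux
set_option linter.unusedSectionVars false
set_option linter.unusedSimpArgs false

/-- Index set of the observations: matrix part and side channel part. -/
abbrev Ix (n K : ℕ) := (Fin n × Fin n) ⊕ (Fin K × Fin n)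

/-- Signals. -/
def ps (n K : ℕ) : Ix n K → (Fin n → ℝ) → ℝ :=
  Sum.elim (fun q x => x q.1 * x q.2) (fun q x => x q.2)

/-- Weights. -/
def wt {n : ℕ} (i j : Fin n) : ℝ := if i < j then 1 else if i = j then (√2)⁻¹ else 0

/-- Amplitudes. -/
def amp {n K : ℕ} (c : ℝ) (d : Fin K → ℝ) : Ix n K → ℝ :=
  Sum.elim (fun q => c * wt q.1 q.2) (fun q => d q.1)

/-- Prior. -/
def pr (n : ℕ) (v : NNReal) : Measure (Fin n → ℝ) := Measure.pi fun _ => gaussianReal 0 v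

instance (n : ℕ) (v : NNReal) : IsProbabilityMeasure (pr n v) := by unfold pr; infer_instance

/-- Joint law of signal and noise. -/
def mu (n K : ℕ) (v : NNReal) : Measure ((Fin n → ℝ) × (Ix n K → ℝ)) :=
  (pr n v).prod (gam (Ix n K))

instance (n K : ℕ) (v : NNReal) : IsProbabilityMeasure (mu n K v) := by unfold mu; infer_instance

/-- Posterior averages along the channel. -/
def avp {n K : ℕ} (v : NNReal) (c : ℝ) (d : Fin K → ℝ) (f : (Fin n → ℝ) → ℝ)
    (p : (Fin n → ℝ) × (Ix n K → ℝ)) : ℝ :=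
  av (pr n v) (ps n K) (amp c d) f (Yo (ps n K) (amp c d) p)

variable {n K : ℕ} {v : NNReal} {c : ℝ} {d : Fin K → ℝ}

lemma AM_x (i : Fin n) : AM (pr n v) (fun x => x i) := AM_coord i

lemma AM_xx (i j : Fin n) : AM (pr n v) (fun x => x i * x j) := (AM_x i).mul (AM_x j)

lemma AM_ps (j : Ix n K) : AM (pr n v) (ps n K j) := by
  rcases j with q | q
  · exact AM_xx q.1 q.2
  · exact AM_x q.2

lemma ms_ps (j : Ix n K) : Measurable (ps n K j) := (AM_ps (v := 1) j).1

lemma AM_avp {f : (Fin n → ℝ) → ℝ} (hf : AM (pr n v) f) : AM (mu n K v) (avp v c d f) :=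
  AM_av ms_ps hf

lemma wt_sq (i j : Fin n) : wt i j ^ 2 + wt j i ^ 2 = 1 := by
  unfold wt
  rcases lt_trichotomy i j with h | h | h
  · simp [h, h.not_gt, h.ne']
  · subst h; simp; norm_num
  · simp [h, h.not_gt, h.ne']

lemma sum_wt (S : Fin n → Fin n → ℝ) (hS : ∀ i j, S i j = S j i) :
    ∑ i, ∑ j, wt i j ^ 2 * S i j = (1 / 2) * ∑ i, ∑ j, S i j := by
  have h1 : ∑ i, ∑ j, wt i j ^ 2 * S i j = ∑ i, ∑ j, wt j i ^ 2 * S i j := by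
    rw [Finset.sum_comm]
    refine Finset.sum_congr rfl fun i _ => Finset.sum_congr rfl fun j _ => ?_
    rw [hS]
  have h2 : ∑ i, ∑ j, wt i j ^ 2 * S i j + ∑ i, ∑ j, wt j i ^ 2 * S i j = ∑ i, ∑ j, S i j := by
    simp only [← Finset.sum_add_distrib, ← add_mul, wt_sq, one_mul]
  linarith

/-- `n r` -/
def RR (n : ℕ) {K : ℕ} (v : NNReal) (c : ℝ) (d : Fin K → ℝ) : ℝ :=
  ∑ i : Fin n, ∫ p, avp v c d (fun x => x i) p ^ 2 ∂(mu n K v)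

/-- `n² Q` -/
def QQ (n : ℕ) {K : ℕ} (v : NNReal) (c : ℝ) (d : Fin K → ℝ) : ℝ :=
  ∑ i : Fin n, ∑ j : Fin n, ∫ p, avp v c d (fun x => x i * x j) p ^ 2 ∂(mu n K v)

/-- `n² T` -/
def TT (n : ℕ) {K : ℕ} (v : NNReal) (c : ℝ) (d : Fin K → ℝ) : ℝ :=
  ∑ i : Fin n, ∑ j : Fin n, ∫ p, avp v c d (fun x => x j) p *
    (avp v c d (fun x => x i) p * avp v c d (fun x => x i * x j) p) ∂(mu n K v)

/-- `U` -/
def UU (n : ℕ) {K : ℕ} (v : NNReal) (c : ℝ) (d : Fin K → ℝ) : ℝ :=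
  ∑ i : Fin n, ∑ j : Fin n, ∫ p, avp v c d (fun x => x j) p *
    avp v c d (fun x => x i * (x i * x j)) p ∂(mu n K v)

lemma mom2 (hv : v ≠ 0) (i : Fin n) : ∫ x, x i * x i ∂(pr n v) = v := by
  have := steinPi (J := Fin n) hv i (F := fun x => x i) (F' := fun _ => 1)
    (fun y t => by simpa using hasDerivAt_id' t) (AM_x i).integrable (AM_xx i i).integrable
    (integrable_const _)
  simpa [pr] using this

lemma mom4 (hv : v ≠ 0) (i j : Fin n) : ∫ x, (x i * x j) ^ 2 ∂(pr n v)
    = v ^ 2 * (1 + if i = j then 2 else 0) := by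
  have h := steinPi (J := Fin n) hv i (F := fun x => x i * (x j * x j))
    (F' := fun x => x j * x j + (if i = j then 2 else 0) * (x i * x i)) ?_
    ((AM_x i).mul (AM_xx j j)).integrable ((AM_x i).mul ((AM_x i).mul (AM_xx j j))).integrable
    ((AM_xx j j).add ((AM_xx i i).const_mul _)).integrable
  · have e : ∫ x, (x i * x j) ^ 2 ∂(pr n v) = ∫ x, x i * (x i * (x j * x j)) ∂(pr n v) := by
      congr 1; ext x; ring
    rw [e]
    change ∫ x, x i * (x i * (x j * x j)) ∂(pr n v) = v * ∫ x, _ ∂(pr n v) at h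
    rw [h, integral_add (AM_xx j j).integrable ((AM_xx i i).const_mul _).integrable,
      integral_const_mul, mom2 hv, mom2 hv]
    ring
  · intro y t
    by_cases hij : i = j
    · subst hij
      simp only [Function.update_self, if_true]
      have h1 := (hasDerivAt_id' t)
      exact (h1.mul (h1.mul h1)).congr_deriv (by simp; ring)
    · simp only [Function.update_self, Function.update_of_ne (Ne.symm hij), if_neg hij]
      exact ((hasDerivAt_id' t).mul_const _).congr_deriv (by ring)

lemma mom4_sum (hv : v ≠ 0) : ∑ i, ∑ j, ∫ x, (x i * x j) ^ 2 ∂(pr n v) = v ^ 2 * (n * (n + 2)) := by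
  simp only [mom4 hv, ← Finset.mul_sum]
  simp [Finset.sum_add_distrib]
  left; ring

lemma integral_fst' (f : (Fin n → ℝ) → ℝ) : ∫ p, f p.1 ∂(mu n K v) = ∫ x, f x ∂(pr n v) := by
  unfold mu
  rw [integral_fun_fst]
  simp

lemma QQ_le (hv : v ≠ 0) : QQ n v c d ≤ v ^ 2 * (n * (n + 2)) := by
  rw [← mom4_sum hv, QQ]
  refine Finset.sum_le_sum fun i _ => Finset.sum_le_sum fun j _ => ?_
  rw [← integral_fst' (K := K) (fun x => (x i * x j) ^ 2)]
  exact integral_av_sq_le ms_ps (AM_xx i j)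

lemma RR_le (hv : v ≠ 0) : RR n v c d ≤ n * v := by
  have : ∀ i : Fin n, ∫ p, avp v c d (fun x => x i) p ^ 2 ∂(mu n K v) ≤ v := by
    intro i
    rw [← mom2 hv i, ← integral_fst' (K := K) (fun x => (x i * x i))]
    have := integral_av_sq_le (a := amp c d) (ms_ps (n := n) (K := K)) (AM_x (v := v) i)
    simpa only [sq, avp, mu] using this
  refine (Finset.sum_le_sum fun i _ => this i).trans ?_
  simp

lemma RR_nonneg : 0 ≤ RR n v c d :=
  Finset.sum_nonneg fun _ _ => integral_nonneg fun _ => sq_nonneg _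

lemma QQ_nonneg : 0 ≤ QQ n v c d :=
  Finset.sum_nonneg fun _ _ => Finset.sum_nonneg fun _ _ => integral_nonneg fun _ => sq_nonneg _

/-- Averaged Schwinger-Dyson equation for the model. -/
lemma sd_model (hv : v ≠ 0) :
    RR n v c d = v * (c ^ 2 * (UU n v c d - TT n v c d) + (∑ k, d k ^ 2) * (n * v - RR n v c d)) := by
  have am := fun i : Fin n => AM_avp (c := c) (d := d) (AM_x (v := v) i)
  have aM := fun i j : Fin n => AM_avp (c := c) (d := d) (AM_xx (v := v) i j)
  have aT := fun i j k : Fin n => AM_avp (c := c) (d := d) ((AM_x (v := v) i).mul (AM_xx j k))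
  -- the key integrals
  set S : Fin n → Fin n → ℝ := fun k l => ∫ p, avp v c d (fun x => x l) p *
    (avp v c d (fun x => x k * (x k * x l)) p
      - avp v c d (fun x => x k) p * avp v c d (fun x => x k * x l) p) ∂(mu n K v) with hS
  let G : Fin n → Ix n K → (Fin n → ℝ) → ℝ := fun i => Sum.elim
    (fun q x => (if q.1 = i then x q.2 else 0) + (if q.2 = i then x q.1 else 0))
    (fun q _ => if q.2 = i then 1 else 0)
  have hGm : ∀ i j, AM (pr n v) (G i j) := by
    intro i j
    rcases j with q | q
    · refine AM.add ?_ ?_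
      · split_ifs
        · exact AM_x _
        · exact AM.const 0
      · split_ifs
        · exact AM_x _
        · exact AM.const 0
    · exact AM.const _
  have hG : ∀ i j x t, HasDerivAt (fun t => ps n K j (Function.update x i t))
      (G i j (Function.update x i t)) t := by
    intro i j x t
    have hu : HasDerivAt (Function.update x i) (Pi.single i (1 : ℝ)) t := hasDerivAt_update x i t
    rw [hasDerivAt_pi] at hu
    rcases j with q | q
    · refine ((hu q.1).fun_mul (hu q.2)).congr_deriv ?_
      simp only [G, Sum.elim_inl, Pi.single_apply]
      split_ifs <;> simp
    · refine (hu q.2).congr_deriv ?_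
      simp only [G, Sum.elim_inr, Pi.single_apply]
  have hsd := fun i => sd (a := amp c d) hv (fun j => AM_ps (K := K) j) (hGm i) (hG i)
    (π := pr n v) rfl
  have hinl : ∀ (i k l : Fin n), ∫ p, av (pr n v) (ps n K) (amp c d) (G i (Sum.inl (k, l)))
      (Yo (ps n K) (amp c d) p) *
      (av (pr n v) (ps n K) (amp c d) (fun x => x i * ps n K (Sum.inl (k, l)) x) (Yo (ps n K) (amp c d) p)
        - av (pr n v) (ps n K) (amp c d) (fun x => x i) (Yo (ps n K) (amp c d) p) *
          av (pr n v) (ps n K) (amp c d) (ps n K (Sum.inl (k, l))) (Yo (ps n K) (amp c d) p))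
        ∂((pr n v).prod (gam (Ix n K))) =
      (if k = i then S k l else 0) + (if l = i then S l k else 0) := by
    intro i k l
    have e0 : ∀ Y, av (pr n v) (ps n K) (amp c d) (G i (Sum.inl (k, l))) Y =
        (if k = i then av (pr n v) (ps n K) (amp c d) (fun x => x l) Y else 0) +
        (if l = i then av (pr n v) (ps n K) (amp c d) (fun x => x k) Y else 0) := by
      intro Y
      simp only [G, Sum.elim_inl]
      have := av_const (π := pr n v) (a := amp c d) (ms_ps (n := n) (K := K)) 0 Y
      by_cases h1 : k = i <;> by_cases h2 : l = i <;> simp only [h1, h2, if_true, if_false, add_zero,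
        zero_add, this]
      rw [av_add ms_ps (AM_x _).integrable (AM_x _).integrable]
    have eA : ∫ p, (if k = i then avp v c d (fun x => x l) p else 0) *
        (avp v c d (fun x => x i * (x k * x l)) p
          - avp v c d (fun x => x i) p * avp v c d (fun x => x k * x l) p) ∂(mu n K v) =
        if k = i then S k l else 0 := by
      split_ifs with h
      · subst h; rfl
      · simp
    have eB : ∫ p, (if l = i then avp v c d (fun x => x k) p else 0) *
        (avp v c d (fun x => x i * (x k * x l)) p
          - avp v c d (fun x => x i) p * avp v c d (fun x => x k * x l) p) ∂(mu n K v) =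
        if l = i then S l k else 0 := by
      split_ifs with h
      · subst h
        simp only [hS]
        have : ∀ x : Fin n → ℝ, x k * x l = x l * x k := fun x => mul_comm _ _
        simp only [this]
      · simp
    rw [← eA, ← eB, ← integral_add]
    · simp only [e0]
      change ∫ p, ((if k = i then avp v c d (fun x => x l) p else 0) +
        (if l = i then avp v c d (fun x => x k) p else 0)) *
        (avp v c d (fun x => x i * (x k * x l)) p
          - avp v c d (fun x => x i) p * avp v c d (fun x => x k * x l) p) ∂(mu n K v) = _
      simp only [add_mul]
    · split_ifs
      · exact ((am l).mul ((aT i k l).sub ((am i).mul (aM k l)))).integrable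
      · simp
    · split_ifs
      · exact ((am k).mul ((aT i k l).sub ((am i).mul (aM k l)))).integrable
      · simp
  have hinr : ∀ (i : Fin n) (k : Fin K) (l : Fin n),
      ∫ p, av (pr n v) (ps n K) (amp c d) (G i (Sum.inr (k, l))) (Yo (ps n K) (amp c d) p) *
      (av (pr n v) (ps n K) (amp c d) (fun x => x i * ps n K (Sum.inr (k, l)) x) (Yo (ps n K) (amp c d) p)
        - av (pr n v) (ps n K) (amp c d) (fun x => x i) (Yo (ps n K) (amp c d) p) *
          av (pr n v) (ps n K) (amp c d) (ps n K (Sum.inr (k, l))) (Yo (ps n K) (amp c d) p))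
        ∂((pr n v).prod (gam (Ix n K))) =
      (if l = i then (v - ∫ p, avp v c d (fun x => x l) p ^ 2 ∂(mu n K v)) else 0) := by
    intro i k l
    simp only [G, Sum.elim_inr, av_const (ms_ps (n := n) (K := K))]
    split_ifs with h
    · subst h
      have e1 : ∫ p, avp v c d (fun x => x l * x l) p ∂(mu n K v) = v := by
        rw [← mom2 hv l, ← integral_fst' (K := K) (fun x => x l * x l)]
        exact (nishi1 (a := amp c d) ms_ps (AM_xx l l)).symm
      rw [← e1, ← integral_sub (aM l l).integrable ((am l).pow 2).integrable]
      simp only [one_mul, sq]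
      rfl
    · simp
  have hR : RR n v c d = ∑ i, v * ∑ j, amp c d j ^ 2 *
      ∫ p, av (pr n v) (ps n K) (amp c d) (G i j) (Yo (ps n K) (amp c d) p) *
      (av (pr n v) (ps n K) (amp c d) (fun x => x i * ps n K j x) (Yo (ps n K) (amp c d) p)
        - av (pr n v) (ps n K) (amp c d) (fun x => x i) (Yo (ps n K) (amp c d) p) *
          av (pr n v) (ps n K) (amp c d) (ps n K j) (Yo (ps n K) (amp c d) p))
        ∂((pr n v).prod (gam (Ix n K))) :=
    Finset.sum_congr rfl fun i _ => hsd i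
  refine hR.trans ?_
  rw [← Finset.mul_sum]
  congr 1
  rw [Finset.sum_comm, Fintype.sum_sum_type, Fintype.sum_prod_type, Fintype.sum_prod_type]
  have ha1 : ∀ k l, (amp c d : Ix n K → ℝ) (Sum.inl (k, l)) = c * wt k l := fun _ _ => rfl
  have ha2 : ∀ k l, (amp c d : Ix n K → ℝ) (Sum.inr (k, l)) = d k := fun _ _ => rfl
  simp only [← Finset.mul_sum, hinl, hinr, ha1, ha2, Finset.sum_add_distrib, Finset.sum_ite_eq,
    Finset.mem_univ, if_true, mul_pow, mul_assoc]
  congr 1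
  · congr 1
    rw [sum_wt (fun k l => S k l + S l k) (fun k l => add_comm _ _)]
    simp only [Finset.sum_add_distrib]
    rw [Finset.sum_comm (f := fun k l => S l k)]
    have : UU n v c d - TT n v c d = ∑ k, ∑ l, S k l := by
      simp only [UU, TT, hS, ← Finset.sum_sub_distrib]
      refine Finset.sum_congr rfl fun k _ => Finset.sum_congr rfl fun l _ => ?_
      rw [← integral_sub ((am l).mul (aT k k l)).integrable
        ((am l).mul ((am k).mul (aM k l))).integrable]
      congr 1; ext p; ring
    rw [this]; ring
  · rw [← Finset.sum_mul]
    congr 1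
    simp [RR, Finset.sum_sub_distrib]

end Aux

namespace Aux
set_option linter.unusedSectionVars false
set_option linter.unusedSimpArgs false

variable {n K : ℕ} {v : NNReal} {c : ℝ} {d : Fin K → ℝ}

lemma avp_lin (b : Fin n → ℝ) (p : (Fin n → ℝ) × (Ix n K → ℝ)) :
    avp v c d (fun x => ∑ i, b i * x i) p = ∑ i, b i * avp v c d (fun x => x i) p := by
  unfold avp
  rw [av_sum ms_ps _ fun i _ => ((AM_x i).const_mul _).integrable]
  simp only [av_const_mul]

lemma avp_quad (b : Fin n → Fin n → ℝ) (p : (Fin n → ℝ) × (Ix n K → ℝ)) :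
    avp v c d (fun x => ∑ i, ∑ j, b i j * (x i * x j)) p
      = ∑ i, ∑ j, b i j * avp v c d (fun x => x i * x j) p := by
  unfold avp
  rw [av_sum ms_ps _ fun i _ => (AM.sum _ fun j _ => ((AM_xx i j).const_mul _)).integrable]
  refine Finset.sum_congr rfl fun i _ => ?_
  rw [av_sum ms_ps _ fun j _ => ((AM_xx i j).const_mul _).integrable]
  simp only [av_const_mul]

lemma psd (b : Fin n → ℝ) (p : (Fin n → ℝ) × (Ix n K → ℝ)) :
    (∑ i, b i * avp v c d (fun x => x i) p) ^ 2 ≤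
      ∑ i, ∑ j, (b i * b j) * avp v c d (fun x => x i * x j) p := by
  rw [← avp_lin, ← avp_quad]
  have h := av_sq_le (a := amp c d) (ms_ps (n := n) (K := K)) (f := fun x => ∑ i, b i * x i)
    (AM.sum (μ := pr n v) _ fun i _ => ((AM_x i).const_mul _)) (Yo (ps n K) (amp c d) p)
  refine h.trans (le_of_eq ?_)
  unfold avp
  congr 1
  ext x
  rw [sq, Finset.sum_mul_sum]
  refine Finset.sum_congr rfl fun i _ => Finset.sum_congr rfl fun j _ => ?_
  ring

/-- Posterior covariance. -/
def Cp {n K : ℕ} (v : NNReal) (c : ℝ) (d : Fin K → ℝ) (i j : Fin n)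
    (p : (Fin n → ℝ) × (Ix n K → ℝ)) : ℝ :=
  avp v c d (fun x => x i * x j) p - avp v c d (fun x => x i) p * avp v c d (fun x => x j) p

lemma AM_Cp (i j : Fin n) : AM (mu n K v) (Cp v c d i j) :=
  (AM_avp (AM_xx i j)).sub ((AM_avp (AM_x i)).mul (AM_avp (AM_x j)))

lemma MC_nonneg (p : (Fin n → ℝ) × (Ix n K → ℝ)) :
    0 ≤ ∑ i, ∑ j, avp v c d (fun x => x i * x j) p * Cp v c d i j p := by
  have e : ∑ i, ∑ j, avp v c d (fun x => x i * x j) p * Cp v c d i j p =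
      avp v c d (fun x => ∑ i, ∑ j, Cp v c d i j p * (x i * x j)) p := by
    rw [avp_quad]
    refine Finset.sum_congr rfl fun i _ => Finset.sum_congr rfl fun j _ => ?_
    ring
  rw [e]
  refine av_nonneg (fun x => ?_) _
  have h := psd (v := v) (c := c) (d := d) x p
  rw [sq, Finset.sum_mul_sum] at h
  have : ∑ i, ∑ j, Cp v c d i j p * (x i * x j) =
      ∑ i, ∑ j, (x i * x j) * avp v c d (fun x => x i * x j) p -
      ∑ i, ∑ j, x i * avp v c d (fun x => x i) p * (x j * avp v c d (fun x => x j) p) := by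
    simp only [← Finset.sum_sub_distrib, Cp]
    refine Finset.sum_congr rfl fun i _ => Finset.sum_congr rfl fun j _ => ?_
    ring
  rw [this]; linarith

/-- `∑ E C²` -/
def CC (n : ℕ) {K : ℕ} (v : NNReal) (c : ℝ) (d : Fin K → ℝ) : ℝ :=
  ∑ i : Fin n, ∑ j : Fin n, ∫ p, Cp v c d i j p ^ 2 ∂(mu n K v)

lemma QQ_sub_TT : QQ n v c d - TT n v c d =
    ∑ i, ∑ j, ∫ p, avp v c d (fun x => x i * x j) p * Cp v c d i j p ∂(mu n K v) := by
  simp only [QQ, TT, ← Finset.sum_sub_distrib]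
  refine Finset.sum_congr rfl fun i _ => Finset.sum_congr rfl fun j _ => ?_
  rw [← integral_sub ((AM_avp (AM_xx i j)).pow 2).integrable
    ((AM_avp (AM_x j)).mul ((AM_avp (AM_x i)).mul (AM_avp (AM_xx i j)))).integrable]
  congr 1; ext p; simp only [Cp]; ring

lemma int_sum2 {f : Fin n → Fin n → (Fin n → ℝ) × (Ix n K → ℝ) → ℝ}
    (hf : ∀ i j, AM (mu n K v) (f i j)) :
    ∫ p, ∑ i, ∑ j, f i j p ∂(mu n K v) = ∑ i, ∑ j, ∫ p, f i j p ∂(mu n K v) := by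
  rw [integral_finsetSum _ fun i _ => (AM.sum _ fun j _ => hf i j).integrable]
  refine Finset.sum_congr rfl fun i _ => ?_
  rw [integral_finsetSum _ fun j _ => (hf i j).integrable]

lemma TT_le_QQ : TT n v c d ≤ QQ n v c d := by
  have h := QQ_sub_TT (n := n) (v := v) (c := c) (d := d)
  rw [← int_sum2 fun i j => (AM_avp (AM_xx i j)).mul (AM_Cp i j)] at h
  have := integral_nonneg (μ := mu n K v) (f := fun p => ∑ i, ∑ j,
    avp v c d (fun x => x i * x j) p * Cp v c d i j p) (fun p => MC_nonneg p)
  linarith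

lemma QQ_sub_TT_le {s : ℝ} (hs : 0 < s) :
    QQ n v c d - TT n v c d ≤ (1 / 2) * (s * QQ n v c d + s⁻¹ * CC n v c d) := by
  rw [QQ_sub_TT]
  simp only [QQ, CC, Finset.mul_sum, ← Finset.sum_add_distrib]
  refine Finset.sum_le_sum fun i _ => Finset.sum_le_sum fun j _ => ?_
  have hM := AM_avp (c := c) (d := d) (AM_xx (v := v) i j)
  have hC := AM_Cp (v := v) (c := c) (d := d) i j
  rw [← integral_const_mul, ← integral_const_mul, ← integral_add
    ((hM.pow 2).const_mul _).integrable ((hC.pow 2).const_mul _).integrable, ← integral_const_mul]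
  refine integral_mono (hM.mul hC).integrable
    ((((hM.pow 2).const_mul _).add ((hC.pow 2).const_mul _)).const_mul _).integrable fun p => ?_
  set M := avp v c d (fun x => x i * x j) p
  set C := Cp v c d i j p
  change M * C ≤ 1 / 2 * (s * M ^ 2 + s⁻¹ * C ^ 2)
  have : s * M ^ 2 + s⁻¹ * C ^ 2 - 2 * (M * C) = s * (M - s⁻¹ * C) ^ 2 := by
    field_simp; ring
  nlinarith [mul_nonneg hs.le (sq_nonneg (M - s⁻¹ * C))]

lemma sq_int_le {Ω : Type*} [MeasurableSpace Ω] {μ : Measure Ω} [IsProbabilityMeasure μ]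
    {f : Ω → ℝ} (hf : AM μ f) : (∫ p, f p ∂μ) ^ 2 ≤ ∫ p, f p ^ 2 ∂μ := by
  set m := ∫ p, f p ∂μ with hm
  have h : 0 ≤ ∫ p, (f p - m) ^ 2 ∂μ := integral_nonneg fun _ => sq_nonneg _
  have e : ∀ p, (f p - m) ^ 2 = (f p ^ 2 - (2 * m) * f p) + m ^ 2 := fun p => by ring
  simp only [e] at h
  rw [integral_add ((hf.pow 2).sub (hf.const_mul _)).integrable (integrable_const _),
    integral_sub (hf.pow 2).integrable (hf.const_mul _).integrable, integral_const_mul, ← hm] at h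
  simp at h
  nlinarith

lemma RR_sq_le : RR n v c d ^ 2 ≤ TT n v c d := by
  have am := fun i : Fin n => AM_avp (c := c) (d := d) (AM_x (v := v) i)
  have aM := fun i j : Fin n => AM_avp (c := c) (d := d) (AM_xx (v := v) i j)
  have aS : AM (mu n K v) (fun p => ∑ i : Fin n, avp v c d (fun x => x i) p ^ 2) :=
    AM.sum _ fun i _ => (am i).pow 2
  have h1 : RR n v c d = ∫ p, ∑ i, avp v c d (fun x => x i) p ^ 2 ∂(mu n K v) := by
    rw [integral_finsetSum _ fun i _ => ((am i).pow 2).integrable]; rfl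
  rw [h1]
  refine (sq_int_le aS).trans ?_
  have h2 : TT n v c d = ∫ p, ∑ i, ∑ j, (avp v c d (fun x => x j) p *
    (avp v c d (fun x => x i) p * avp v c d (fun x => x i * x j) p)) ∂(mu n K v) := by
    rw [int_sum2 fun i j => (am j).mul ((am i).mul (aM i j))]; rfl
  rw [h2]
  refine integral_mono (aS.pow 2).integrable (AM.sum _ fun i _ => AM.sum _ fun j _ =>
    (am j).mul ((am i).mul (aM i j))).integrable fun p => ?_
  have := psd (v := v) (c := c) (d := d) (fun i => avp v c d (fun x => x i) p) p
  simp only [← sq] at this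
  refine this.trans (le_of_eq ?_)
  refine Finset.sum_congr rfl fun i _ => Finset.sum_congr rfl fun j _ => ?_
  ring

lemma TT_nonneg : 0 ≤ TT n v c d := (sq_nonneg _).trans RR_sq_le

lemma sq_mono {X : Type*} [MeasurableSpace X] {π : Measure X} {J : Type*} [Fintype J]
    {ψ : J → X → ℝ} {a a' : J → ℝ} [IsProbabilityMeasure π] (hψ : ∀ j, Measurable (ψ j))
    (haa : ∀ j, a j ≠ 0 → a' j = a j) {f : X → ℝ} (hf : AM π f) :
    ∫ p, (av π ψ a f (Yo ψ a p)) ^ 2 ∂(π.prod (gam J)) ≤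
    ∫ p, (av π ψ a' f (Yo ψ a' p)) ^ 2 ∂(π.prod (gam J)) := by
  have hav : ∀ p, av π ψ a f (Yo ψ a' p) = av π ψ a f (Yo ψ a p) := fun p =>
    av_congr (fun j hj => by simp only [Yo, haa j hj]) f
  have hh := AM_av (a := a) hψ hf
  have hh' : AM (π.prod (gam J)) (fun p => av π ψ a f (Yo ψ a' p)) := by
    simpa only [hav] using hh
  have hma : Measurable (av π ψ a f) := measurable_av (a := a) hψ hf.1
  have h := opt (a := a') (h := av π ψ a f) hψ hf hma hh'
  simp only [hav] at h
  have e : ∀ p : X × (J → ℝ), (f p.1 - av π ψ a f (Yo ψ a p)) ^ 2 =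
      (f p.1 ^ 2 - 2 * (f p.1 * av π ψ a f (Yo ψ a p))) + av π ψ a f (Yo ψ a p) ^ 2 :=
    fun p => by ring
  have e1 := nishi' (a := a) (h := av π ψ a f) hψ hf hma hh
  simp only [← sq] at e1
  simp only [e] at h
  rw [integral_add ((hf.fst.pow 2).sub ((hf.fst.mul hh).const_mul _)).integrable
    (hh.pow 2).integrable, integral_sub (hf.fst.pow 2).integrable
    ((hf.fst.mul hh).const_mul _).integrable, integral_const_mul, e1] at h
  linarith

lemma QQ_mono : QQ n v c (fun _ : Fin K => 0) ≤ QQ n v c d := by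
  refine Finset.sum_le_sum fun i _ => Finset.sum_le_sum fun j _ => ?_
  refine sq_mono ms_ps (fun l hl => ?_) (AM_xx i j)
  rcases l with l | l
  · rfl
  · simp [amp] at hl

lemma UU_le (hv : v ≠ 0) (hn : 1 ≤ n) :
    UU n v c d ≤ n * v * RR n v c d + 5 / 2 * v ^ 2 * (n * √n) := by
  have am := fun i : Fin n => AM_avp (c := c) (d := d) (AM_x (v := v) i)
  have aM := fun i j : Fin n => AM_avp (c := c) (d := d) (AM_xx (v := v) i j)
  have ax : ∀ i : Fin n, AM (mu n K v) (fun p => p.1 i) :=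
    fun i => (AM_x (v := v) i).fst (J := Ix n K)
  have axx : ∀ i j : Fin n, AM (mu n K v) (fun p => p.1 i * p.1 j) :=
    fun i j => (AM_xx (v := v) i j).fst (J := Ix n K)
  set N2 : (Fin n → ℝ) × (Ix n K → ℝ) → ℝ := fun p => (∑ i, p.1 i * p.1 i) - n * v with hN2
  set W : (Fin n → ℝ) × (Ix n K → ℝ) → ℝ := fun p => ∑ j, p.1 j * avp v c d (fun x => x j) p with hW
  have aN2 : AM (mu n K v) N2 := (AM.sum _ fun i _ => axx i i).sub (AM.const _)
  have aW : AM (mu n K v) W := AM.sum _ fun j _ => (ax j).mul (am j)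
  have eU : UU n v c d = ∫ p, (∑ i, p.1 i * p.1 i) * W p ∂(mu n K v) := by
    have : ∀ p : (Fin n → ℝ) × (Ix n K → ℝ), (∑ i, p.1 i * p.1 i) * W p =
        ∑ i, ∑ j, (p.1 i * (p.1 i * p.1 j)) * avp v c d (fun x => x j) p := by
      intro p
      rw [hW, Finset.sum_mul_sum]
      refine Finset.sum_congr rfl fun i _ => Finset.sum_congr rfl fun j _ => ?_
      ring
    simp only [this]
    rw [int_sum2 fun i j => ((ax i).mul (axx i j)).mul (am j)]
    refine Finset.sum_congr rfl fun i _ => Finset.sum_congr rfl fun j _ => ?_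
    have := nishi' (a := amp c d) (ms_ps (n := n) (K := K)) ((AM_x (v := v) i).mul (AM_xx i j))
      (measurable_av (π := pr n v) (a := amp c d) ms_ps (AM_x (v := v) j).1) (am j)
    refine Eq.trans ?_ this.symm
    congr 1; ext p; exact mul_comm _ _
  have eR : RR n v c d = ∫ p, W p ∂(mu n K v) := by
    simp only [hW]
    rw [integral_finsetSum _ fun j _ => ((ax j).mul (am j)).integrable]
    refine Finset.sum_congr rfl fun j _ => ?_
    have := nishi' (a := amp c d) (ms_ps (n := n) (K := K)) (AM_x (v := v) j)
      (measurable_av (π := pr n v) (a := amp c d) ms_ps (AM_x (v := v) j).1) (am j)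
    refine Eq.trans ?_ this.symm
    congr 1; ext p; exact sq _
  have eT : TT n v c d = ∫ p, W p ^ 2 ∂(mu n K v) := by
    have : ∀ p : (Fin n → ℝ) × (Ix n K → ℝ), W p ^ 2 =
        ∑ i, ∑ j, (p.1 i * p.1 j) * (avp v c d (fun x => x i) p * avp v c d (fun x => x j) p) := by
      intro p
      rw [hW, sq, Finset.sum_mul_sum]
      refine Finset.sum_congr rfl fun i _ => Finset.sum_congr rfl fun j _ => ?_
      ring
    simp only [this]
    rw [int_sum2 fun i j => (axx i j).mul ((am i).mul (am j))]
    refine Finset.sum_congr rfl fun i _ => Finset.sum_congr rfl fun j _ => ?_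
    have := nishi' (a := amp c d) (ms_ps (n := n) (K := K)) (AM_xx (v := v) i j)
      ((measurable_av (π := pr n v) (a := amp c d) ms_ps (AM_x (v := v) i).1).mul
        (measurable_av (π := pr n v) (a := amp c d) ms_ps (AM_x (v := v) j).1)) ((am i).mul (am j))
    refine Eq.trans ?_ this.symm
    congr 1; ext p; simp only [avp, Pi.mul_apply]; ring
  have eN : ∫ p, N2 p ^ 2 ∂(mu n K v) = 2 * n * v ^ 2 := by
    have e1 : ∀ p : (Fin n → ℝ) × (Ix n K → ℝ), N2 p ^ 2 =
        ((∑ i, ∑ j, (p.1 i * p.1 j) ^ 2) - (2 * n * v) * ∑ i, p.1 i * p.1 i) + (n * v) ^ 2 := by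
      intro p
      have : (∑ i, ∑ j, (p.1 i * p.1 j) ^ 2) = (∑ i, p.1 i * p.1 i) * (∑ i, p.1 i * p.1 i) := by
        rw [Finset.sum_mul_sum]
        refine Finset.sum_congr rfl fun i _ => Finset.sum_congr rfl fun j _ => ?_
        ring
      rw [this, hN2]; ring
    have a1 : AM (mu n K v) (fun p => ∑ i, ∑ j, (p.1 i * p.1 j) ^ 2) :=
      AM.sum _ fun i _ => AM.sum _ fun j _ => (axx i j).pow 2
    have a2 : AM (mu n K v) (fun p => ∑ i, p.1 i * p.1 i) := AM.sum _ fun i _ => axx i i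
    simp only [e1]
    rw [integral_add (a1.sub (a2.const_mul _)).integrable (integrable_const _),
      integral_sub a1.integrable (a2.const_mul _).integrable, integral_const_mul,
      int_sum2 fun i j => (axx i j).pow 2, integral_finsetSum _ fun i _ => (axx i i).integrable]
    have e2 : ∀ i j : Fin n, ∫ p, (p.1 i * p.1 j) ^ 2 ∂(mu n K v) = ∫ x, (x i * x j) ^ 2 ∂(pr n v) :=
      fun i j => integral_fst' (fun x => (x i * x j) ^ 2)
    have e3 : ∀ i : Fin n, ∫ p, p.1 i * p.1 i ∂(mu n K v) = v :=
      fun i => (integral_fst' (fun x => x i * x i)).trans (mom2 hv i)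
    simp only [e2, e3, mom4_sum hv]
    simp
    ring
  have hsn : 0 < √(n : ℝ) := Real.sqrt_pos.2 (by exact_mod_cast hn)
  have hss : √(n : ℝ) * √n = n := Real.mul_self_sqrt (by positivity)
  have hT : TT n v c d ≤ 3 * (n : ℝ) ^ 2 * v ^ 2 := by
    refine (TT_le_QQ.trans (QQ_le hv)).trans ?_
    have h1 : (1 : ℝ) ≤ n := by exact_mod_cast hn
    have h2 : (0 : ℝ) ≤ (v : ℝ) ^ 2 := sq_nonneg _
    nlinarith [mul_nonneg h2 (mul_nonneg (by linarith : (0 : ℝ) ≤ n) (by linarith : (0 : ℝ) ≤ n - 1))]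
  have hdiff : UU n v c d - n * v * RR n v c d = ∫ p, N2 p * W p ∂(mu n K v) := by
    rw [eU, eR, ← integral_const_mul, ← integral_sub
      ((AM.sum _ fun i _ => axx i i).mul aW).integrable (aW.const_mul _).integrable]
    congr 1; ext p; simp only [hN2]; ring
  have hle : ∫ p, N2 p * W p ∂(mu n K v) ≤
      ∫ p, (1 / 2) * (√n * N2 p ^ 2 + (√n)⁻¹ * W p ^ 2) ∂(mu n K v) := by
    refine integral_mono (aN2.mul aW).integrable
      ((((aN2.pow 2).const_mul _).add ((aW.pow 2).const_mul _)).const_mul _).integrable fun p => ?_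
    change N2 p * W p ≤ 1 / 2 * (√n * N2 p ^ 2 + (√n)⁻¹ * W p ^ 2)
    have : √n * N2 p ^ 2 + (√n)⁻¹ * W p ^ 2 - 2 * (N2 p * W p) = √n * (N2 p - (√n)⁻¹ * W p) ^ 2 := by
      field_simp; ring
    nlinarith [mul_nonneg hsn.le (sq_nonneg (N2 p - (√n)⁻¹ * W p))]
  rw [integral_const_mul, integral_add ((aN2.pow 2).const_mul _).integrable
    ((aW.pow 2).const_mul _).integrable, integral_const_mul, integral_const_mul, eN, ← eT] at hle
  have : (√(n : ℝ))⁻¹ * TT n v c d ≤ 3 * (n * √n) * v ^ 2 := by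
    rw [inv_mul_le_iff₀ hsn]
    calc _ ≤ _ := hT
      _ = _ := by linear_combination (-3 * (n : ℝ) * v ^ 2) * hss
  linarith

end Aux

namespace Aux
set_option linter.unusedSectionVars false
set_option linter.unusedSimpArgs false

variable {n K : ℕ} {v : NNReal} {c : ℝ} {d : Fin K → ℝ}

lemma int_av_pow_le {f : (Fin n → ℝ) → ℝ} (hf : AM (pr n v) f) (k : ℕ) (hk : Even k) :
    ∫ p, avp v c d f p ^ k ∂(mu n K v) ≤ ∫ x, f x ^ k ∂(pr n v) := by
  rw [← integral_fst' (K := K)]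
  have e := nishi1 (a := amp c d) (ms_ps (n := n) (K := K)) (hf.pow k)
  refine le_trans ?_ e.symm.le
  refine integral_mono ((AM_avp hf).pow k).integrable (AM_avp (hf.pow k)).integrable fun p => ?_
  have := abs_av_pow_le (a := amp c d) (ms_ps (n := n) (K := K)) hf (Yo (ps n K) (amp c d) p) k
  simp only [hk.pow_abs] at this
  exact this

/-- crude moment bound -/
def Bd (n : ℕ) (v : NNReal) (i : Fin n) : ℝ := n * ∑ j : Fin n, (1 / 2) *
  (8 * (∫ x, (x i * x j) ^ 4 ∂(pr n v) + (1 / 2) * (∫ x, x i ^ 8 ∂(pr n v) + ∫ x, x j ^ 8 ∂(pr n v)))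
   + 8 * (∫ x, x j ^ 4 ∂(pr n v) + ∫ x, x j ^ 4 ∂(pr n v)))

lemma bound_four (a b : ℝ) : (a - b) ^ 4 ≤ 8 * (a ^ 4 + b ^ 4) := by
  nlinarith [sq_nonneg (a ^ 2 - b ^ 2), sq_nonneg (a + b), sq_nonneg ((a + b) ^ 2),
    sq_nonneg (a * b), mul_nonneg (sq_nonneg (a + b)) (sq_nonneg (a - b)),
    mul_nonneg (sq_nonneg (a + b)) (add_nonneg (sq_nonneg a) (sq_nonneg b))]

lemma Bd_bound (i : Fin n) : ∫ p, (∑ j, Cp v c d i j p *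
    (p.1 j - avp v c d (fun x => x j) p)) ^ 2 ∂(mu n K v) ≤ Bd n v i := by
  have am := fun i : Fin n => AM_avp (c := c) (d := d) (AM_x (v := v) i)
  have aM := fun i j : Fin n => AM_avp (c := c) (d := d) (AM_xx (v := v) i j)
  have ax : ∀ i : Fin n, AM (mu n K v) (fun p => p.1 i) :=
    fun i => (AM_x (v := v) i).fst (J := Ix n K)
  have aC := fun j : Fin n => AM_Cp (v := v) (c := c) (d := d) i j
  have key : ∀ p : (Fin n → ℝ) × (Ix n K → ℝ), (∑ j, Cp v c d i j p *
      (p.1 j - avp v c d (fun x => x j) p)) ^ 2 ≤ n * ∑ j, (1 / 2) *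
      (8 * (avp v c d (fun x => x i * x j) p ^ 4 + (1 / 2) * (avp v c d (fun x => x i) p ^ 8 +
        avp v c d (fun x => x j) p ^ 8)) + 8 * (p.1 j ^ 4 + avp v c d (fun x => x j) p ^ 4)) := by
    intro p
    have h1 := sq_sum_le_card_mul_sum_sq (s := Finset.univ) (f := fun j : Fin n => Cp v c d i j p *
      (p.1 j - avp v c d (fun x => x j) p))
    rw [Finset.card_univ, Fintype.card_fin] at h1
    refine h1.trans ?_
    refine mul_le_mul_of_nonneg_left (Finset.sum_le_sum fun j _ => ?_) (by positivity)
    simp only [Cp]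
    set M := avp v c d (fun x => x i * x j) p
    set a := avp v c d (fun x => x i) p
    set b := avp v c d (fun x => x j) p
    have h2 := bound_four M (a * b)
    have h3 := bound_four (p.1 j) b
    have h4 : (a * b) ^ 4 ≤ 1 / 2 * (a ^ 8 + b ^ 8) := by nlinarith [sq_nonneg (a ^ 4 - b ^ 4)]
    nlinarith [sq_nonneg ((M - a * b) ^ 2 - (p.1 j - b) ^ 2)]
  have aR : ∀ j, AM (mu n K v) (fun p => (1 / 2) *
      (8 * (avp v c d (fun x => x i * x j) p ^ 4 + (1 / 2) * (avp v c d (fun x => x i) p ^ 8 +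
        avp v c d (fun x => x j) p ^ 8)) + 8 * (p.1 j ^ 4 + avp v c d (fun x => x j) p ^ 4))) := by
    intro j
    exact ((((((aM i j).pow 4).add ((((am i).pow 8).add ((am j).pow 8)).const_mul _)).const_mul _).add
      ((((ax j).pow 4).add ((am j).pow 4)).const_mul _))).const_mul _
  refine (integral_mono ((AM.sum _ fun j _ => (aC j).mul ((ax j).sub (am j))).pow 2).integrable
    ((AM.sum _ fun j _ => aR j).const_mul _).integrable key).trans ?_
  rw [integral_const_mul, integral_finsetSum _ fun j _ => (aR j).integrable]
  refine mul_le_mul_of_nonneg_left (Finset.sum_le_sum fun j _ => ?_) (by positivity)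
  rw [integral_const_mul, integral_add, integral_const_mul, integral_const_mul, integral_add,
    integral_add, integral_const_mul, integral_add]
  · have h1 := int_av_pow_le (c := c) (d := d) (AM_xx (v := v) i j) 4 (by decide)
    have h2 := int_av_pow_le (c := c) (d := d) (AM_x (v := v) i) 8 (by decide)
    have h3 := int_av_pow_le (c := c) (d := d) (AM_x (v := v) j) 8 (by decide)
    have h4 := int_av_pow_le (c := c) (d := d) (AM_x (v := v) j) 4 (by decide)
    have h5 : ∫ p, p.1 j ^ 4 ∂(mu n K v) = ∫ x, x j ^ 4 ∂(pr n v) := integral_fst' (fun x => x j ^ 4)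
    rw [h5]
    linarith
  · exact ((am i).pow 8).integrable
  · exact ((am j).pow 8).integrable
  · exact ((ax j).pow 4).integrable
  · exact ((am j).pow 4).integrable
  · exact ((aM i j).pow 4).integrable
  · exact ((((am i).pow 8).add ((am j).pow 8)).const_mul _).integrable
  · exact ((((aM i j).pow 4).add ((((am i).pow 8).add ((am j).pow 8)).const_mul _)).const_mul _).integrable
  · exact (((ax j).pow 4).add ((am j).pow 4)).const_mul _ |>.integrable

lemma RR_step {δ : ℝ} {d' : Fin K → ℝ} (k : Fin K) (h0 : d k = 0) (h1 : d' k = δ)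
    (h2 : ∀ l, l ≠ k → d' l = d l) :
    RR n v c d + δ ^ 2 * CC n v c d - δ ^ 4 * ∑ i, Bd n v i ≤ RR n v c d' := by
  unfold RR CC
  rw [Finset.mul_sum, Finset.mul_sum, ← Finset.sum_add_distrib, ← Finset.sum_sub_distrib]
  refine Finset.sum_le_sum fun i _ => ?_
  have h := thermal_step (π := pr n v) (ψ := ps n K) (a := amp c d) (a' := amp c d')
    (φ := fun i x => x i) (e := fun i => Sum.inr (k, i)) (δ := δ) AM_ps (fun i => AM_x i)
    (fun a b hab => by simpa using hab) (fun _ => rfl) (fun _ => h0) (fun _ => h1) ?_ i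
  · have hb := Bd_bound (v := v) (c := c) (d := d) i
    have hb' : δ ^ 4 * ∫ p, (∑ j, Cp v c d i j p *
      (p.1 j - avp v c d (fun x => x j) p)) ^ 2 ∂(mu n K v) ≤ δ ^ 4 * Bd n v i :=
      mul_le_mul_of_nonneg_left hb (by positivity)
    refine le_trans ?_ h
    exact sub_le_sub_left hb' _
  · rintro (j | j) hj
    · rfl
    · refine h2 _ fun hk => hj ⟨j.2, ?_⟩
      rw [← hk]

/-- Thermal concentration at a suitable small side information. -/
lemma thermal (hv : v ≠ 0) (hn : 1 ≤ n) (c : ℝ) {ε : ℝ} (hε : 0 < ε) :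
    ∃ (K : ℕ) (d : Fin K → ℝ), ∑ k, d k ^ 2 ≤ ε ∧ CC n v c d ≤ n * (v / ε + 1) := by
  have hn' : (0 : ℝ) < n := by exact_mod_cast hn
  set B := ∑ i, Bd n v i with hB
  obtain ⟨K, hK⟩ := exists_nat_gt (max (ε * B / n) 0)
  have hK0 : (0 : ℝ) < K := (le_max_right _ _).trans_lt hK
  have hKB : ε * B / n < K := (le_max_left _ _).trans_lt hK
  set δ := √(ε / K) with hδ
  have hδ2 : δ ^ 2 = ε / K := Real.sq_sqrt (by positivity)
  let D : ℕ → Fin K → ℝ := fun k l => if (l : ℕ) < k then δ else 0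
  by_contra hcon
  push Not at hcon
  have hsum : ∀ k, ∑ l, D k l ^ 2 ≤ ε := by
    intro k
    have : ∑ l, D k l ^ 2 ≤ ∑ _l : Fin K, ε / K := Finset.sum_le_sum fun l _ => by
      simp only [D]
      split_ifs
      · exact hδ2.le
      · rw [zero_pow two_ne_zero]; positivity
    refine this.trans (le_of_eq ?_)
    simp
    field_simp
  have hind : ∀ k : ℕ, k ≤ K → k * (δ ^ 2 * (n * (v / ε + 1)) - δ ^ 4 * B) ≤ RR n v c (D k) := by
    intro k
    induction k with
    | zero => intro _; simpa using RR_nonneg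
    | succ k ih =>
      intro hk
      have h1 := ih (by omega)
      have h2 := RR_step (n := n) (v := v) (c := c) (d := D k) (d' := D (k + 1)) (δ := δ) ⟨k, hk⟩
        (by simp [D]) (by simp [D]) (by
          intro l hl
          have : (l : ℕ) ≠ k := fun h => hl (Fin.ext h)
          simp only [D]
          congr 1
          simp; omega)
      have h3 := (hcon K (D k) (hsum k)).le
      have h4 := mul_le_mul_of_nonneg_left h3 (sq_nonneg δ)
      push_cast
      linarith
  have h1 := (hind K le_rfl).trans (RR_le hv)
  have hδ4 : δ ^ 4 = (ε / K) ^ 2 := by rw [← hδ2]; ring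
  rw [hδ2, hδ4] at h1
  have e : (K : ℝ) * (ε / K * (n * (v / ε + 1)) - (ε / K) ^ 2 * B) = n * v + ε * n - ε * (ε * B) / K := by
    field_simp
  rw [e] at h1
  have : ε * B < K * n := by rwa [div_lt_iff₀ hn'] at hKB
  have : ε * (ε * B) / K < ε * n := by
    rw [div_lt_iff₀ hK0]
    nlinarith
  linarith

/-- Free energy of the model. -/
def FE (n : ℕ) {K : ℕ} (v : NNReal) (c : ℝ) (d : Fin K → ℝ) : ℝ := Fe (pr n v) (ps n K) (amp c d)

lemma FE_zero : FE n v 0 (fun _ : Fin K => 0) = 0 := by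
  have : (amp 0 (fun _ : Fin K => 0) : Ix n K → ℝ) = fun _ => 0 := by
    ext j; rcases j with j | j <;> simp [amp]
  unfold FE
  rw [this]
  exact Fe_zero

lemma FE_inc (hv : v ≠ 0) (c' : ℝ) (d' : Fin K → ℝ) :
    FE n v c d + ((c' ^ 2 - c ^ 2) / 4 * QQ n v c d - (c' - c) ^ 2 / 4 * (v ^ 2 * (n * (n + 2)))
      + ((∑ k, d' k ^ 2 - ∑ k, d k ^ 2) / 2 * RR n v c d
      - (∑ k, (d' k - d k) ^ 2) / 2 * (n * v))) ≤ FE n v c' d' := by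
  have h := Fe_inc (π := pr n v) (ψ := ps n K) AM_ps (amp c d) (amp c' d')
  refine le_trans (le_of_eq ?_) h
  unfold FE
  congr 1
  rw [Fintype.sum_sum_type, Fintype.sum_prod_type, Fintype.sum_prod_type]
  have ha1 : ∀ c d k l, (amp c d : Ix n K → ℝ) (Sum.inl (k, l)) = c * wt k l := fun _ _ _ _ => rfl
  have ha2 : ∀ c d k l, (amp c d : Ix n K → ℝ) (Sum.inr (k, l)) = d k := fun _ _ _ _ => rfl
  have hq : ∀ k l : Fin n, ∫ p, av (pr n v) (ps n K) (amp c d) (ps n K (Sum.inl (k, l)))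
      (Yo (ps n K) (amp c d) p) ^ 2 ∂((pr n v).prod (gam (Ix n K))) =
      ∫ p, avp v c d (fun x => x k * x l) p ^ 2 ∂(mu n K v) := fun _ _ => rfl
  have hr : ∀ (k : Fin K) (l : Fin n), ∫ p, av (pr n v) (ps n K) (amp c d) (ps n K (Sum.inr (k, l)))
      (Yo (ps n K) (amp c d) p) ^ 2 ∂((pr n v).prod (gam (Ix n K))) =
      ∫ p, avp v c d (fun x => x l) p ^ 2 ∂(mu n K v) := fun _ _ => rfl
  have hm : ∀ (k l : Fin n), ∫ x, ps n K (Sum.inl (k, l)) x ^ 2 ∂(pr n v) =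
      ∫ x, (x k * x l) ^ 2 ∂(pr n v) := fun _ _ => rfl
  have hm' : ∀ (k : Fin K) (l : Fin n), ∫ x, ps n K (Sum.inr (k, l)) x ^ 2 ∂(pr n v) = v := by
    intro k l
    rw [← mom2 hv l]
    congr 1; ext x; exact sq _
  simp only [hq, hr, hm, hm', ha1, ha2]
  congr 1
  · have e : ∀ k l : Fin n, ((c' * wt k l) ^ 2 - (c * wt k l) ^ 2) / 2 *
        ∫ p, avp v c d (fun x => x k * x l) p ^ 2 ∂(mu n K v) -
        (c' * wt k l - c * wt k l) ^ 2 / 2 * ∫ x, (x k * x l) ^ 2 ∂(pr n v) =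
        wt k l ^ 2 * ((c' ^ 2 - c ^ 2) / 2 * ∫ p, avp v c d (fun x => x k * x l) p ^ 2 ∂(mu n K v) -
        (c' - c) ^ 2 / 2 * ∫ x, (x k * x l) ^ 2 ∂(pr n v)) := by intro k l; ring
    simp only [e]
    rw [sum_wt (fun k l => ((c' ^ 2 - c ^ 2) / 2 * ∫ p, avp v c d (fun x => x k * x l) p ^ 2 ∂(mu n K v) -
        (c' - c) ^ 2 / 2 * ∫ x, (x k * x l) ^ 2 ∂(pr n v)))]
    · simp only [Finset.sum_sub_distrib, ← Finset.mul_sum, mom4_sum hv]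
      unfold QQ
      ring
    · intro i j
      have : ∀ x : Fin n → ℝ, x i * x j = x j * x i := fun x => mul_comm _ _
      simp only [this]
  · simp only [Finset.sum_sub_distrib, ← Finset.mul_sum, ← Finset.sum_mul, ← Finset.sum_div]
    unfold RR
    simp [Finset.sum_sub_distrib]

end Aux

namespace Aux
set_option linter.unusedSectionVars false
set_option linter.unusedSimpArgs false

variable {n K : ℕ} {v : NNReal} {c : ℝ}

lemma gam_precomp {J J' : Type*} [Fintype J] [Fintype J'] {e : J' → J} (he : Function.Injective e) :
    MeasurePreserving (fun (y : J → ℝ) (j : J') => y (e j)) (gam J) (gam J') := by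
  refine ⟨by fun_prop, ?_⟩
  have h1 : iIndepFun (fun (j : J) (y : J → ℝ) => y j) (gam J) :=
    iIndepFun_pi (X := fun _ => id) (fun _ => aemeasurable_id)
  have h2 := h1.precomp he
  have : IsProbabilityMeasure (gam J) := by unfold gam; infer_instance
  rw [iIndepFun_iff_map_fun_eq_pi_map (fun i => (measurable_pi_apply _).aemeasurable)] at h2
  rw [h2, gam]
  congr 1
  ext1 j
  exact (measurePreserving_eval (fun _ : J => gaussianReal 0 1) (e j)).map_eq

/-- symmetric noise from standard Gaussians -/
def Zof {n : ℕ} (g : Fin n × Fin n → ℝ) : Matrix (Fin n) (Fin n) ℝ :=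
  Matrix.of fun i j => wt i j * g (i, j) + wt j i * g (j, i)

lemma ms_entry (i j : Fin n) : Measurable (fun Y : Matrix (Fin n) (Fin n) ℝ => Y i j) := by
  have : Measurable (fun Y : Fin n → Fin n → ℝ => Y i j) := by fun_prop
  exact this

lemma ms_matrix {X : Type*} [MeasurableSpace X] {f : X → Matrix (Fin n) (Fin n) ℝ}
    (h : ∀ i j, Measurable (fun x => f x i j)) : Measurable f := by
  have : Measurable (fun x => (f x : Fin n → Fin n → ℝ)) :=
    measurable_pi_lambda _ fun i => measurable_pi_lambda _ fun j => h i j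
  exact this

lemma ms_Zof : Measurable (Zof (n := n)) := by
  refine ms_matrix fun i j => ?_
  simp only [Zof, Matrix.of_apply]
  fun_prop

lemma noise_eq : noiseMeasure n = (gam (Fin n × Fin n)).map Zof := by
  have h1 : (Measure.pi fun p : Fin n × Fin n => gaussianReal 0 (if p.1 = p.2 then 2 else 1)) =
      (gam (Fin n × Fin n)).map (fun g p => (if p.1 = p.2 then √2 else 1) * g p) := by
    unfold gam
    rw [Measure.pi_map_pi (f := fun (p : Fin n × Fin n) (t : ℝ) => (if p.1 = p.2 then √2 else 1) * t)
      (fun p => (measurable_const_mul _).aemeasurable)]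
    congr 1
    ext1 p
    rw [gaussianReal_map_const_mul]
    congr 1
    · simp
    · split_ifs
      · ext; simp
      · ext; simp
  unfold noiseMeasure
  rw [h1, Measure.map_map]
  · congr 1
    ext g i j
    simp only [Function.comp, Zof, Matrix.of_apply, wt]
    rcases lt_trichotomy i j with h | h | h
    · simp [h.le, h, h.ne, h.ne', h.not_gt]
    · subst h
      simp
      have : √(2 : ℝ) * √2 = 2 := Real.mul_self_sqrt (by norm_num)
      have h2 : √(2 : ℝ) ≠ 0 := by positivity
      field_simp
      linear_combination this * g (i, i)
    · simp [h.not_ge, h, h.ne, h.ne', h.not_gt]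
  · refine ms_matrix fun i j => ?_
    simp only [Matrix.of_apply]
    split_ifs <;> fun_prop
  · fun_prop

lemma law_push : ((pr n v).prod (noiseMeasure n)) =
    (mu n K v).map (fun p => (p.1, Zof (fun q => p.2 (Sum.inl q)))) := by
  have hg := gam_precomp (e := (Sum.inl : Fin n × Fin n → Ix n K)) Sum.inl_injective
  have h2 : MeasurePreserving (Zof (n := n)) (gam (Fin n × Fin n)) (noiseMeasure n) :=
    ⟨ms_Zof, noise_eq.symm⟩
  have h3 := h2.comp hg
  have : IsProbabilityMeasure (gam (Ix n K)) := by unfold gam; infer_instance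
  have : IsProbabilityMeasure (gam (Fin n × Fin n)) := by unfold gam; infer_instance
  have : IsProbabilityMeasure (noiseMeasure n) := by
    rw [noise_eq]; exact Measure.isProbabilityMeasure_map ms_Zof.aemeasurable
  exact ((MeasurePreserving.id (pr n v)).prod h3).map_eq.symm

lemma sum_w (g : Fin n × Fin n → ℝ) (x : Fin n → ℝ) :
    ∑ i, ∑ j, Zof g i j * (x i * x j) = 2 * ∑ i, ∑ j, wt i j * g (i, j) * (x i * x j) := by
  simp only [Zof, Matrix.of_apply, add_mul, Finset.sum_add_distrib]
  rw [two_mul]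
  congr 1
  rw [Finset.sum_comm]
  refine Finset.sum_congr rfl fun i _ => Finset.sum_congr rfl fun j _ => ?_
  ring

lemma weight_eq (lam : ℝ) (p : (Fin n → ℝ) × (Ix n K → ℝ)) (x : Fin n → ℝ) :
    weight n lam (obs n lam p.1 (Zof fun q => p.2 (Sum.inl q))) x =
    Real.exp (-(1 / 4) * frobSq (obs n lam p.1 (Zof fun q => p.2 (Sum.inl q)))) *
      Real.exp (Ham (ps n K) (amp √(lam / n) (fun _ => 0))
        (Yo (ps n K) (amp √(lam / n) (fun _ => 0)) p) x) := by
  rw [← Real.exp_add, weight]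
  congr 1
  set c := √(lam / n)
  set g : Fin n × Fin n → ℝ := fun q => p.2 (Sum.inl q) with hg
  have h1 := sum_w g x
  have h2 := sum_wt (fun i j => c * (p.1 i * p.1 j) * (x i * x j)) (fun i j => by ring)
  have h3 := sum_wt (fun i j => (x i * x j) ^ 2) (fun i j => by ring)
  have eH : Ham (ps n K) (amp c (fun _ => 0)) (Yo (ps n K) (amp c (fun _ => 0)) p) x =
      c * ∑ i, ∑ j, wt i j ^ 2 * (c * (p.1 i * p.1 j) * (x i * x j)) +
      c * ∑ i, ∑ j, wt i j * g (i, j) * (x i * x j) -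
      c ^ 2 / 2 * ∑ i, ∑ j, wt i j ^ 2 * (x i * x j) ^ 2 := by
    simp only [Ham, Fintype.sum_sum_type, Fintype.sum_prod_type, Finset.mul_sum,
      ← Finset.sum_add_distrib, ← Finset.sum_sub_distrib, Yo, amp, ps, Sum.elim_inl, Sum.elim_inr, hg]
    simp only [zero_mul, sub_zero, ne_eq, OfNat.ofNat_ne_zero, not_false_eq_true, zero_pow, zero_div,
      Finset.sum_const_zero, add_zero]
    refine Finset.sum_congr rfl fun i _ => Finset.sum_congr rfl fun j _ => ?_
    ring
  have eF : frobSq (obs n lam p.1 (Zof g) - c • vecMulVec x x) = frobSq (obs n lam p.1 (Zof g)) -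
      2 * c * (∑ i, ∑ j, c * (p.1 i * p.1 j) * (x i * x j)) - 2 * c * (∑ i, ∑ j, Zof g i j * (x i * x j))
      + c ^ 2 * ∑ i, ∑ j, (x i * x j) ^ 2 := by
    simp only [frobSq, Finset.mul_sum, ← Finset.sum_add_distrib, ← Finset.sum_sub_distrib, obs,
      Matrix.sub_apply, Matrix.add_apply, Matrix.smul_apply, vecMulVec_apply, smul_eq_mul]
    refine Finset.sum_congr rfl fun i _ => Finset.sum_congr rfl fun j _ => ?_
    ring
  rw [eF, eH, h1, h2, h3]
  ring

lemma gibbs_eq (sig lam : ℝ) (p : (Fin n → ℝ) × (Ix n K → ℝ)) (f : (Fin n → ℝ) → ℝ) :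
    gibbs n sig lam (obs n lam p.1 (Zof fun q => p.2 (Sum.inl q))) f =
      avp (Real.toNNReal (sig ^ 2)) √(lam / n) (fun _ => 0) f p := by
  unfold gibbs avp
  rw [av_eq]
  simp only [weight_eq]
  have e : ∀ x, f x * (Real.exp (-(1 / 4) * frobSq (obs n lam p.1 (Zof fun q => p.2 (Sum.inl q)))) *
      Real.exp (Ham (ps n K) (amp √(lam / n) (fun _ => 0))
        (Yo (ps n K) (amp √(lam / n) (fun _ => 0)) p) x)) =
      Real.exp (-(1 / 4) * frobSq (obs n lam p.1 (Zof fun q => p.2 (Sum.inl q)))) *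
      (Real.exp (Ham (ps n K) (amp √(lam / n) (fun _ => 0))
        (Yo (ps n K) (amp √(lam / n) (fun _ => 0)) p) x) * f x) := fun x => by ring
  simp only [e]
  rw [integral_const_mul, integral_const_mul, mul_div_mul_left _ _ (Real.exp_ne_zero _)]
  rfl

lemma ms_frob {X : Type*} [MeasurableSpace X] {f : X → Matrix (Fin n) (Fin n) ℝ}
    (h : Measurable f) : Measurable (fun x => frobSq (f x)) := by
  unfold frobSq
  refine Finset.measurable_sum _ fun i _ => Finset.measurable_sum _ fun j _ => ?_
  exact ((ms_entry i j).comp h).pow_const 2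

lemma ms_gibbs (sig lam : ℝ) (f : (Fin n → ℝ) → ℝ) (hf : Measurable f) :
    Measurable (fun Y => gibbs n sig lam Y f) := by
  have hw : Measurable (fun q : Matrix (Fin n) (Fin n) ℝ × (Fin n → ℝ) => weight n lam q.1 q.2) := by
    unfold weight
    refine ((ms_frob (ms_matrix fun i j => ?_)).const_mul _).exp
    simp only [Matrix.sub_apply, Matrix.smul_apply, vecMulVec_apply, smul_eq_mul]
    refine ((ms_entry i j).comp measurable_fst).sub ?_
    fun_prop
  have : SFinite (gaussPrior n (sig ^ 2)) := by unfold gaussPrior; infer_instance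
  unfold gibbs
  refine Measurable.div ?_ ?_
  · exact ((((hf.comp measurable_snd).mul hw).stronglyMeasurable).integral_prod_right').measurable
  · exact ((hw.stronglyMeasurable).integral_prod_right').measurable

lemma link (K : ℕ) (sig lam : ℝ) (hs : 0 < sig) :
    MMSE n sig lam = (1 / (n : ℝ) ^ 2) * (sig ^ 4 * (n * (n + 2)) -
      QQ n (Real.toNNReal (sig ^ 2)) √(lam / n) (fun _ : Fin K => 0)) := by
  set v := Real.toNNReal (sig ^ 2) with hvdef
  have hv : v ≠ 0 := by
    rw [hvdef, ne_eq, Real.toNNReal_eq_zero]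
    push Not; positivity
  have hvv : (v : ℝ) = sig ^ 2 := Real.coe_toNNReal _ (by positivity)
  unfold MMSE MSE
  congr 1
  change ∫ p, _ ∂((pr n v).prod (noiseMeasure n)) = _
  rw [law_push (K := K), integral_map]
  · have e : ∀ p : (Fin n → ℝ) × (Ix n K → ℝ),
        frobSq (vecMulVec p.1 p.1 - gibbsMatrix n sig lam (obs n lam p.1 (Zof fun q => p.2 (Sum.inl q))))
        = ∑ i, ∑ j, (p.1 i * p.1 j - avp v √(lam / n) (fun _ => 0) (fun x => x i * x j) p) ^ 2 := by
      intro p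
      simp only [frobSq, Matrix.sub_apply, vecMulVec_apply, gibbsMatrix, Matrix.of_apply, gibbs_eq sig lam]
      rfl
    simp only [e]
    have axx : ∀ i j : Fin n, AM (mu n K v) (fun p => p.1 i * p.1 j) :=
      fun i j => (AM_xx (v := v) i j).fst (J := Ix n K)
    have aM := fun i j : Fin n => AM_avp (K := K) (c := √(lam / n)) (d := fun _ => 0) (AM_xx (v := v) i j)
    rw [int_sum2 fun i j => ((axx i j).sub (aM i j)).pow 2]
    have e4 : sig ^ 4 * (n * (n + 2)) = ∑ i, ∑ j, ∫ p, (p.1 i * p.1 j) ^ 2 ∂(mu n K v) := by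
      have e2 : ∀ i j : Fin n, ∫ p, (p.1 i * p.1 j) ^ 2 ∂(mu n K v) = ∫ x, (x i * x j) ^ 2 ∂(pr n v) :=
        fun i j => integral_fst' (fun x => (x i * x j) ^ 2)
      simp only [e2, mom4_sum hv, hvv]
      ring
    rw [e4, QQ]
    simp only [← Finset.sum_sub_distrib]
    refine Finset.sum_congr rfl fun i _ => Finset.sum_congr rfl fun j _ => ?_
    have e1 : ∀ p : (Fin n → ℝ) × (Ix n K → ℝ),
      (p.1 i * p.1 j - avp v √(lam / n) (fun _ => 0) (fun x => x i * x j) p) ^ 2 =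
      ((p.1 i * p.1 j) ^ 2 - 2 * ((p.1 i * p.1 j) * avp v √(lam / n) (fun _ => 0) (fun x => x i * x j) p))
      + avp v √(lam / n) (fun _ => 0) (fun x => x i * x j) p ^ 2 := fun p => by ring
    simp only [e1]
    have hma : Measurable (av (pr n v) (ps n K) (amp √(lam / n) (fun _ => 0)) (fun x => x i * x j)) :=
      measurable_av ms_ps (AM_xx (v := v) i j).1
    have hn := nishi' (a := amp √(lam / n) (fun _ => 0)) (ms_ps (n := n) (K := K)) (AM_xx (v := v) i j)
      hma (aM i j)
    have hn' : ∫ p, (p.1 i * p.1 j) * avp v √(lam / n) (fun _ => 0) (fun x => x i * x j) p ∂(mu n K v) =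
      ∫ p, avp v √(lam / n) (fun _ => 0) (fun x => x i * x j) p ^ 2 ∂(mu n K v) := by
      refine Eq.trans hn ?_
      congr 1; ext p; exact (sq _).symm
    rw [integral_add (((axx i j).pow 2).sub (((axx i j).mul (aM i j)).const_mul _)).integrable
      ((aM i j).pow 2).integrable, integral_sub ((axx i j).pow 2).integrable
      (((axx i j).mul (aM i j)).const_mul _).integrable, integral_const_mul, hn']
    ring
  · have : Measurable (fun p : (Fin n → ℝ) × (Ix n K → ℝ) => (p.1, Zof (fun q => p.2 (Sum.inl q)))) :=
      measurable_fst.prodMk (ms_Zof.comp (by fun_prop))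
    exact this.aemeasurable
  · refine Measurable.aestronglyMeasurable (ms_frob (ms_matrix fun i j => ?_))
    simp only [Matrix.sub_apply, vecMulVec_apply, gibbsMatrix, Matrix.of_apply]
    refine Measurable.sub (by fun_prop) ?_
    refine (ms_gibbs sig lam (fun x => x i * x j) (by fun_prop)).comp (ms_matrix fun k l => ?_)
    simp only [obs, Matrix.add_apply, Matrix.smul_apply, vecMulVec_apply, smul_eq_mul]
    refine Measurable.add (by fun_prop) ((ms_entry k l).comp measurable_snd)

lemma QQ_indep (hn : 1 ≤ n) (hv : v ≠ 0) (K K' : ℕ) (lam : ℝ) :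
    QQ n v √(lam / n) (fun _ : Fin K => 0) = QQ n v √(lam / n) (fun _ : Fin K' => 0) := by
  have hs : 0 < √(v : ℝ) := Real.sqrt_pos.2 (by exact_mod_cast pos_iff_ne_zero.2 hv)
  have h1 := link (n := n) K √(v : ℝ) lam hs
  have h2 := link (n := n) K' √(v : ℝ) lam hs
  have hn' : (0 : ℝ) < n := by exact_mod_cast hn
  rw [Real.sq_sqrt (NNReal.coe_nonneg v), Real.toNNReal_coe] at h1 h2
  have h3 := h1.symm.trans h2
  have := mul_left_cancel₀ (by positivity) h3
  linarith

end Aux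

namespace Aux
set_option linter.unusedSectionVars false
set_option linter.unusedSimpArgs false

variable {n : ℕ} {v : NNReal}

/-- normalized overlap -/
def qn (v : NNReal) (n : ℕ) (lam : ℝ) : ℝ := QQ n v √(lam / n) (fun _ : Fin 1 => 0) / (n : ℝ) ^ 2

/-- normalized free energy -/
def fn (v : NNReal) (n : ℕ) (lam : ℝ) : ℝ := FE n v √(lam / n) (fun _ : Fin 1 => 0) / n

lemma quad_bound {t a b : ℝ} (ha : 0 ≤ a) (hb : 0 ≤ b) (h : t ^ 2 ≤ a * t + b ^ 2) : t ≤ a + b := by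
  by_contra hc
  push Not at hc
  nlinarith [mul_nonneg ha hb]

lemma qn_le_aux (hv : v ≠ 0) (hn : 1 ≤ n) {lam ε : ℝ} (hl : 0 < lam) (hε : 0 < ε) :
    qn v n lam ≤ (max (v - 1 / (lam * v)) 0 + √(ε * v / lam + 5 / 2 * v ^ 2 / √n)) ^ 2
      + (3 * v ^ 2 + v / ε + 1) / (2 * √n) := by
  have hn' : (1 : ℝ) ≤ n := by exact_mod_cast hn
  have hn0 : (0 : ℝ) < n := by linarith
  have hV : (0 : ℝ) < v := by exact_mod_cast pos_iff_ne_zero.2 hv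
  have hsn : 0 < √(n : ℝ) := Real.sqrt_pos.2 hn0
  set s := √(n : ℝ) with hs
  have hss : s * s = n := Real.mul_self_sqrt hn0.le
  set V : ℝ := (v : ℝ) with hVdef
  obtain ⟨K, d, hd, hCC⟩ := thermal hv hn √(lam / n) hε
  set c := √(lam / n) with hc
  have hc2 : c ^ 2 = lam / n := Real.sq_sqrt (by positivity)
  have h1 : qn v n lam ≤ QQ n v c d / (n : ℝ) ^ 2 := by
    unfold qn
    rw [QQ_indep hn hv 1 K]
    gcongr
    exact QQ_mono
  have h2 := QQ_sub_TT_le (n := n) (v := v) (c := c) (d := d) (s := s⁻¹) (by positivity)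
  have h3 := QQ_le (n := n) (c := c) (d := d) hv
  have h4 := sd_model (n := n) (c := c) (d := d) hv
  have h5 := UU_le (c := c) (d := d) hv hn
  have h6 := RR_sq_le (n := n) (v := v) (c := c) (d := d)
  have h7 := RR_nonneg (n := n) (v := v) (c := c) (d := d)
  have h8 := RR_le (n := n) (c := c) (d := d) hv
  set e := ∑ k, d k ^ 2
  have he : 0 ≤ e := Finset.sum_nonneg fun _ _ => sq_nonneg _
  set Q := QQ n v c d
  set T := TT n v c d
  set U := UU n v c d
  set R := RR n v c d
  rw [inv_inv] at h2
  rw [hc2] at h4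
  simp only [← hVdef, ← hs] at *
  have hT0 : 0 ≤ T := (sq_nonneg _).trans h6
  have h3' : Q ≤ 3 * (n : ℝ) ^ 2 * V ^ 2 := by
    nlinarith [mul_nonneg (sq_nonneg V) (mul_nonneg hn0.le (by linarith : (0 : ℝ) ≤ n - 1))]
  -- bound on T
  set t := √T / n with ht
  have ht0 : 0 ≤ t := by positivity
  have hT : T = (t * n) ^ 2 := by
    rw [ht, div_mul_cancel₀ _ hn0.ne', Real.sq_sqrt hT0]
  have hR : R ≤ t * n := by
    rw [hT] at h6
    exact (le_abs_self _).trans (abs_le_of_sq_le_sq h6 (by positivity))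
  have ha0 : 0 ≤ max (V - 1 / (lam * V)) 0 := le_max_right _ _
  set β := ε * V / lam + 5 / 2 * V ^ 2 / s with hβ
  have hβ0 : 0 ≤ β := by positivity
  have key : t ^ 2 ≤ max (V - 1 / (lam * V)) 0 * t + (√β) ^ 2 := by
    rw [Real.sq_sqrt hβ0]
    have k1 : lam / n * T = lam / n * U - R / V + e * (n * V - R) := by
      have : R / V = lam / n * (U - T) + e * (n * V - R) := by
        rw [div_eq_iff hV.ne']; linarith
      linarith
    have k2 : e * (n * V - R) ≤ ε * (n * V) := by
      have : e * (n * V - R) ≤ ε * (n * V - R) :=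
        mul_le_mul_of_nonneg_right hd (by linarith)
      nlinarith [mul_nonneg hε.le h7]
    have k3 : lam / n * U ≤ lam / n * (n * V * R + 5 / 2 * V ^ 2 * (n * s)) :=
      mul_le_mul_of_nonneg_left h5 (by positivity)
    have k4 : t ^ 2 = (lam / n * T) / (lam * n) := by
      rw [hT]; field_simp
    have k5 : (lam / n * T) / (lam * n) ≤
        (lam / n * (n * V * R + 5 / 2 * V ^ 2 * (n * s)) - R / V + ε * (n * V)) / (lam * n) := by
      gcongr; linarith
    have k6 : (lam / n * (n * V * R + 5 / 2 * V ^ 2 * (n * s)) - R / V + ε * (n * V)) / (lam * n)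
        = (V - 1 / (lam * V)) * (R / n) + β := by
      rw [hβ, ← hss]; field_simp; ring
    have k7 : (V - 1 / (lam * V)) * (R / n) ≤ max (V - 1 / (lam * V)) 0 * (R / n) :=
      mul_le_mul_of_nonneg_right (le_max_left _ _) (by positivity)
    have k8 : max (V - 1 / (lam * V)) 0 * (R / n) ≤ max (V - 1 / (lam * V)) 0 * t :=
      mul_le_mul_of_nonneg_left (by rw [div_le_iff₀ hn0]; exact hR) ha0
    linarith
  have hfin := quad_bound ha0 (Real.sqrt_nonneg _) key
  have hT2 : T / (n : ℝ) ^ 2 = t ^ 2 := by rw [hT]; field_simp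
  have hQ : Q / (n : ℝ) ^ 2 ≤ T / (n : ℝ) ^ 2 + (3 * V ^ 2 + V / ε + 1) / (2 * s) := by
    have m1 : s⁻¹ * Q ≤ s⁻¹ * (3 * (n : ℝ) ^ 2 * V ^ 2) := mul_le_mul_of_nonneg_left h3' (by positivity)
    have m2 : s * CC n v c d ≤ s * (n * (V / ε + 1)) := mul_le_mul_of_nonneg_left hCC hsn.le
    have m3 : Q ≤ T + 1 / 2 * (s⁻¹ * (3 * (n : ℝ) ^ 2 * V ^ 2) + s * (n * (V / ε + 1))) := by linarith
    have m4 : (T + 1 / 2 * (s⁻¹ * (3 * (n : ℝ) ^ 2 * V ^ 2) + s * (n * (V / ε + 1)))) / (n : ℝ) ^ 2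
        = T / (n : ℝ) ^ 2 + (3 * V ^ 2 + V / ε + 1) / (2 * s) := by
      rw [← hss]; field_simp; ring
    rw [← m4]; gcongr
  have := pow_le_pow_left₀ ht0 hfin 2
  linarith

/-- Uniform asymptotic upper bound on the overlap. -/
lemma qn_le (hv : v ≠ 0) {a0 τ : ℝ} (ha : 0 < a0) (hτ : 0 < τ) :
    ∀ᶠ n : ℕ in atTop, ∀ lam, a0 ≤ lam → qn v n lam ≤ (max (v - 1 / (lam * v)) 0) ^ 2 + τ := by
  have hV : (0 : ℝ) < v := by exact_mod_cast pos_iff_ne_zero.2 hv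
  set V : ℝ := (v : ℝ) with hVdef
  let E : ℝ → ℝ := fun w => 2 * V * √(w * V / a0 + 5 / 2 * V ^ 2 * w ^ 2) +
    (w * V / a0 + 5 / 2 * V ^ 2 * w ^ 2) + ((3 * V ^ 2 + 1) * w ^ 2 + V * w) / 2
  have hE : Continuous E := by fun_prop
  have hw : Tendsto (fun n : ℕ => (√√(n : ℝ))⁻¹) atTop (nhds 0) :=
    tendsto_inv_atTop_zero.comp (Real.tendsto_sqrt_atTop.comp
      (Real.tendsto_sqrt_atTop.comp tendsto_natCast_atTop_atTop))
  have hE0 : E 0 = 0 := by simp [E]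
  have hlim : Tendsto (fun n : ℕ => E (√√(n : ℝ))⁻¹) atTop (nhds 0) := by
    have := (hE.tendsto 0).comp hw
    rwa [hE0] at this
  filter_upwards [hlim.eventually (gt_mem_nhds hτ), eventually_ge_atTop 1] with n hn1 hn lam hlam
  have hl : 0 < lam := ha.trans_le hlam
  have hn0 : (0 : ℝ) < n := by exact_mod_cast hn
  have hsn : 0 < √(n : ℝ) := Real.sqrt_pos.2 hn0
  have hssn : 0 < √√(n : ℝ) := Real.sqrt_pos.2 hsn
  set w := (√√(n : ℝ))⁻¹ with hwdef
  have hw0 : 0 < w := by positivity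
  have hw2 : (√(n : ℝ))⁻¹ = w ^ 2 := by
    rw [hwdef, inv_pow, Real.sq_sqrt hsn.le]
  have h := qn_le_aux hv hn hl hw0
  simp only [← hVdef] at h
  set a := max (V - 1 / (lam * V)) 0
  have ha0 : 0 ≤ a := le_max_right _ _
  have haV : a ≤ V := max_le (by have : 0 < 1 / (lam * V) := by positivity
                                 linarith) hV.le
  have e1 : (3 * V ^ 2 + V / w + 1) / (2 * √n) = ((3 * V ^ 2 + 1) * w ^ 2 + V * w) / 2 := by
    rw [div_mul_eq_div_div_swap, div_eq_mul_inv _ (√(n : ℝ)), hw2]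
    field_simp
    ring
  have e2 : w * V / lam + 5 / 2 * V ^ 2 / √n ≤ w * V / a0 + 5 / 2 * V ^ 2 * w ^ 2 := by
    rw [div_eq_mul_inv _ (√(n : ℝ)), hw2]
    gcongr
  set β := w * V / a0 + 5 / 2 * V ^ 2 * w ^ 2 with hβ
  have hβ0 : 0 ≤ β := by positivity
  have e3 : (a + √(w * V / lam + 5 / 2 * V ^ 2 / √n)) ^ 2 ≤ (a + √β) ^ 2 := by
    gcongr
  have e4 : (a + √β) ^ 2 ≤ a ^ 2 + 2 * V * √β + β := by
    have := Real.sq_sqrt hβ0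
    nlinarith [mul_le_mul_of_nonneg_right haV (Real.sqrt_nonneg β)]
  have e5 : E w = 2 * V * √β + β + ((3 * V ^ 2 + 1) * w ^ 2 + V * w) / 2 := rfl
  rw [e1] at h
  linarith

/-- Telescoping. -/
lemma telescope {G : ℝ → ℝ} {B a b : ℝ} (hab : a ≤ b)
    (h : ∀ x y, a ≤ x → x ≤ y → y ≤ b → G y ≤ G x + B * (y - x) ^ 2) : G b ≤ G a := by
  have key : ∀ N : ℕ, 1 ≤ N → G b ≤ G a + (B * (b - a) ^ 2) / N := by
    intro N hN
    have hN0 : (0 : ℝ) < N := by exact_mod_cast hN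
    have hind : ∀ k : ℕ, k ≤ N → G (a + k * ((b - a) / N)) ≤ G a + k * (B * ((b - a) / N) ^ 2) := by
      intro k
      induction k with
      | zero => intro _; simp
      | succ k ih =>
        intro hk
        have h1 := ih (by omega)
        have hh : 0 ≤ (b - a) / N := div_nonneg (by linarith) hN0.le
        have hkN : ((k + 1 : ℕ) : ℝ) ≤ N := by exact_mod_cast hk
        have h2 := h (a + k * ((b - a) / N)) (a + (k + 1 : ℕ) * ((b - a) / N))
          (by nlinarith [mul_nonneg (Nat.cast_nonneg (α := ℝ) k) hh])
          (by push_cast; nlinarith) (by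
            have : ((k + 1 : ℕ) : ℝ) * ((b - a) / N) ≤ N * ((b - a) / N) :=
              mul_le_mul_of_nonneg_right hkN hh
            rw [mul_div_cancel₀ _ hN0.ne'] at this
            linarith)
        have e : (a + (k + 1 : ℕ) * ((b - a) / N)) - (a + k * ((b - a) / N)) = (b - a) / N := by
          push_cast; ring
        rw [e] at h2
        push_cast at h2 ⊢
        linarith
    have := hind N le_rfl
    rw [mul_div_cancel₀ _ hN0.ne'] at this
    have e : (N : ℝ) * (B * ((b - a) / N) ^ 2) = (B * (b - a) ^ 2) / N := by field_simp
    rw [e] at this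
    simpa using this
  have hlim : Tendsto (fun N : ℕ => G a + (B * (b - a) ^ 2) / N) atTop (nhds (G a + 0)) :=
    tendsto_const_nhds.add (tendsto_const_div_atTop_nhds_zero_nat _)
  rw [add_zero] at hlim
  refine ge_of_tendsto hlim ?_
  filter_upwards [eventually_ge_atTop 1] with N hN using key N hN

end Aux

namespace Aux
set_option linter.unusedSectionVars false
set_option linter.unusedSimpArgs false

variable {n : ℕ} {v : NNReal}

lemma qn_nonneg (lam : ℝ) : 0 ≤ qn v n lam := by
  unfold qn
  have := QQ_nonneg (n := n) (v := v) (c := √(lam / n)) (d := fun _ : Fin 1 => (0 : ℝ))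
  positivity

lemma nn2_le (hn : 1 ≤ n) : (v : ℝ) ^ 2 * (n * (n + 2)) ≤ 3 * (v : ℝ) ^ 2 * (n : ℝ) ^ 2 := by
  have h1 : (1 : ℝ) ≤ n := by exact_mod_cast hn
  nlinarith [mul_nonneg (sq_nonneg (v : ℝ)) (mul_nonneg (by linarith : (0 : ℝ) ≤ n) (by linarith : (0 : ℝ) ≤ n - 1))]

lemma qn_le3 (hv : v ≠ 0) (hn : 1 ≤ n) (lam : ℝ) : qn v n lam ≤ 3 * v ^ 2 := by
  unfold qn
  have h1 : (0 : ℝ) < n := by exact_mod_cast hn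
  rw [div_le_iff₀ (by positivity)]
  exact (QQ_le hv).trans (nn2_le hn)

lemma fn_zero : fn v n 0 = 0 := by
  unfold fn
  simp [FE_zero]

lemma fn_inc (hv : v ≠ 0) (hn : 1 ≤ n) {lam lam' : ℝ} (hl : 0 ≤ lam) (hl' : 0 ≤ lam') :
    fn v n lam ≤ fn v n lam' + 1 / 4 * (lam - lam') * qn v n lam
      + 3 / 4 * v ^ 2 * (√lam - √lam') ^ 2 := by
  have h1 : (0 : ℝ) < n := by exact_mod_cast hn
  have h := FE_inc (n := n) (c := √(lam / n)) (d := fun _ : Fin 1 => (0 : ℝ)) hv √(lam' / n)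
    (fun _ : Fin 1 => (0 : ℝ))
  have hS := nn2_le (v := v) hn
  rw [Real.sq_sqrt (by positivity), Real.sq_sqrt (by positivity)] at h
  simp only [sub_self, ne_eq, OfNat.ofNat_ne_zero, not_false_eq_true, zero_pow, Finset.sum_const_zero,
    zero_div, zero_mul, add_zero, sub_zero] at h
  have e : (√(lam' / n) - √(lam / n)) ^ 2 = (√lam - √lam') ^ 2 / n := by
    rw [Real.sqrt_div' _ h1.le, Real.sqrt_div' _ h1.le, ← sub_div, div_pow, Real.sq_sqrt h1.le]
    ring
  rw [e] at h
  have hm : (√lam - √lam') ^ 2 / n / 4 * (v ^ 2 * (n * (n + 2))) ≤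
      (√lam - √lam') ^ 2 / n / 4 * (3 * (v : ℝ) ^ 2 * (n : ℝ) ^ 2) :=
    mul_le_mul_of_nonneg_left hS (by positivity)
  unfold fn qn
  set Q := QQ n v √(lam / n) (fun _ : Fin 1 => (0 : ℝ))
  set A := FE n v √(lam / n) (fun _ : Fin 1 => (0 : ℝ))
  set A' := FE n v √(lam' / n) (fun _ : Fin 1 => (0 : ℝ))
  rw [div_le_iff₀ h1]
  have e2 : (A' / n + 1 / 4 * (lam - lam') * (Q / (n : ℝ) ^ 2) + 3 / 4 * v ^ 2 * (√lam - √lam') ^ 2) * n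
      = A' - (lam' / n - lam / n) / 4 * Q + (√lam - √lam') ^ 2 / n / 4 * (3 * (v : ℝ) ^ 2 * (n : ℝ) ^ 2) := by
    field_simp
    ring
  rw [e2]
  linarith

lemma fn_le_lin (hv : v ≠ 0) (hn : 1 ≤ n) {a : ℝ} (ha : 0 ≤ a) : fn v n a ≤ 3 / 2 * v ^ 2 * a := by
  have h := fn_inc hv hn ha le_rfl
  rw [fn_zero, Real.sqrt_zero, sub_zero, sub_zero, Real.sq_sqrt ha] at h
  have := mul_le_mul_of_nonneg_left (qn_le3 hv hn a) (by positivity : 0 ≤ 1 / 4 * a)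
  linarith

lemma sqrt_diff {a x y : ℝ} (ha : 0 < a) (hx : a ≤ x) (hy : a ≤ y) :
    (√y - √x) ^ 2 ≤ (y - x) ^ 2 / (4 * a) := by
  have h1 : √a ≤ √x := Real.sqrt_le_sqrt hx
  have h2 : √a ≤ √y := Real.sqrt_le_sqrt hy
  have h0 : 0 < √a := Real.sqrt_pos.2 ha
  have ea : √a ^ 2 = a := Real.sq_sqrt ha.le
  have ex : √x ^ 2 = x := Real.sq_sqrt (by linarith)
  have ey : √y ^ 2 = y := Real.sq_sqrt (by linarith)
  rw [le_div_iff₀ (by positivity)]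
  have e : (y - x) ^ 2 = (√y - √x) ^ 2 * (√y + √x) ^ 2 := by
    rw [← mul_pow, ← ey, ← ex, Real.sqrt_sq (by positivity), Real.sqrt_sq (by positivity)]; ring
  rw [e]
  apply mul_le_mul_of_nonneg_left _ (sq_nonneg _)
  calc 4 * a = (√a + √a) ^ 2 := by rw [← ea, Real.sqrt_sq h0.le]; ring
    _ ≤ _ := by gcongr

set_option maxHeartbeats 800000 in
lemma guerra (hv : v ≠ 0) (hn : 1 ≤ n) {lam q : ℝ} (hl : 0 ≤ lam) (hq : 0 ≤ q) :
    FE n v 0 (fun _ : Fin 1 => √(lam * q)) - lam * n * q ^ 2 / 4 ≤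
      FE n v √(lam / n) (fun _ : Fin 1 => 0) := by
  have h1 : (0 : ℝ) < n := by exact_mod_cast hn
  have hV : (0 : ℝ) ≤ v := v.2
  set c0 := √(lam / n) with hc0
  set d0 := √(lam * q) with hd0
  have ec : c0 ^ 2 = lam / n := Real.sq_sqrt (by positivity)
  have ed : d0 ^ 2 = lam * q := Real.sq_sqrt (by positivity)
  let G : ℝ → ℝ := fun θ => - FE n v (c0 * Real.sin θ) (fun _ : Fin 1 => d0 * Real.cos θ)
    - lam * n * q ^ 2 / 4 * Real.sin θ ^ 2
  have hG : G (Real.pi / 2) ≤ G 0 := by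
    refine telescope (B := c0 ^ 2 / 4 * (v ^ 2 * (n * (n + 2))) + d0 ^ 2 / 2 * (n * v))
      (by positivity) ?_
    intro x y hx hxy hy
    have h := FE_inc (n := n) (c := c0 * Real.sin x) (d := fun _ : Fin 1 => d0 * Real.cos x) hv
      (c0 * Real.sin y) (fun _ : Fin 1 => d0 * Real.cos y)
    have hRQ := (RR_sq_le (n := n) (v := v) (c := c0 * Real.sin x)
      (d := fun _ : Fin 1 => d0 * Real.cos x)).trans TT_le_QQ
    simp only [Finset.univ_unique, Finset.sum_singleton] at h
    simp only [G]
    set R := RR n v (c0 * Real.sin x) (fun _ : Fin 1 => d0 * Real.cos x)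
    set Q := QQ n v (c0 * Real.sin x) (fun _ : Fin 1 => d0 * Real.cos x)
    set A := FE n v (c0 * Real.sin x) (fun _ : Fin 1 => d0 * Real.cos x)
    set A' := FE n v (c0 * Real.sin y) (fun _ : Fin 1 => d0 * Real.cos y)
    have hsin : Real.sin x ≤ Real.sin y :=
      Real.sin_le_sin_of_le_of_le_pi_div_two (by linarith [Real.pi_pos]) hy hxy
    have hsx : 0 ≤ Real.sin x := Real.sin_nonneg_of_nonneg_of_le_pi hx (by linarith [Real.pi_pos])
    have hΔ : 0 ≤ Real.sin y ^ 2 - Real.sin x ^ 2 := by nlinarith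
    have hs2 : (Real.sin y - Real.sin x) ^ 2 ≤ (y - x) ^ 2 :=
      sq_le_sq.2 (by simpa [Real.dist_eq] using Real.abs_sin_sub_sin_le y x)
    have hc2 : (Real.cos y - Real.cos x) ^ 2 ≤ (y - x) ^ 2 :=
      sq_le_sq.2 (by simpa [Real.dist_eq] using Real.abs_cos_sub_cos_le y x)
    have b1 : (c0 * Real.sin y - c0 * Real.sin x) ^ 2 / 4 * (v ^ 2 * (n * (n + 2))) ≤
        c0 ^ 2 / 4 * (v ^ 2 * (n * (n + 2))) * (y - x) ^ 2 := by
      have : 0 ≤ c0 ^ 2 / 4 * ((v : ℝ) ^ 2 * (n * (n + 2))) := by positivity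
      exact le_trans (le_of_eq (by ring)) (mul_le_mul_of_nonneg_left hs2 this)
    have b2 : (d0 * Real.cos y - d0 * Real.cos x) ^ 2 / 2 * (n * v) ≤
        d0 ^ 2 / 2 * (n * v) * (y - x) ^ 2 := by
      have : 0 ≤ d0 ^ 2 / 2 * ((n : ℝ) * v) := by positivity
      exact le_trans (le_of_eq (by ring)) (mul_le_mul_of_nonneg_left hc2 this)
    have b3 : ((c0 * Real.sin y) ^ 2 - (c0 * Real.sin x) ^ 2) / 4 * Q
        + ((d0 * Real.cos y) ^ 2 - (d0 * Real.cos x) ^ 2) / 2 * R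
        = lam / n * (Real.sin y ^ 2 - Real.sin x ^ 2) / 4 * (Q - 2 * n * q * R) := by
      simp only [mul_pow, ec, ed, Real.cos_sq']
      field_simp
      ring
    have b4 : lam / n * (Real.sin y ^ 2 - Real.sin x ^ 2) / 4 * (-(n * q) ^ 2) ≤
        lam / n * (Real.sin y ^ 2 - Real.sin x ^ 2) / 4 * (Q - 2 * n * q * R) := by
      apply mul_le_mul_of_nonneg_left _ (by positivity)
      have := sq_nonneg (R - n * q)
      linarith [sub_sq R (n * q)]
    have b5 : lam / n * (Real.sin y ^ 2 - Real.sin x ^ 2) / 4 * (-(n * q) ^ 2) =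
        - (lam * n * q ^ 2 / 4 * (Real.sin y ^ 2 - Real.sin x ^ 2)) := by
      field_simp
    linarith
  simp only [G, Real.sin_pi_div_two, Real.cos_pi_div_two, Real.sin_zero, Real.cos_zero, mul_one,
    mul_zero] at hG
  linarith

lemma FE_side (hv : v ≠ 0) {t : ℝ} (ht : 0 ≤ t) :
    (n : ℝ) / 2 * (v * t ^ 2 - Real.log (1 + v * t ^ 2)) ≤ FE n v 0 (fun _ : Fin 1 => t) := by
  have hV : (0 : ℝ) < v := by exact_mod_cast pos_iff_ne_zero.2 hv
  set V : ℝ := (v : ℝ) with hVd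
  let G : ℝ → ℝ := fun s => (n : ℝ) / 2 * (V * s ^ 2 - Real.log (1 + V * s ^ 2))
    - FE n v 0 (fun _ : Fin 1 => s)
  have hG : G t ≤ G 0 := by
    refine telescope (B := n / 2 * (4 * V ^ 2 * t ^ 2) + n / 2 * V) ht ?_
    intro x y hx hxy hy
    have h := FE_inc (n := n) (c := 0) (d := fun _ : Fin 1 => x) hv 0 (fun _ : Fin 1 => y)
    have hsd := sd_model (n := n) (c := 0) (d := fun _ : Fin 1 => x) hv
    simp only [Finset.univ_unique, Finset.sum_singleton, sub_self, ne_eq, OfNat.ofNat_ne_zero,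
      not_false_eq_true, zero_pow, zero_div, zero_mul, zero_add, ← hVd] at h hsd
    simp only [G]
    set R := RR n v 0 (fun _ : Fin 1 => x)
    set A := FE n v 0 (fun _ : Fin 1 => x)
    set A' := FE n v 0 (fun _ : Fin 1 => y)
    have hux : 1 ≤ 1 + V * x ^ 2 := by linarith [mul_nonneg hV.le (sq_nonneg x)]
    have huy : 1 ≤ 1 + V * y ^ 2 := by linarith [mul_nonneg hV.le (sq_nonneg y)]
    set a := 1 + V * x ^ 2 with ha
    set b := 1 + V * y ^ 2 with hb
    have a0 : 0 < a := by linarith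
    have b0 : 0 < b := by linarith
    have hR : R = n * V * (1 - 1 / a) := by
      have : R * a = n * V * (a - 1) := by rw [ha]; linear_combination hsd
      field_simp
      linarith
    have hlog : 1 - a / b ≤ Real.log b - Real.log a := by
      have := Real.log_le_sub_one_of_pos (div_pos a0 b0)
      rw [Real.log_div a0.ne' b0.ne'] at this
      linarith
    have hab : b - a = V * (y ^ 2 - x ^ 2) := by rw [ha, hb]; ring
    have hfrac : (b - a) / a - (b - a) / b ≤ (b - a) ^ 2 := by
      have : (b - a) / a - (b - a) / b = (b - a) ^ 2 / (a * b) := by field_simp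
      rw [this]
      exact div_le_self (sq_nonneg _) (by nlinarith)
    have hw : (b - a) ^ 2 ≤ 4 * V ^ 2 * t ^ 2 * (y - x) ^ 2 := by
      have e : (b - a) ^ 2 = V ^ 2 * (y - x) ^ 2 * (y + x) ^ 2 := by rw [hab]; ring
      have e2 : (y + x) ^ 2 ≤ (2 * t) ^ 2 := by
        apply pow_le_pow_left₀ <;> linarith
      rw [e]
      nlinarith [mul_le_mul_of_nonneg_left e2 (by positivity : 0 ≤ V ^ 2 * (y - x) ^ 2)]
    have hbb : 1 - a / b = (b - a) / b := by field_simp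
    have hinc : (y ^ 2 - x ^ 2) / 2 * R = n / 2 * ((b - a) - (b - a) / a) := by
      rw [hR, hab]; field_simp
    have hn0 : (0 : ℝ) ≤ n / 2 := by positivity
    have hfin := mul_le_mul_of_nonneg_left (show (b - a) - (Real.log b - Real.log a) ≤
      (b - a) - (b - a) / a + 4 * V ^ 2 * t ^ 2 * (y - x) ^ 2 by linarith) hn0
    have eb : V * y ^ 2 = b - 1 := by rw [hb]; ring
    have ea : V * x ^ 2 = a - 1 := by rw [ha]; ring
    rw [eb, ea]
    rw [hinc] at h
    linarith
  simp only [G] at hG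
  have hz : FE n v 0 (fun _ : Fin 1 => (0 : ℝ)) = 0 := FE_zero
  rw [hz] at hG
  simp at hG
  linarith

/-- limiting free energy above the threshold -/
def Phi (v lam : ℝ) : ℝ := 1 / 4 * (lam * v ^ 2 - 1 / (lam * v ^ 2)) - 1 / 2 * Real.log (lam * v ^ 2)

lemma Phi_le_fn (hv : v ≠ 0) (hn : 1 ≤ n) {lam : ℝ} (hl : 1 / (v : ℝ) ^ 2 ≤ lam) :
    Phi v lam ≤ fn v n lam := by
  have hV : (0 : ℝ) < v := by exact_mod_cast pos_iff_ne_zero.2 hv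
  have h1 : (0 : ℝ) < n := by exact_mod_cast hn
  have hl0 : 0 < lam := lt_of_lt_of_le (by positivity) hl
  have hu : 1 ≤ lam * (v : ℝ) ^ 2 := by rwa [div_le_iff₀ (by positivity)] at hl
  set V : ℝ := (v : ℝ) with hVd
  set q := V - 1 / (lam * V) with hq
  have hq0 : 0 ≤ q := by
    rw [hq, sub_nonneg, div_le_iff₀ (by positivity)]; linarith
  have g := guerra (n := n) hv hn hl0.le hq0
  have s := FE_side (n := n) hv (Real.sqrt_nonneg (lam * q))
  rw [Real.sq_sqrt (by positivity), ← hVd] at s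
  have e : 1 + V * (lam * q) = lam * V ^ 2 := by rw [hq]; field_simp; ring
  have e' : V * (lam * q) = lam * V ^ 2 - 1 := by linarith
  rw [e, e'] at s
  unfold fn Phi
  rw [le_div_iff₀ h1]
  refine le_trans (le_of_eq ?_) ((sub_le_sub_right s _).trans g)
  rw [hq]
  field_simp
  ring

lemma Phi_inc {v x y : ℝ} (hv : 0 < v) (hx : 1 / v ^ 2 ≤ x) (hxy : x ≤ y) :
    1 / 4 * (y - x) * (v - 1 / (y * v)) ^ 2 - 1 / 2 * v ^ 4 * (y - x) ^ 2 ≤ Phi v y - Phi v x := by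
  have hu : 1 ≤ x * v ^ 2 := by rwa [div_le_iff₀ (by positivity)] at hx
  have hx0 : 0 < x := lt_of_lt_of_le (by positivity) hx
  have hy0 : 0 < y := hx0.trans_le hxy
  unfold Phi
  have e1 : (v - 1 / (y * v)) ^ 2 = v ^ 2 * (1 - 1 / (y * v ^ 2)) ^ 2 := by field_simp
  have e2 : 1 / 4 * (y - x) * (v ^ 2 * (1 - 1 / (y * v ^ 2)) ^ 2) =
      1 / 4 * (y * v ^ 2 - x * v ^ 2) * (1 - 1 / (y * v ^ 2)) ^ 2 := by ring
  have e3 : 1 / 2 * v ^ 4 * (y - x) ^ 2 = 1 / 2 * (y * v ^ 2 - x * v ^ 2) ^ 2 := by ring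
  rw [e1, e2, e3]
  have huw : x * v ^ 2 ≤ y * v ^ 2 := by gcongr
  generalize x * v ^ 2 = a at *
  generalize y * v ^ 2 = b at *
  have a0 : 0 < a := by linarith
  have b0 : 0 < b := by linarith
  have hlog : Real.log b - Real.log a ≤ b / a - 1 := by
    have := Real.log_le_sub_one_of_pos (div_pos b0 a0)
    rwa [Real.log_div b0.ne' a0.ne'] at this
  have key : 1 / 4 * (b - a) * (1 - 1 / b) ^ 2 - 1 / 2 * (b - a) ^ 2 ≤
      1 / 4 * (b - 1 / b) - 1 / 4 * (a - 1 / a) - 1 / 2 * (b / a - 1) := by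
    have : 1 / 4 * (b - 1 / b) - 1 / 4 * (a - 1 / a) - 1 / 2 * (b / a - 1)
      - 1 / 4 * (b - a) * (1 - 1 / b) ^ 2 = 1 / 4 * (b - a) ^ 2 * (1 / (b ^ 2 * a)) -
        1 / 2 * (b - a) ^ 2 * (1 / (a * b)) := by
      field_simp
      ring
    have h1 : 0 ≤ 1 / 4 * (b - a) ^ 2 * (1 / (b ^ 2 * a)) := by positivity
    have h2 : 1 / (a * b) ≤ 1 := by
      rw [div_le_one (by positivity)]; nlinarith
    have h3 := mul_le_mul_of_nonneg_left h2 (by positivity : 0 ≤ 1 / 2 * (b - a) ^ 2)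
    linarith
  linarith

lemma Phi_crit {v : ℝ} (hv : 0 < v) : Phi v (1 / v ^ 2) = 0 := by
  unfold Phi
  rw [div_mul_cancel₀ _ (by positivity)]
  simp

lemma fn_le_Phi (hv : v ≠ 0) {L κ : ℝ} (hL : 1 / (v : ℝ) ^ 2 ≤ L) (hκ : 0 < κ) :
    ∀ᶠ n : ℕ in atTop, ∀ lam, 1 / (v : ℝ) ^ 2 ≤ lam → lam ≤ L → fn v n lam ≤ Phi v lam + κ := by
  have hV : (0 : ℝ) < v := by exact_mod_cast pos_iff_ne_zero.2 hv
  have hc0 : 0 < 1 / (v : ℝ) ^ 2 := by positivity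
  set lc := 1 / (v : ℝ) ^ 2 with hlc
  have hL0 : 0 < L := hc0.trans_le hL
  set a := min lc (κ / (3 * (v : ℝ) ^ 2)) with ha
  have ha0 : 0 < a := lt_min hc0 (by positivity)
  have hac : a ≤ lc := min_le_left _ _
  have haκ : 3 / 2 * (v : ℝ) ^ 2 * a ≤ κ / 2 := by
    have : a ≤ κ / (3 * (v : ℝ) ^ 2) := min_le_right _ _
    rw [le_div_iff₀ (by positivity)] at this
    linarith
  set τ := 2 * κ / L with hτ
  have hτ0 : 0 < τ := by positivity
  have hLτ : L * τ = 2 * κ := by rw [hτ]; field_simp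
  filter_upwards [qn_le hv ha0 hτ0, eventually_ge_atTop 1] with n hq hn lam hlam1 hlam2
  have base := fn_le_lin hv hn ha0.le
  have step : ∀ x y, a ≤ x → x ≤ y → fn v n y ≤ fn v n x +
      1 / 4 * (y - x) * (max (v - 1 / (y * v)) 0 ^ 2 + τ) + 3 / 4 * v ^ 2 / (4 * a) * (y - x) ^ 2 := by
    intro x y hx hxy
    have i1 := fn_inc hv hn (lam := y) (lam' := x) (by linarith) (by linarith)
    have i2 := sqrt_diff ha0 hx (hx.trans hxy)
    have i3 := mul_le_mul_of_nonneg_left i2 (by positivity : 0 ≤ 3 / 4 * (v : ℝ) ^ 2)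
    have i4 := mul_le_mul_of_nonneg_left (hq y (hx.trans hxy))
      (by linarith : 0 ≤ 1 / 4 * (y - x))
    have i5 : 3 / 4 * (v : ℝ) ^ 2 * ((y - x) ^ 2 / (4 * a)) =
      3 / 4 * v ^ 2 / (4 * a) * (y - x) ^ 2 := by ring
    linarith
  have t1 : fn v n lc - lc * τ / 4 ≤ fn v n a - a * τ / 4 := by
    refine telescope (G := fun x => fn v n x - x * τ / 4) (B := 3 / 4 * v ^ 2 / (4 * a)) hac ?_
    intro x y hx hxy hy
    have s := step x y hx hxy
    have hm : max ((v : ℝ) - 1 / (y * v)) 0 = 0 := by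
      apply max_eq_right
      have hy0 : 0 < y := by linarith
      rw [sub_nonpos, le_div_iff₀ (by positivity)]
      rw [hlc, le_div_iff₀ (by positivity)] at hy
      linarith
    rw [hm] at s
    linarith
  have t2 : fn v n lam - Phi v lam - lam * τ / 4 ≤ fn v n lc - Phi v lc - lc * τ / 4 := by
    refine telescope (G := fun x => fn v n x - Phi v x - x * τ / 4)
      (B := 3 / 4 * v ^ 2 / (4 * a) + 1 / 2 * v ^ 4) hlam1 ?_
    intro x y hx hxy hy
    have s := step x y (hac.trans hx) hxy
    have hm : max ((v : ℝ) - 1 / (y * v)) 0 = v - 1 / (y * v) := by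
      apply max_eq_left
      have hy0 : 0 < y := by linarith
      have := hx.trans hxy
      rw [hlc, div_le_iff₀ (by positivity)] at this
      rw [sub_nonneg, div_le_iff₀ (by positivity)]
      linarith
    rw [hm] at s
    have p := Phi_inc hV hx hxy
    linarith
  rw [hlc, Phi_crit hV, ← hlc] at t2
  have : lam * τ ≤ L * τ := by gcongr
  have : 0 < a * τ := by positivity
  linarith

lemma qn_tendsto_zero (hv : v ≠ 0) {lam : ℝ} (hl : 0 < lam) (hlam : lam ≤ 1 / (v : ℝ) ^ 2) :
    Tendsto (fun n => qn v n lam) atTop (nhds 0) := by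
  have hV : (0 : ℝ) < v := by exact_mod_cast pos_iff_ne_zero.2 hv
  rw [Metric.tendsto_atTop']
  intro ε hε
  have hm : max ((v : ℝ) - 1 / (lam * v)) 0 = 0 := by
    apply max_eq_right
    rw [sub_nonpos, le_div_iff₀ (by positivity)]
    rw [le_div_iff₀ (by positivity)] at hlam
    linarith
  obtain ⟨N, hN⟩ := eventually_atTop.1 (qn_le hv hl (half_pos hε))
  refine ⟨N, fun n hn => ?_⟩
  have := hN n hn.le lam le_rfl
  rw [hm] at this
  rw [Real.dist_eq, sub_zero, abs_of_nonneg (qn_nonneg _)]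
  linarith

lemma qn_tendsto_pos (hv : v ≠ 0) {lam : ℝ} (hlam : 1 / (v : ℝ) ^ 2 < lam) :
    Tendsto (fun n => qn v n lam) atTop (nhds ((v - 1 / (lam * v)) ^ 2)) := by
  have hV : (0 : ℝ) < v := by exact_mod_cast pos_iff_ne_zero.2 hv
  have hc0 : 0 < 1 / (v : ℝ) ^ 2 := by positivity
  have hl : 0 < lam := hc0.trans hlam
  have hm : max ((v : ℝ) - 1 / (lam * v)) 0 = v - 1 / (lam * v) := by
    apply max_eq_left
    have := hlam.le
    rw [div_le_iff₀ (by positivity)] at this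
    rw [sub_nonneg, div_le_iff₀ (by positivity)]
    linarith
  rw [tendsto_order]
  constructor
  · intro A hA
    set lc := 1 / (v : ℝ) ^ 2 with hlc
    set B : ℝ := 3 / 4 * v ^ 2 * (v ^ 2 / 4) + 1 / 2 * v ^ 4 + 1 with hB
    have hB0 : 0 < B := by positivity
    set Qs := ((v : ℝ) - 1 / (lam * v)) ^ 2 with hQs
    set h := min (lam - lc) ((Qs - A) / (8 * B)) with hh
    have hh0 : 0 < h := lt_min (by linarith) (div_pos (by linarith) (by positivity))
    have hh1 : h ≤ lam - lc := min_le_left _ _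
    have hh2 : h * (8 * B) ≤ Qs - A := by
      rw [← le_div_iff₀ (by positivity)]; exact min_le_right _ _
    filter_upwards [fn_le_Phi hv hlam.le (by positivity : 0 < h ^ 2), eventually_ge_atTop 1]
      with n hP hn
    have u := hP (lam - h) (by linarith) (by linarith)
    have l := Phi_le_fn (n := n) hv hn hlam.le
    have i := fn_inc (n := n) hv hn (lam := lam) (lam' := lam - h) hl.le (by linarith)
    have s := sqrt_diff hc0 (x := lam - h) (y := lam) (by linarith) hlam.le
    have p := Phi_inc hV (x := lam - h) (y := lam) (by linarith) (by linarith)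
    rw [sub_sub_cancel] at i s p
    have e : h ^ 2 / (4 * (1 / (v : ℝ) ^ 2)) = v ^ 2 / 4 * h ^ 2 := by field_simp
    rw [e] at s
    have s' := mul_le_mul_of_nonneg_left s (by positivity : 0 ≤ 3 / 4 * (v : ℝ) ^ 2)
    rw [← hQs] at p
    have k : 1 / 4 * h * Qs - B * h ^ 2 ≤ 1 / 4 * h * qn v n lam := by
      rw [hB]; linarith
    have k2 : h * (Qs - 4 * B * h) ≤ h * qn v n lam := by linarith
    have k3 := le_of_mul_le_mul_left k2 hh0
    linarith
  · intro A hA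
    filter_upwards [qn_le hv hl (half_pos (sub_pos.2 hA))] with n hn
    have := hn lam le_rfl
    rw [hm] at this
    linarith

lemma MMSE_eq (sig lam : ℝ) (hs : 0 < sig) (hn : 1 ≤ n) :
    MMSE n sig lam = sig ^ 4 + sig ^ 4 * 2 / n - qn (Real.toNNReal (sig ^ 2)) n lam := by
  have h1 : (0 : ℝ) < n := by exact_mod_cast hn
  rw [link 1 sig lam hs]
  unfold qn
  field_simp

lemma MMSE_tendsto {sig lam q : ℝ} (hs : 0 < sig)
    (h : Tendsto (fun n => qn (Real.toNNReal (sig ^ 2)) n lam) atTop (nhds q)) :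
    Tendsto (fun n => MMSE n sig lam) atTop (nhds (sig ^ 4 - q)) := by
  have h2 : Tendsto (fun n : ℕ => sig ^ 4 + sig ^ 4 * 2 / (n : ℝ)
      - qn (Real.toNNReal (sig ^ 2)) n lam) atTop (nhds (sig ^ 4 + 0 - q)) :=
    (tendsto_const_nhds.add (tendsto_const_div_atTop_nhds_zero_nat _)).sub h
  rw [add_zero] at h2
  refine h2.congr' ?_
  filter_upwards [eventually_ge_atTop 1] with n hn
  exact (MMSE_eq sig lam hs hn).symm

lemma final (sig : ℝ) (hs : 0 < sig) (lam : ℝ) (hl : 0 < lam) :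
    (lam ≤ 1 / sig ^ 4 → Tendsto (fun n => MMSE n sig lam) atTop (nhds (sig ^ 4))) ∧
    (1 / sig ^ 4 ≤ lam → Tendsto (fun n => MMSE n sig lam) atTop
      (nhds (2 / lam - 1 / (lam ^ 2 * sig ^ 4)))) := by
  have hv : Real.toNNReal (sig ^ 2) ≠ 0 := by
    rw [← pos_iff_ne_zero, Real.toNNReal_pos]; positivity
  have hcoe : ((Real.toNNReal (sig ^ 2) : NNReal) : ℝ) = sig ^ 2 :=
    Real.coe_toNNReal _ (by positivity)
  have h4 : (sig ^ 2) ^ 2 = sig ^ 4 := by ring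
  have part1 : lam ≤ 1 / sig ^ 4 → Tendsto (fun n => MMSE n sig lam) atTop (nhds (sig ^ 4)) := by
    intro h
    have := MMSE_tendsto hs (qn_tendsto_zero hv hl (by rw [hcoe, h4]; exact h))
    rwa [sub_zero] at this
  refine ⟨part1, fun h => ?_⟩
  rcases h.eq_or_lt with h | h
  · have e : 2 / lam - 1 / (lam ^ 2 * sig ^ 4) = sig ^ 4 := by
      rw [← h]; field_simp; ring
    rw [e]
    exact part1 h.ge
  · have := MMSE_tendsto hs (qn_tendsto_pos hv (by rw [hcoe, h4]; exact h))
    rw [hcoe] at this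
    convert this using 2
    field_simp
    ring

end Aux

/-- The limiting matrix-MMSE formula, assuming uniform convergence
of `MMSE_n` in `λ` on compact subsets of `ℝ₊`. -/
theorem mmse_limit_formula (sig : ℝ) (hsig : 0 < sig) (F : ℝ → ℝ)
    (hunif : ∀ K : Set ℝ, IsCompact K → K ⊆ Set.Ioi 0 →
      TendstoUniformlyOn (fun n lam => MMSE n sig lam) F atTop K) :
    ∀ lam : ℝ, 0 < lam →
      (lam ≤ 1 / sig ^ 4 →
        Tendsto (fun n => MMSE n sig lam) atTop (nhds (sig ^ 4))) ∧
      (1 / sig ^ 4 ≤ lam →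
        Tendsto (fun n => MMSE n sig lam) atTop
          (nhds (2 / lam - 1 / (lam ^ 2 * sig ^ 4)))) := by
  intro lam hlam
  exact Aux.final sig hsig lam hlam

end
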